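/- arXiv:2503.22535 — 2 statements merged into one kernel-verified Lean document; each statement's English description precedes it below -/
import Mathlib

section
/- Fix, for every (β,s)∈Δ⁺×ℤ, a choice of parameters and decompositions defining the quantum root vector E_{β,s}. Then for every k∈ℕ^n, every d∈KP(k), every h∈H_{k,d}, and every d′∈KP(k) with d′<d, one has φ_{d′}(Ψ(E_h)) = 0. -/
noncomputable section
open scoped BigOperators DirectSum

/-! ### Base field ℚ(v) and quantum numbers -/

/-- the base field `ℚ(v)`. -/
abbrev KK : Type := RatFunc ℚ
/-- the variable `v ∈ ℚ(v)`. -/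
def vv : KK := RatFunc.X
/-- integer powers of `v`. -/
def vpow (m : ℤ) : KK := vv ^ m
/-- the quantum integer `[m]_u = (uᵐ - u⁻ᵐ)/(u - u⁻¹)`. -/
def qInt (u : KK) (m : ℕ) : KK := (u ^ (m : ℤ) - u ^ (-(m : ℤ))) / (u - u⁻¹)
/-- the quantum factorial `[m]_u!`. -/
def qFact (u : KK) (m : ℕ) : KK := ∏ k ∈ Finset.range m, qInt u (k + 1)
/-- the quantum binomial coefficient. -/
def qBinom (u : KK) (m k : ℕ) : KK := qFact u m / (qFact u k * qFact u (m - k))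
/-- `⟨m⟩_v = vᵐ - v⁻ᵐ`. -/
def qBrack (m : ℕ) : KK := vpow (m : ℤ) - vpow (-(m : ℤ))
/-- the sign `ε ∈ {+,-}` as `±1`. -/
def sgn (ε : Bool) : ℤ := if ε then 1 else -1
/-- `l` is an integer power of `v`. -/
def IsVpow (l : KK) : Prop := ∃ m : ℤ, l = vpow m

/-! ### Cartan data of types `C_n` and `D_n` (1-based indices) -/

/-- the Cartan matrix of type `C_n` (1-based indices). -/
def aC (n i j : ℕ) : ℤ :=
  if i = j then 2 else if i + 1 = n ∧ j = n then -2
  else if i + 1 = j ∨ j + 1 = i then -1 else 0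
/-- the symmetrizing integers `d_i` of type `C_n`. -/
def dC (n i : ℕ) : ℕ := if i = n then 2 else 1
/-- the Cartan matrix of type `D_n` (1-based indices). -/
def aD (n i j : ℕ) : ℤ :=
  if i = j then 2
  else if (i + 1 = j ∧ j + 1 ≤ n) ∨ (j + 1 = i ∧ i + 1 ≤ n) then -1
  else if (i + 2 = n ∧ j = n) ∨ (j + 2 = n ∧ i = n) then -1 else 0
/-- the symmetrizing integers `d_i` of type `D_n` (all equal to `1`). -/
def dD (n i : ℕ) : ℕ := 1

/-! ### The positive subalgebra of the quantum loop algebra, for Cartan data `(A, Dd)` -/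

section Ualg
variable (n : ℕ) (A : ℕ → ℕ → ℤ) (Dd : ℕ → ℕ)

/-- the free `ℚ(v)`-algebra on generators `e_{i,r}`, `i ∈ I`, `r ∈ ℤ`. -/
abbrev FA := FreeAlgebra KK (Fin n × ℤ)
/-- the free generator `e_{i,r}`. -/
def fg (i : Fin n) (r : ℤ) : FA n := FreeAlgebra.ι KK (i, r)

/-- the `z^{-r₁}⋯z^{-r_m}w^{-t}`-coefficient of the Serre relation between colors `i ≠ j`. -/
def serreElt (i j : Fin n) (m : ℕ) (r : Fin m → ℤ) (t : ℤ) : FA n :=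
  ∑ σ : Equiv.Perm (Fin m), ∑ k ∈ Finset.range (m + 1),
    ((-1 : KK) ^ k * qBinom (vpow (Dd (i.1 + 1))) m k) •
      (((List.ofFn fun l => fg n i (r (σ l))).take k
        ++ fg n j t :: (List.ofFn fun l => fg n i (r (σ l))).drop k).prod)

/-- the defining relations of `U_v^>(Lg)` in the new Drinfeld realization: the coefficients of
`(z - v_i^{a_ij} w) e_i(z) e_j(w) = (v_i^{a_ij} z - w) e_j(w) e_i(z)` and of the Serre relations. -/
inductive URel : FA n → FA n → Prop
  | loop (i j : Fin n) (r s : ℤ) :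
      URel (fg n i (r + 1) * fg n j s
             - vpow ((Dd (i.1 + 1) : ℤ) * A (i.1 + 1) (j.1 + 1)) • (fg n i r * fg n j (s + 1)))
           (vpow ((Dd (i.1 + 1) : ℤ) * A (i.1 + 1) (j.1 + 1)) • (fg n j s * fg n i (r + 1))
             - fg n j (s + 1) * fg n i r)
  | serre (i j : Fin n) (hij : i ≠ j) (r : Fin (1 - A (i.1 + 1) (j.1 + 1)).toNat → ℤ) (t : ℤ) :
      URel (serreElt n Dd i j _ r t) 0

/-- the positive subalgebra `U_v^>(Lg)` of the quantum loop algebra. -/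
abbrev UA := RingQuot (URel n A Dd)
/-- the generator `e_{i,r}` of `U_v^>(Lg)`. -/
def ug (i : Fin n) (r : ℤ) : UA n A Dd := RingQuot.mkAlgHom KK (URel n A Dd) (fg n i r)
/-- the generator `e_{i,r}` with a 1-based index `1 ≤ i ≤ n` (and junk value `0` otherwise). -/
def g1 (i : ℕ) (r : ℤ) : UA n A Dd := if h : 1 ≤ i ∧ i ≤ n then ug n A Dd ⟨i - 1, by omega⟩ r else 0

end Ualg

/-! ### `q`-brackets, ordered monomials, and ℤ[v,v⁻¹]-forms -/

section Aux
variable {B : Type} [Ring B] [Module KK B]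

/-- the `u`-commutator `[x,y]_u = xy - u · yx`. -/
def qcm (u : KK) (x y : B) : B := x * y - u • (y * x)

/-- the iterated `q`-bracket `[⋯[[g i₁ s₁, g i₂ s₂]_{λ₁}, g i₃ s₃]_{λ₂}, ⋯]_{λ_{ℓ-1}}`. -/
def chainE (g : ℕ → ℤ → B) (w : List ℕ) (ss : List ℤ) (ls : List KK) : B :=
  match w, ss with
  | i :: w', s :: ss' =>
      ((w'.zip ss').zip ls).foldl
        (fun acc p => acc * g p.1.1 p.1.2 - p.2 • (g p.1.1 p.1.2 * acc)) (g i s)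
  | _, _ => 0
end Aux

section Mon
variable {B : Type} [Ring B] {ι : Type} [LinearOrder ι]
/-- the ordered monomial `∏→ (E p)^(h p)`, the product taken in increasing order of `p`. -/
def ordMon (E : ι → B) (h : ι →₀ ℕ) : B := ((h.support.sort (· ≤ ·)).map (fun p => E p ^ h p)).prod
end Mon

/-- the subring `ℤ[v,v⁻¹] ⊆ ℚ(v)`. -/
def Rint : Subring KK := Subring.closure {vv, vv⁻¹}

section Forms
variable {B : Type} [Ring B] [Algebra KK B]
/-- the `ℤ[v,v⁻¹]`-subalgebra of a `ℚ(v)`-algebra generated by a set `X`, realized as the subring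
generated by `X` together with the central scalars `v^{±1}`. -/
def zvForm (X : Set B) : Subring B :=
  Subring.closure ({algebraMap KK B vv, algebraMap KK B vv⁻¹} ∪ X)
end Forms

/-! ### Positive roots of type `C_n` with the fixed convex (lexicographic) order -/

section RootsC
variable (n : ℕ)

/-- Positive roots of type `C_n`, encoded as lexicographically ordered pairs `(i,t)`:
`[i,i+t]` for `i+t<n` or `i=n`; `[i,n,i]` for `i+t=n`, `i<n`; `[i,n]` for `i+t=n+1`;
`[i,n,j]` with `j = 2n+1-i-t` for `i+t ≥ n+2`.  The induced linear order is exactly the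
convex order coming from standard Lyndon words. -/
def IsPosRootC (p : Fin (n + 1) ×ₗ Fin (2 * n + 1)) : Prop :=
  1 ≤ ((ofLex p).1 : ℕ) ∧ (((ofLex p).1 : ℕ) = n → ((ofLex p).2 : ℕ) = 0) ∧
    ((ofLex p).2 : ℕ) + 2 * ((ofLex p).1 : ℕ) ≤ 2 * n

instance : DecidablePred (IsPosRootC n) := fun p => by unfold IsPosRootC; infer_instance

/-- the set `Δ⁺` of positive roots of type `C_n`, with its convex linear order. -/
abbrev PosRootC := {p : Fin (n + 1) ×ₗ Fin (2 * n + 1) // IsPosRootC n p}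

variable {n}
/-- the first index `i` of a positive root. -/
def ri (β : PosRootC n) : ℕ := ((ofLex β.1).1 : ℕ)
/-- the offset `t` of a positive root within its block. -/
def rt (β : PosRootC n) : ℕ := ((ofLex β.1).2 : ℕ)

/-- multiplicity of `α_c` (1-based color `c`) in the positive root `β` (type `C_n`). -/
def nuC (β : PosRootC n) (c : ℕ) : ℕ :=
  let i := ri β; let t := rt β
  if i + t < n ∨ i = n then (if i ≤ c ∧ c ≤ i + t then 1 else 0)
  else if i + t = n then (if i ≤ c ∧ c ≤ n - 1 then 2 else if c = n then 1 else 0)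
  else if i + t = n + 1 then (if i ≤ c ∧ c ≤ n then 1 else 0)
  else (if i ≤ c ∧ c < 2 * n + 1 - i - t then 1
        else if 2 * n + 1 - i - t ≤ c ∧ c ≤ n - 1 then 2
        else if c = n then 1 else 0)

/-- standard Lyndon word (list of 1-based simple-root indices) of `β` (type `C_n`). -/
def wordC (β : PosRootC n) : List ℕ :=
  let i := ri β; let t := rt β
  if i + t < n ∨ i = n then List.range' i (t + 1)
  else if i + t = n then List.range' i (n - i) ++ List.range' i (n - i) ++ [n]
  else if i + t = n + 1 then List.range' i (n - i + 1)
  else List.range' i (n - i + 1) ++ (List.range' (2 * n + 1 - i - t) (n - (2 * n + 1 - i - t))).reverse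

/-- the height `|β|` of a positive root (type `C_n`). -/
def heightC (β : PosRootC n) : ℕ := (wordC β).length

/-- `β` is a root of the form `[i,n,i]`. -/
def isINI (β : PosRootC n) : Prop := ri β + rt β = n ∧ ri β < n
instance (β : PosRootC n) : Decidable (isINI β) := by unfold isINI; infer_instance
end RootsC

/-! ### General quantum root vectors of type `C_n` -/

section RVC
variable (n : ℕ)

/-- the positive subalgebra `U_v^>(Lsp_{2n})`. -/
abbrev UC := UA n (aC n) (dC n)
/-- generators of `U_v^>(Lsp_{2n})` with 1-based indices. -/
def genC : ℕ → ℤ → UC n := g1 n (aC n) (dC n)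

variable {n}
/-- `E` is a quantum root vector `E_{β,s}` for a root of "chain" type, i.e. obtained by an
iterated `q`-bracket along the standard Lyndon word of `β` for some choice of the parameters
`λ_k ∈ v^ℤ` and of a decomposition of `s`. -/
def IsRVCchain (β : PosRootC n) (s : ℤ) (E : UC n) : Prop :=
  ∃ (ss : List ℤ) (ls : List KK),
    ss.length = (wordC β).length ∧ ls.length + 1 = (wordC β).length ∧ ss.sum = s ∧
    (∀ l ∈ ls, IsVpow l) ∧ E = chainE (genC n) (wordC β) ss ls

/-- `E` is a quantum root vector `E_{β,s}` of type `C_n` for some choice of the parameters: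
for `β ≠ [i,n,i]` an iterated `q`-bracket along the standard Lyndon word of `β`, and for
`β = [i,n,i]` a `q`-bracket `[E_{[i,n-1],s₁}, E_{[i,n],s₂}]_λ`. -/
def IsRVC (β : PosRootC n) (s : ℤ) (E : UC n) : Prop :=
  if isINI β then
    ∃ (β₁ β₂ : PosRootC n) (s₁ s₂ : ℤ) (lam : KK) (E₁ E₂ : UC n),
      (ri β₁ = ri β ∧ ri β₁ + rt β₁ + 1 = n) ∧ (ri β₂ = ri β ∧ ri β₂ + rt β₂ = n + 1) ∧
      IsVpow lam ∧ IsRVCchain β₁ s₁ E₁ ∧ IsRVCchain β₂ s₂ E₂ ∧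
      s = s₁ + s₂ ∧ E = qcm lam E₁ E₂
  else IsRVCchain β s E
end RVC

section Shuffle
variable (n : ℕ) (A : ℕ → ℕ → ℤ) (Dd : ℕ → ℕ)

abbrev Vars (k : Fin n → ℕ) : Type := Σ i : Fin n, Fin (k i)
abbrev Pk (k : Fin n → ℕ) := MvPolynomial (Vars n k) KK
abbrev Fk (k : Fin n → ℕ) := FractionRing (Pk n k)

def xvr {k : Fin n → ℕ} (u : Vars n k) : Fk n k := algebraMap (Pk n k) (Fk n k) (MvPolynomial.X u)
def cf {k : Fin n → ℕ} (a : KK) : Fk n k := algebraMap KK (Fk n k) a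

def emb1f (k l : Fin n → ℕ) : Vars n k → Vars n (k + l) :=
  fun u => ⟨u.1, ⟨u.2.1, by have h := u.2.2; show u.2.1 < k u.1 + l u.1; omega⟩⟩
def emb2f (k l : Fin n → ℕ) : Vars n l → Vars n (k + l) :=
  fun u => ⟨u.1, ⟨k u.1 + u.2.1, by have h := u.2.2; show k u.1 + u.2.1 < k u.1 + l u.1; omega⟩⟩

lemma emb1f_inj (k l : Fin n → ℕ) : Function.Injective (emb1f n k l) := by
  rintro ⟨i, r⟩ ⟨j, s⟩ h
  simp only [emb1f, Sigma.mk.inj_iff] at h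
  obtain ⟨rfl, h2⟩ := h
  rw [heq_iff_eq, Fin.mk.injEq] at h2
  exact congrArg _ (Fin.ext h2)

lemma emb2f_inj (k l : Fin n → ℕ) : Function.Injective (emb2f n k l) := by
  rintro ⟨i, r⟩ ⟨j, s⟩ h
  simp only [emb2f, Sigma.mk.inj_iff] at h
  obtain ⟨rfl, h2⟩ := h
  rw [heq_iff_eq, Fin.mk.injEq] at h2
  exact congrArg _ (Fin.ext (by omega))

def permVf {m : Fin n → ℕ} (σ : ∀ i, Equiv.Perm (Fin (m i))) : Vars n m → Vars n m :=
  fun u => ⟨u.1, σ u.1 u.2⟩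

lemma permVf_inj {m : Fin n → ℕ} (σ : ∀ i, Equiv.Perm (Fin (m i))) :
    Function.Injective (permVf n σ) := by
  rintro ⟨i, r⟩ ⟨j, s⟩ h
  simp only [permVf, Sigma.mk.inj_iff] at h
  obtain ⟨rfl, h2⟩ := h
  rw [heq_iff_eq] at h2
  exact congrArg _ ((σ i).injective h2)

/-- extension of an (injective) renaming of variables to fraction fields. -/
def liftHom {k m : Fin n → ℕ} (f : Vars n k → Vars n m) (hf : Function.Injective f) :
    Fk n k →+* Fk n m :=
  IsFractionRing.lift (g := (algebraMap (Pk n m) (Fk n m)).comp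
      (MvPolynomial.rename f).toRingHom)
    (by
      rw [RingHom.coe_comp]
      exact Function.Injective.comp (IsFractionRing.injective _ _)
        (by simpa using MvPolynomial.rename_injective (R := KK) f hf))

def emb1 (k l : Fin n → ℕ) : Fk n k →+* Fk n (k + l) := liftHom n (emb1f n k l) (emb1f_inj n k l)
def emb2 (k l : Fin n → ℕ) : Fk n l →+* Fk n (k + l) := liftHom n (emb2f n k l) (emb2f_inj n k l)
def permF {m : Fin n → ℕ} (σ : ∀ i, Equiv.Perm (Fin (m i))) : Fk n m →+* Fk n m :=
  liftHom n (permVf n σ) (permVf_inj n σ)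

/-- the product of `ζ`-factors in the shuffle product. -/
def zfac (k l : Fin n → ℕ) : Fk n (k + l) :=
  ∏ i : Fin n, ∏ j : Fin n, ∏ r : Fin (k i), ∏ s : Fin (l j),
    (xvr n (emb1f n k l ⟨i, r⟩) -
        cf n (vpow (-((Dd (i.1 + 1) : ℤ) * A (i.1 + 1) (j.1 + 1)))) * xvr n (emb2f n k l ⟨j, s⟩)) /
      (xvr n (emb1f n k l ⟨i, r⟩) - xvr n (emb2f n k l ⟨j, s⟩))

/-- the shuffle product on homogeneous components. -/
def shufMul (k l : Fin n → ℕ) (F : Fk n k) (G : Fk n l) : Fk n (k + l) :=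
  (((∏ i, Nat.factorial (k i)) * (∏ i, Nat.factorial (l i)) : ℕ) : KK)⁻¹ •
    ∑ σ : ∀ i : Fin n, Equiv.Perm (Fin ((k + l) i)),
      permF n σ (emb1 n k l F * emb2 n k l G * zfac n A Dd k l)

abbrev BigS := ⨁ k : Fin n → ℕ, Fk n k

open Classical in
/-- the shuffle product, extended bilinearly to the direct sum. -/
def bstar (x y : BigS n) : BigS n :=
  DFinsupp.sum x fun k xk => DFinsupp.sum y fun l yl =>
    DirectSum.of (fun k => Fk n k) (k + l) (shufMul n A Dd k l xk yl)

def Dpoly (k : Fin n → ℕ) : Pk n k :=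
  ∏ i : Fin n, ∏ j : Fin n,
    if i < j ∧ A (i.1 + 1) (j.1 + 1) ≠ 0 then
      ∏ r : Fin (k i), ∏ s : Fin (k j), (MvPolynomial.X ⟨i, r⟩ - MvPolynomial.X (⟨j, s⟩ : Vars n k))
    else 1

def xProd (k : Fin n → ℕ) : Pk n k := ∏ u : Vars n k, MvPolynomial.X u

/-- `f` is symmetric in the variables of each color. -/
def symmQ {k : Fin n → ℕ} (f : Pk n k) : Prop :=
  ∀ σ : ∀ i, Equiv.Perm (Fin (k i)), MvPolynomial.rename (permVf n σ) f = f

def wheelSub {k : Fin n → ℕ} (i j : Fin n) (m : ℕ) (hm : 0 < m)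
    (s : Fin m → Fin (k i)) (r : Fin (k j)) : Vars n k → Pk n k := fun u =>
  if u = ⟨j, r⟩ then
    MvPolynomial.C (vpow ((Dd (i.1 + 1) : ℤ) * A (i.1 + 1) (j.1 + 1))) *
      MvPolynomial.X ⟨i, s ⟨0, hm⟩⟩
  else if h : ∃ t : Fin m, u = ⟨i, s t⟩ then
    MvPolynomial.C (vpow ((Dd (i.1 + 1) : ℤ) * (-2 * (h.choose.1 : ℤ)))) *
      MvPolynomial.X ⟨i, s ⟨0, hm⟩⟩
  else MvPolynomial.X u

/-- the wheel conditions. -/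
def wheelQ {k : Fin n → ℕ} (f : Pk n k) : Prop :=
  ∀ (i j : Fin n), i ≠ j → ∀ hA : A (i.1 + 1) (j.1 + 1) < 0,
    ∀ s : Fin (1 - A (i.1 + 1) (j.1 + 1)).toNat → Fin (k i), Function.Injective s →
      ∀ r : Fin (k j),
        MvPolynomial.aeval (wheelSub n A Dd i j _ (by omega) s r) f = 0

/-- membership in the component `S_k` of the shuffle algebra: `F = f / (denominator)` with `f`
a symmetric Laurent polynomial satisfying the wheel conditions. -/
def inS {k : Fin n → ℕ} (F : Fk n k) : Prop :=
  ∃ (f : Pk n k) (m : ℕ), symmQ n f ∧ wheelQ n A Dd f ∧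
    F * algebraMap (Pk n k) (Fk n k) (Dpoly n A k * xProd n k ^ m) = algebraMap (Pk n k) (Fk n k) f

end Shuffle

section Slots
variable {R : Type} [Fintype R] [LinearOrder R]
/-- ordered enumeration of the variable slots of color `c` determined by a Kostant partition. -/
def slots (νf : R → ℕ → ℕ) (d : R → ℕ) (c : ℕ) : List (R × ℕ × ℕ) :=
  ((Finset.univ : Finset R).sort (· ≤ ·)).flatMap fun β =>
    (List.range (d β)).flatMap fun s => (List.range (νf β c)).map fun tt => (β, s, tt)
end Slots

section SpecC
variable (n : ℕ)
abbrev WRC := MvPolynomial (PosRootC n × ℕ) KK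
abbrev FWC := FractionRing (WRC n)
abbrev WR2C := MvPolynomial ((PosRootC n × ℕ) ⊕ (PosRootC n × ℕ)) KK

def wXC (p : PosRootC n × ℕ) : FWC n := algebraMap (WRC n) (FWC n) (MvPolynomial.X p)
def cwC (a : KK) : FWC n := algebraMap KK (FWC n) a

/-- the value assigned to the variable `x^{(β,s)}_{c,t+1}` by the first-step specialization
map `φ^{(1)}` in type `C_n`. -/
def specValC (β : PosRootC n) (s tt c : ℕ) : WR2C n :=
  if isINI β then
    (if c = n then MvPolynomial.C (vpow (-(n : ℤ))) * MvPolynomial.X (Sum.inr (β, s))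
     else if tt = 0 then MvPolynomial.C (vpow (1 - (c : ℤ))) * MvPolynomial.X (Sum.inl (β, s))
     else MvPolynomial.C (vpow (1 - (c : ℤ))) * MvPolynomial.X (Sum.inr (β, s)))
  else
    (if c = n then MvPolynomial.C (vpow (-(n : ℤ))) * MvPolynomial.X (Sum.inl (β, s))
     else if tt = 0 then MvPolynomial.C (vpow (1 - (c : ℤ))) * MvPolynomial.X (Sum.inl (β, s))
     else MvPolynomial.C (vpow ((c : ℤ) - 1 - 2 * n)) * MvPolynomial.X (Sum.inl (β, s)))

def phi1subC {k : Fin n → ℕ} (d : PosRootC n → ℕ) : Vars n k → WR2C n := fun u =>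
  match (slots (nuC (n := n)) d (u.1.1 + 1))[(u.2.1)]? with
  | some (β, s, tt) => specValC n β s tt (u.1.1 + 1)
  | none => 0

def BoneC (β : PosRootC n) (s : ℕ) : WR2C n :=
  if isINI β then
    ((MvPolynomial.X (Sum.inl (β, s)) -
        MvPolynomial.C (vpow (-2)) * MvPolynomial.X (Sum.inr (β, s))) *
      (MvPolynomial.X (Sum.inl (β, s)) -
        MvPolynomial.C (vpow 2) * MvPolynomial.X (Sum.inr (β, s)))) ^ (n - ri β - 1)
  else 1

def BprodC (d : PosRootC n → ℕ) : WR2C n :=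
  ∏ β : PosRootC n, ∏ s ∈ Finset.range (d β), BoneC n β s

/-- second-step substitution `w'_{β,s} ↦ v² w_{β,s}` (type `C_n`). -/
def psi2C : WR2C n →ₐ[KK] WRC n :=
  MvPolynomial.aeval fun u => match u with
    | Sum.inl p => MvPolynomial.X p
    | Sum.inr p => MvPolynomial.C (vpow 2) * MvPolynomial.X p

/-- `PhiRelC n d F P` holds iff `P = φ_d(F)`, where `φ_d` is the (normalized, two-step)
specialization map of type `C_n` applied to the canonical Laurent numerator of `F`. -/
def PhiRelC {k : Fin n → ℕ} (d : PosRootC n → ℕ) (F : Fk n k) (P : FWC n) : Prop :=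
  ∃ (m : ℕ) (g : Pk n k) (q : WR2C n),
    F * algebraMap (Pk n k) (Fk n k) (Dpoly n (aC n) k * xProd n k ^ m) =
        algebraMap (Pk n k) (Fk n k) g ∧
    MvPolynomial.aeval (phi1subC n d) g = BprodC n d * q ∧
    P * algebraMap (WRC n) (FWC n) (psi2C n (MvPolynomial.aeval (phi1subC n d) (xProd n k ^ m)))
      = algebraMap (WRC n) (FWC n) (psi2C n q)

def nuVecC (β : PosRootC n) : Fin n → ℕ := fun i => nuC β (i.1 + 1)

def KPmemC (k : Fin n → ℕ) (d : PosRootC n → ℕ) : Prop :=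
  ∀ i : Fin n, (∑ β : PosRootC n, d β * nuC β (i.1 + 1)) = k i

def KPltC (d' d : PosRootC n → ℕ) : Prop :=
  ∃ γ : PosRootC n, d' γ < d γ ∧ ∀ β : PosRootC n, β < γ → d' β = d β
end SpecC

/-- the `i`-th coordinate vector `1_i ∈ ℕ^n`. -/
def unitVec {n : ℕ} (i : Fin n) : Fin n → ℕ := fun j => if j = i then 1 else 0

/-- the degree `deg(h) ∈ ℕ^{Δ⁺}` of `h ∈ H`: `deg(h)_β = Σ_s h(β,s)`. -/
def degH {R : Type} [DecidableEq R] (h : Lex (R × ℤ) →₀ ℕ) (β : R) : ℕ :=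
  ∑ p ∈ h.support, if (ofLex p).1 = β then h p else 0

/-- the ordered PBWD monomial `E_h`. -/
def EmonC {n : ℕ} (E : PosRootC n × ℤ → UC n) (h : Lex (PosRootC n × ℤ) →₀ ℕ) : UC n :=
  ordMon (fun p => E (ofLex p)) h

/-- span of monomials in the generators whose colors form a permutation of `w`. -/
def contentSpan (n : ℕ) (w : List ℕ) : Submodule KK (UC n) :=
  Submodule.span KK {x | ∃ L : List (Fin n × ℤ), (L.map fun p => p.1.1 + 1).Perm w ∧
    x = (L.map fun p => ug n (aC n) (dC n) p.1 p.2).prod}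

lemma contentSpan_perm {n : ℕ} {w w' : List ℕ} (h : w.Perm w') :
    contentSpan n w = contentSpan n w' := by
  unfold contentSpan
  congr 1
  ext x
  exact ⟨fun ⟨L, hL, hx⟩ => ⟨L, hL.trans h, hx⟩, fun ⟨L, hL, hx⟩ => ⟨L, hL.trans h.symm, hx⟩⟩

lemma mul_mem_contentSpan {n : ℕ} {w w' : List ℕ} {x y : UC n}
    (hx : x ∈ contentSpan n w) (hy : y ∈ contentSpan n w') :
    x * y ∈ contentSpan n (w ++ w') := by
  have := Submodule.mul_mem_mul hx hy
  rw [contentSpan, contentSpan, Submodule.span_mul_span] at this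
  refine Submodule.span_mono ?_ this
  rintro _ ⟨_, ⟨L, hL, rfl⟩, _, ⟨L', hL', rfl⟩, rfl⟩
  exact ⟨L ++ L', by simpa using hL.append hL', by simp⟩

lemma genC_mem_contentSpan (n i : ℕ) (r : ℤ) : genC n i r ∈ contentSpan n [i] := by
  unfold genC g1
  split_ifs with h
  · exact Submodule.subset_span ⟨[(⟨i - 1, by omega⟩, r)], by simp; omega, by simp⟩
  · exact zero_mem _

lemma qcm_mem_contentSpan {n : ℕ} {w w' : List ℕ} {x y : UC n} (u : KK)
    (hx : x ∈ contentSpan n w) (hy : y ∈ contentSpan n w') :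
    x * y - u • (y * x) ∈ contentSpan n (w ++ w') := by
  refine sub_mem (mul_mem_contentSpan hx hy) (Submodule.smul_mem _ _ ?_)
  rw [contentSpan_perm List.perm_append_comm]
  exact mul_mem_contentSpan hy hx

lemma foldl_qcm_mem_contentSpan {n : ℕ} (L : List ((ℕ × ℤ) × KK)) :
    ∀ {w : List ℕ} {x : UC n}, x ∈ contentSpan n w →
      L.foldl (fun acc p => acc * genC n p.1.1 p.1.2 - p.2 • (genC n p.1.1 p.1.2 * acc)) x
        ∈ contentSpan n (w ++ L.map fun p => p.1.1) := by
  induction L with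
  | nil => intro w x hx; simpa using hx
  | cons p L ih =>
    intro w x hx
    have := ih (qcm_mem_contentSpan p.2 hx (genC_mem_contentSpan n p.1.1 p.1.2))
    simpa using this

lemma IsRVCchain.mem_contentSpan {n : ℕ} {β : PosRootC n} {s : ℤ} {E : UC n}
    (h : IsRVCchain β s E) : E ∈ contentSpan n (wordC β) := by
  obtain ⟨ss, ls, h1, h2, -, -, rfl⟩ := h
  generalize wordC β = w at *
  match w, ss with
  | [], [] => simp [chainE]
  | i :: w, s :: ss =>
    have := foldl_qcm_mem_contentSpan ((w.zip ss).zip ls) (genC_mem_contentSpan n i s)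
    simp only [List.length_cons, add_left_inj] at h1 h2
    have e : ((w.zip ss).zip ls).map (fun p => p.1.1) = w := by
      have : (fun p : (ℕ × ℤ) × KK => p.1.1) = Prod.fst ∘ Prod.fst := rfl
      rw [this, ← List.map_map, List.map_fst_zip (by simp; omega), List.map_fst_zip (by omega)]
    rw [e] at this
    exact this

lemma IsRVC.mem_contentSpan {n : ℕ} {β : PosRootC n} {s : ℤ} {E : UC n}
    (h : IsRVC β s E) : E ∈ contentSpan n (wordC β) := by
  unfold IsRVC at h
  split_ifs at h with hI
  · obtain ⟨β₁, β₂, s₁, s₂, lam, E₁, E₂, ⟨a1, a2⟩, ⟨b1, b2⟩, -, h1, h2, -, rfl⟩ := h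
    obtain ⟨c1, c2⟩ := hI
    have := qcm_mem_contentSpan lam h1.mem_contentSpan h2.mem_contentSpan
    rw [qcm]
    convert this using 2
    have e1 : wordC β₁ = List.range' (ri β) (n - ri β) := by
      simp only [wordC]
      rw [if_pos (by omega), a1]
      congr 1; omega
    have e2 : wordC β₂ = List.range' (ri β) (n - ri β) ++ [n] := by
      simp only [wordC]
      rw [if_neg (by omega), if_neg (by omega), if_pos (by omega), b1, List.range'_1_concat]
      congr 2; omega
    rw [e1, e2]
    simp only [wordC]
    rw [if_neg (by omega), if_pos (by omega), List.append_assoc]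
  · exact h.mem_contentSpan

lemma PosRootC.bounds {n : ℕ} (β : PosRootC n) :
    1 ≤ ri β ∧ ri β ≤ n ∧ (ri β = n → rt β = 0) ∧ rt β + 2 * ri β ≤ 2 * n := by
  obtain ⟨⟨i, t⟩, h1, h2, h3⟩ := β
  have := i.2
  exact ⟨h1, by change i.1 ≤ n; omega, h2, h3⟩

lemma count_range'_one (a l c : ℕ) :
    (List.range' a l).count c = if a ≤ c ∧ c < a + l then 1 else 0 := by
  rw [List.Nodup.count List.nodup_range']
  simp [List.mem_range'_1]

lemma count_wordC {n : ℕ} (β : PosRootC n) (c : ℕ) : (wordC β).count c = nuC β c := by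
  obtain ⟨h1, h2, h3, h4⟩ := β.bounds
  simp only [wordC, nuC]
  split_ifs <;>
    simp only [List.count_append, List.count_reverse, count_range'_one, List.count_singleton,
      beq_iff_eq] <;>
    split_ifs <;> omega

/-- words with block labels -/
structure IsBlockWord {n : ℕ} (Rs : List (PosRootC n)) (L : List (Fin n × ℤ × ℕ)) : Prop where
  sorted : L.Pairwise fun p q => p.2.2 ≤ q.2.2
  lt : ∀ p ∈ L, p.2.2 < Rs.length
  count : ∀ (b : ℕ) (hb : b < Rs.length) (c : ℕ),
    L.countP (fun p => p.1.1 + 1 = c ∧ p.2.2 = b) = nuC Rs[b] c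

def wordU {n : ℕ} (L : List (Fin n × ℤ × ℕ)) : UC n :=
  (L.map fun p => ug n (aC n) (dC n) p.1 p.2.1).prod

def blockSpan {n : ℕ} (Rs : List (PosRootC n)) : Submodule KK (UC n) :=
  Submodule.span KK {x | ∃ L, IsBlockWord Rs L ∧ x = wordU L}

lemma one_mem_blockSpan {n : ℕ} : (1 : UC n) ∈ blockSpan ([] : List (PosRootC n)) :=
  Submodule.subset_span ⟨[], ⟨by simp, by simp, by simp⟩, by simp [wordU]⟩

lemma IsBlockWord.cons {n : ℕ} {β : PosRootC n} {Rs : List (PosRootC n)}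
    {L : List (Fin n × ℤ × ℕ)} (hL : IsBlockWord Rs L) {L₀ : List (Fin n × ℤ)}
    (h₀ : (L₀.map fun p => p.1.1 + 1).Perm (wordC β)) :
    IsBlockWord (β :: Rs)
      ((L₀.map fun p => (p.1, p.2, 0)) ++ L.map fun p => (p.1, p.2.1, p.2.2 + 1)) := by
  refine ⟨?_, ?_, ?_⟩
  · rw [List.pairwise_append]
    refine ⟨?_, ?_, ?_⟩
    · rw [List.pairwise_map]; exact List.pairwise_of_forall fun _ _ => le_rfl
    · rw [List.pairwise_map]; exact hL.sorted.imp fun h => Nat.succ_le_succ h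
    · simp only [List.mem_map]
      rintro _ ⟨p, -, rfl⟩ q -
      exact Nat.zero_le _
  · intro p hp
    rw [List.mem_append, List.mem_map, List.mem_map] at hp
    obtain ⟨q, -, rfl⟩ | ⟨q, hq, rfl⟩ := hp
    · simp
    · simpa using hL.lt q hq
  · intro b hb c
    rw [List.countP_append, List.countP_map, List.countP_map]
    cases b with
    | zero =>
      rw [← count_wordC]
      change _ = (wordC β).count c
      rw [← h₀.count_eq, List.count, List.countP_map]
      simp [Function.comp_def, Bool.beq_eq_decide_eq]
    | succ b =>
      have := hL.count b (by simpa using hb) c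
      simp [Function.comp_def]
      simpa using this

lemma mul_mem_blockSpan {n : ℕ} {β : PosRootC n} {Rs : List (PosRootC n)} {x y : UC n}
    (hx : x ∈ contentSpan n (wordC β)) (hy : y ∈ blockSpan Rs) :
    x * y ∈ blockSpan (β :: Rs) := by
  have := Submodule.mul_mem_mul hx hy
  rw [contentSpan, blockSpan, Submodule.span_mul_span] at this
  refine Submodule.span_mono ?_ this
  rintro _ ⟨_, ⟨L₀, h₀, rfl⟩, _, ⟨L, hL, rfl⟩, rfl⟩
  exact ⟨_, hL.cons h₀, by simp [wordU, Function.comp_def]⟩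

lemma pow_mul_mem_blockSpan {n : ℕ} {β : PosRootC n} {Rs : List (PosRootC n)} {x y : UC n}
    (hx : x ∈ contentSpan n (wordC β)) (hy : y ∈ blockSpan Rs) (m : ℕ) :
    x ^ m * y ∈ blockSpan (List.replicate m β ++ Rs) := by
  induction m with
  | zero => simpa using hy
  | succ m ih =>
    rw [pow_succ', mul_assoc]
    exact mul_mem_blockSpan hx ih

/-- The roots occurring in the ordered monomial `E_h`, in order. -/
def rootList {n : ℕ} (h : Lex (PosRootC n × ℤ) →₀ ℕ) : List (PosRootC n) :=
  (h.support.sort (· ≤ ·)).flatMap fun p => List.replicate (h p) (ofLex p).1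

lemma EmonC_mem_blockSpan {n : ℕ} {E : PosRootC n × ℤ → UC n} (hE : ∀ p, IsRVC p.1 p.2 (E p))
    (h : Lex (PosRootC n × ℤ) →₀ ℕ) : EmonC E h ∈ blockSpan (rootList h) := by
  unfold EmonC ordMon rootList
  induction h.support.sort (· ≤ ·) with
  | nil => simpa using one_mem_blockSpan
  | cons p l ih =>
    rw [List.map_cons, List.prod_cons, List.flatMap_cons]
    exact pow_mul_mem_blockSpan (hE (ofLex p)).mem_contentSpan ih _

lemma rootList_sorted {n : ℕ} (h : Lex (PosRootC n × ℤ) →₀ ℕ) :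
    (rootList h).Pairwise (· ≤ ·) := by
  unfold rootList
  rw [List.pairwise_flatMap]
  refine ⟨fun p _ => List.pairwise_replicate.2 (Or.inr le_rfl), ?_⟩
  refine (Finset.pairwise_sort _ _).imp ?_
  intro p q hpq x hx y hy
  rw [List.eq_of_mem_replicate hx, List.eq_of_mem_replicate hy]
  rcases Prod.Lex.le_iff.1 hpq with h | h
  · exact h.le
  · exact h.1.le

lemma count_rootList {n : ℕ} (h : Lex (PosRootC n × ℤ) →₀ ℕ) (β : PosRootC n) :
    (rootList h).count β = degH h β := by
  unfold rootList degH
  rw [List.count_flatMap]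
  have e : (h.support.sort (· ≤ ·)).toFinset = h.support := Finset.sort_toFinset _ _
  conv_rhs => rw [← e]
  rw [List.sum_toFinset _ (Finset.sort_nodup _ _)]
  congr 1
  refine List.map_congr_left fun p _ => ?_
  simp [List.count_replicate, Subtype.ext_iff]

section Terms
variable {n : ℕ} {k l : Fin n → ℕ}

lemma liftHom_algebraMap (f : Vars n k → Vars n l) (hf : Function.Injective f) (p : Pk n k) :
    liftHom n f hf (algebraMap (Pk n k) (Fk n k) p) =
      algebraMap (Pk n l) (Fk n l) (MvPolynomial.rename f p) := by
  unfold liftHom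
  rw [IsFractionRing.lift_algebraMap]
  rfl

lemma cf_eq (a : KK) : (cf n a : Fk n k) = algebraMap (Pk n k) (Fk n k) (MvPolynomial.C a) := by
  rw [cf, IsScalarTower.algebraMap_apply KK (Pk n k) (Fk n k), MvPolynomial.algebraMap_eq]

lemma liftHom_xvr (f : Vars n k → Vars n l) (hf : Function.Injective f) (u : Vars n k) :
    liftHom n f hf (xvr n u) = xvr n (f u) := by
  rw [xvr, liftHom_algebraMap, MvPolynomial.rename_X, xvr]

lemma liftHom_cf (f : Vars n k → Vars n l) (hf : Function.Injective f) (a : KK) :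
    liftHom n f hf (cf n a) = cf n a := by
  rw [cf_eq, liftHom_algebraMap, MvPolynomial.rename_C, cf_eq]

lemma liftHom_smul (f : Vars n k → Vars n l) (hf : Function.Injective f) (a : KK) (F : Fk n k) :
    liftHom n f hf (a • F) = a • liftHom n f hf F := by
  rw [Algebra.smul_def, Algebra.smul_def, map_mul]
  congr 1
  exact liftHom_cf f hf a

/-- The exponent `(α_i, α_j)`. -/
def pairC (n : ℕ) (i j : Fin n) : ℤ := (dC n (i.1 + 1) : ℤ) * aC n (i.1 + 1) (j.1 + 1)

/-- The factor `ζ(x_u / x_v)`. -/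
def zetaF (u v : Vars n k) : Fk n k :=
  (xvr n u - cf n (vpow (-pairC n u.1 v.1)) * xvr n v) / (xvr n u - xvr n v)

lemma liftHom_zetaF (f : Vars n k → Vars n l) (hf : Function.Injective f)
    (hc : ∀ u, (f u).1 = u.1) (u v : Vars n k) :
    liftHom n f hf (zetaF u v) = zetaF (f u) (f v) := by
  simp only [zetaF, map_div₀, map_sub, map_mul, liftHom_xvr, liftHom_cf, hc]

/-- The summand of the image of a word attached to an ordering of the variables. -/
def ordTerm : List (Vars n k × ℤ × ℕ) → Fk n k
  | [] => 1
  | p :: es => xvr n p.1 ^ p.2.1 * (es.map fun q => zetaF p.1 q.1).prod * ordTerm es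

lemma liftHom_ordTerm (f : Vars n k → Vars n l) (hf : Function.Injective f)
    (hc : ∀ u, (f u).1 = u.1) (es : List (Vars n k × ℤ × ℕ)) :
    liftHom n f hf (ordTerm es) = ordTerm (es.map fun p => (f p.1, p.2)) := by
  induction es with
  | nil => simp [ordTerm]
  | cons p es ih =>
    simp only [ordTerm, map_mul, map_zpow₀, liftHom_xvr, map_list_prod, List.map_map,
      Function.comp_def, List.map_cons, ih, liftHom_zetaF f hf hc]

/-- `es` enumerates all the variables, with colors and decorations given by `L`. -/
structure IsEnum (L : List (Fin n × ℤ × ℕ)) (es : List (Vars n k × ℤ × ℕ)) : Prop where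
  nodup : (es.map Prod.fst).Nodup
  mem : ∀ u, u ∈ es.map Prod.fst
  map_eq : (es.map fun p => (p.1.1, p.2)) = L

variable (k) in
def termSpan (L : List (Fin n × ℤ × ℕ)) : Submodule KK (Fk n k) :=
  Submodule.span KK {F | ∃ es, IsEnum L es ∧ F = ordTerm es}

lemma permF_ordTerm_mem {L : List (Fin n × ℤ × ℕ)} {es : List (Vars n k × ℤ × ℕ)}
    (h : IsEnum L es) (σ : ∀ i : Fin n, Equiv.Perm (Fin (k i))) :
    permF n σ (ordTerm es) ∈ termSpan k L := by
  refine Submodule.subset_span ⟨es.map fun p : Vars n k × ℤ × ℕ => (permVf n σ p.1, p.2), ⟨?_, ?_, ?_⟩,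
    liftHom_ordTerm _ (permVf_inj n σ) (fun _ => rfl) es⟩
  · have := h.nodup.map (permVf_inj n σ)
    simpa [List.map_map, Function.comp_def] using this
  · rintro ⟨i, r⟩
    obtain ⟨p, hp, hpe⟩ := List.mem_map.1 (h.mem ⟨i, (σ i).symm r⟩)
    refine List.mem_map.2 ⟨_, List.mem_map.2 ⟨p, hp, rfl⟩, ?_⟩
    change permVf n σ p.1 = _
    rw [hpe]
    simp [permVf]
  · simpa [List.map_map, Function.comp_def, permVf] using h.map_eq

/-- The variable of `S_{1_i}`. -/
def unitVar (i : Fin n) : Vars n (unitVec i) := ⟨i, ⟨0, by simp [unitVec]⟩⟩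

lemma eq_unitVar (i : Fin n) (u : Vars n (unitVec i)) : u = unitVar i := by
  obtain ⟨j, r⟩ := u
  have hr := r.2
  by_cases h : j = i
  · subst h
    have : r = ⟨0, by simp [unitVec]⟩ := Fin.ext (by simp [unitVec] at hr; simp [hr])
    rw [this]; rfl
  · simp [unitVec, h] at hr

instance (i : Fin n) : Unique (Vars n (unitVec i)) := ⟨⟨unitVar i⟩, eq_unitVar i⟩

lemma zfac_eq (k l : Fin n → ℕ) : zfac n (aC n) (dC n) k l =
    ∏ u : Vars n k, ∏ v : Vars n l, zetaF (emb1f n k l u) (emb2f n k l v) := by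
  rw [Fintype.prod_sigma]
  simp_rw [Fintype.prod_sigma (ι := Fin n) (α := fun i => Fin (l i))]
  unfold zfac
  refine Finset.prod_congr rfl fun i _ => ?_
  rw [Finset.prod_comm]
  rfl

lemma zfac_unit (i : Fin n) (l : Fin n → ℕ) : zfac n (aC n) (dC n) (unitVec i) l =
    ∏ v : Vars n l, zetaF (emb1f n (unitVec i) l (unitVar i)) (emb2f n (unitVec i) l v) := by
  rw [zfac_eq]
  exact Fintype.prod_unique _

lemma vars_add_cases (k l : Fin n → ℕ) (u : Vars n (k + l)) :
    (∃ v, u = emb1f n k l v) ∨ ∃ v, u = emb2f n k l v := by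
  obtain ⟨i, r⟩ := u
  have hr : r.1 < k i + l i := r.2
  by_cases h : r.1 < k i
  · exact Or.inl ⟨⟨i, ⟨r.1, h⟩⟩, rfl⟩
  · refine Or.inr ⟨⟨i, ⟨r.1 - k i, by omega⟩⟩, ?_⟩
    simp only [emb2f]
    congr 1
    exact Fin.ext (by simp; omega)

lemma emb1f_ne_emb2f (k l : Fin n → ℕ) (u : Vars n k) (v : Vars n l) :
    emb1f n k l u ≠ emb2f n k l v := by
  obtain ⟨i, r⟩ := u
  obtain ⟨j, s⟩ := v
  intro h
  simp only [emb1f, emb2f, Sigma.mk.inj_iff] at h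
  obtain ⟨rfl, h2⟩ := h
  rw [heq_iff_eq, Fin.mk.injEq] at h2
  omega

lemma prod_list_univ {α M : Type} [Fintype α] [CommMonoid M] {xs : List α} (h : xs.Nodup)
    (hm : ∀ a, a ∈ xs) (f : α → M) : (xs.map f).prod = ∏ a, f a := by
  classical
  rw [← List.prod_toFinset f h]
  congr 1
  ext a
  simp [hm]

lemma IsEnum.cons {L : List (Fin n × ℤ × ℕ)} {es : List (Vars n l × ℤ × ℕ)}
    (h : IsEnum L es) (i : Fin n) (r : ℤ) (b : ℕ) :
    IsEnum ((i, r, b) :: L) ((emb1f n (unitVec i) l (unitVar i), r, b) ::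
      es.map fun p => (emb2f n (unitVec i) l p.1, p.2)) := by
  refine ⟨?_, ?_, ?_⟩
  · simp only [List.map_cons, List.map_map, Function.comp_def, List.nodup_cons]
    refine ⟨?_, ?_⟩
    · intro hm
      obtain ⟨p, -, hp⟩ := List.mem_map.1 hm
      exact emb1f_ne_emb2f _ _ _ _ hp.symm
    · have := h.nodup.map (emb2f_inj n (unitVec i) l)
      simpa [List.map_map, Function.comp_def] using this
  · intro u
    rcases vars_add_cases _ _ u with ⟨v, rfl⟩ | ⟨v, rfl⟩
    · rw [eq_unitVar i v]; simp
    · obtain ⟨p, hp, hpe⟩ := List.mem_map.1 (h.mem v)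
      refine List.mem_map.2 ⟨_, List.mem_cons_of_mem _ (List.mem_map.2 ⟨p, hp, rfl⟩), ?_⟩
      simp [hpe]
  · have := h.map_eq
    simp only [List.map_cons, List.map_map, Function.comp_def]
    rw [← this]
    rfl

lemma shufMul_unit_mem {i : Fin n} {r : ℤ} {b : ℕ} {L : List (Fin n × ℤ × ℕ)} {G : Fk n l}
    (hG : G ∈ termSpan l L) :
    shufMul n (aC n) (dC n) (unitVec i) l (xvr n (unitVar i) ^ r) G ∈
      termSpan (unitVec i + l) ((i, r, b) :: L) := by
  unfold shufMul
  refine Submodule.smul_mem _ _ (Submodule.sum_mem _ fun σ _ => ?_)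
  induction hG using Submodule.span_induction with
  | mem F hF =>
    obtain ⟨es, hes, rfl⟩ := hF
    convert permF_ordTerm_mem (hes.cons i r b) σ using 2
    rw [ordTerm, emb2, liftHom_ordTerm (emb2f n (unitVec i) l) _ (fun _ => rfl), emb1, map_zpow₀, liftHom_xvr, zfac_unit,
      ← prod_list_univ hes.nodup hes.mem, List.map_map, List.map_map]
    simp only [Function.comp_def]
    ring
  | zero => simp
  | add x y _ _ hx hy =>
    rw [map_add, mul_add, add_mul, map_add]
    exact add_mem hx hy
  | smul c x _ hx =>
    rw [emb2, liftHom_smul, mul_smul_comm, smul_mul_assoc, permF, liftHom_smul]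
    exact Submodule.smul_mem _ _ hx

end Terms

section PsiWord
variable {n : ℕ} {Ψ : UA n (aC n) (dC n) →ₗ[KK] BigS n}

lemma bstar_of_apply_mem {i : Fin n} {r : ℤ} {b : ℕ} {L : List (Fin n × ℤ × ℕ)} {y : BigS n}
    (hy : ∀ k, y k ∈ termSpan k L) (k : Fin n → ℕ) :
    bstar n (aC n) (dC n)
      (DirectSum.of (fun k => Fk n k) (unitVec i) (xvr n (unitVar i) ^ r)) y k ∈
      termSpan k ((i, r, b) :: L) := by
  classical
  unfold bstar
  have hne : (xvr n (unitVar i) ^ r : Fk n (unitVec i)) ≠ 0 := by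
    refine zpow_ne_zero _ ?_
    rw [xvr, Ne, FaithfulSMul.algebraMap_eq_zero_iff]
    exact MvPolynomial.X_ne_zero _
  have hs : ∀ f : ∀ k, Fk n k → BigS n, DFinsupp.sum (DirectSum.of (fun k => Fk n k) (unitVec i)
      (xvr n (unitVar i) ^ r)) f = f (unitVec i) (xvr n (unitVar i) ^ r) := by
    intro f
    unfold DFinsupp.sum
    rw [show (DirectSum.of (fun k => Fk n k) (unitVec i) (xvr n (unitVar i) ^ r)) =
      DFinsupp.single (unitVec i) (xvr n (unitVar i) ^ r) from rfl,
      DFinsupp.support_single hne, Finset.sum_singleton, DFinsupp.single_eq_same]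
  rw [hs]
  unfold DFinsupp.sum
  rw [DFinsupp.finsetSum_apply]
  refine Submodule.sum_mem _ fun l _ => ?_
  by_cases h : unitVec i + l = k
  · subst h
    rw [DirectSum.of_eq_same]
    exact shufMul_unit_mem (hy l)
  · rw [DirectSum.of_eq_of_ne _ _ _ (Ne.symm h)]
    exact zero_mem _

lemma Psi_wordU_mem
    (hmul : ∀ a b, Ψ (a * b) = bstar n (aC n) (dC n) (Ψ a) (Ψ b))
    (hone : Ψ 1 = DirectSum.of (fun k => Fk n k) 0 1)
    (hgen : ∀ (i : Fin n) (r : ℤ), Ψ (ug n (aC n) (dC n) i r) =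
        DirectSum.of (fun k => Fk n k) (unitVec i) (xvr n (unitVar i) ^ r))
    (L : List (Fin n × ℤ × ℕ)) (k : Fin n → ℕ) : Ψ (wordU L) k ∈ termSpan k L := by
  induction L generalizing k with
  | nil =>
    rw [wordU, List.map_nil, List.prod_nil, hone]
    by_cases h : 0 = k
    · subst h
      rw [DirectSum.of_eq_same]
      exact Submodule.subset_span ⟨[], ⟨by simp, fun u => u.2.elim0, rfl⟩, rfl⟩
    · rw [DirectSum.of_eq_of_ne _ _ _ (Ne.symm h)]
      exact zero_mem _
  | cons p L ih =>
    obtain ⟨i, r, b⟩ := p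
    have e : wordU ((i, r, b) :: L) = ug n (aC n) (dC n) i r * wordU L := by simp [wordU]
    rw [e, hmul, hgen]
    exact bstar_of_apply_mem ih k

/-- Every component of `Ψ(E_h)` is a combination of terms attached to block-labelled orderings. -/
lemma Psi_EmonC_mem
    (hmul : ∀ a b, Ψ (a * b) = bstar n (aC n) (dC n) (Ψ a) (Ψ b))
    (hone : Ψ 1 = DirectSum.of (fun k => Fk n k) 0 1)
    (hgen : ∀ (i : Fin n) (r : ℤ), Ψ (ug n (aC n) (dC n) i r) =
        DirectSum.of (fun k => Fk n k) (unitVec i) (xvr n (unitVar i) ^ r))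
    {E : PosRootC n × ℤ → UC n} (hE : ∀ p, IsRVC p.1 p.2 (E p))
    (h : Lex (PosRootC n × ℤ) →₀ ℕ) (k : Fin n → ℕ) :
    Ψ (EmonC E h) k ∈ Submodule.span KK {F : Fk n k | ∃ L es,
      IsBlockWord (rootList h) L ∧ IsEnum L es ∧ F = ordTerm es} := by
  have := EmonC_mem_blockSpan hE h
  unfold blockSpan at this
  generalize EmonC E h = X at this ⊢
  induction this using Submodule.span_induction with
  | mem x hx =>
    obtain ⟨L, hL, rfl⟩ := hx
    refine Submodule.span_mono ?_ (Psi_wordU_mem hmul hone hgen L k)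
    rintro _ ⟨es, hes, rfl⟩
    exact ⟨L, es, hL, hes, rfl⟩
  | zero => rw [map_zero]; exact zero_mem _
  | add x y _ _ hx hy => rw [map_add]; exact add_mem hx hy
  | smul c x _ hx => rw [map_smul]; exact Submodule.smul_mem _ c hx

end PsiWord

section OrderedPairs
variable {α : Type}

/-- The pairs `(a, b)` with `a` strictly before `b` in a list. -/
def orderedPairs : List α → List (α × α)
  | [] => []
  | a :: l => (l.map fun b => (a, b)) ++ orderedPairs l

lemma mem_of_mem_orderedPairs {l : List α} {p : α × α} (h : p ∈ orderedPairs l) : p.1 ∈ l := by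
  induction l with
  | nil => simp [orderedPairs] at h
  | cons a l ih =>
    rw [orderedPairs, List.mem_append, List.mem_map] at h
    rcases h with ⟨b, -, rfl⟩ | h
    · simp
    · exact List.mem_cons_of_mem _ (ih h)

lemma nodup_orderedPairs {l : List α} (h : l.Nodup) : (orderedPairs l).Nodup := by
  induction l with
  | nil => simp [orderedPairs]
  | cons a l ih =>
    rw [List.nodup_cons] at h
    rw [orderedPairs, List.nodup_append']
    refine ⟨h.2.map fun x y hxy => by simpa using hxy, ih h.2, ?_⟩
    rw [List.disjoint_left]
    rintro p hp hq
    obtain ⟨b, -, rfl⟩ := List.mem_map.1 hp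
    exact h.1 (mem_of_mem_orderedPairs hq)

lemma mem_orderedPairs_of_lt {l : List α} {o : α → ℕ} (ho : l.Pairwise fun a b => o a ≤ o b)
    {a b : α} (ha : a ∈ l) (hb : b ∈ l) (hab : o a < o b) : (a, b) ∈ orderedPairs l := by
  induction l with
  | nil => simp at ha
  | cons x l ih =>
    rw [List.pairwise_cons] at ho
    rw [orderedPairs, List.mem_append, List.mem_map]
    rcases List.mem_cons.1 ha with rfl | ha'
    · rcases List.mem_cons.1 hb with rfl | hb'
      · exact absurd hab (lt_irrefl _)
      · exact Or.inl ⟨b, hb', rfl⟩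
    · rcases List.mem_cons.1 hb with rfl | hb'
      · exact absurd (ho.1 a ha') (not_le.2 hab)
      · exact Or.inr (ih ho.2 ha' hb')

lemma prod_orderedPairs_dvd {R : Type} [CommRing R] (f : α → α → R) (κ : α → α → R)
    (hf : ∀ a b, a ≠ b → f a b ∣ κ a b * κ b a) (hκ : ∀ a, κ a a = 1) {l : List α} (hl : l.Nodup) :
    ((orderedPairs l).map fun p => f p.1 p.2).prod ∣
      (l.map fun a => (l.map fun b => κ a b).prod).prod := by
  induction l with
  | nil => simp [orderedPairs]
  | cons x l ih =>
    have e : ((x :: l).map fun a => ((x :: l).map fun b => κ a b).prod).prod =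
        (l.map fun b => κ x b * κ b x).prod * (l.map fun a => (l.map fun b => κ a b).prod).prod := by
      simp only [List.map_cons, List.prod_cons, hκ, List.prod_map_mul]
      ring
    rw [e, orderedPairs, List.map_append, List.prod_append, List.map_map]
    rw [List.nodup_cons] at hl
    refine mul_dvd_mul ?_ (ih hl.2)
    have hx := hl.1
    clear e ih hl
    induction l with
    | nil => simp
    | cons y l ih =>
      rw [List.mem_cons, not_or] at hx
      simp only [List.map_cons, List.prod_cons]
      exact mul_dvd_mul (hf x y hx.1) (ih hx.2)

end OrderedPairs

section Numerators
variable {n : ℕ} {k : Fin n → ℕ}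
open MvPolynomial

lemma aC_eq_zero_symm {i j : ℕ} (h : aC n i j = 0) : aC n j i = 0 := by
  unfold aC at *
  split_ifs at * <;> omega

/-- The numerator of `ζ(x_u / x_v)`. -/
def zetaNum (u v : Vars n k) : Pk n k :=
  if aC n (u.1.1 + 1) (v.1.1 + 1) = 0 then 1 else X u - C (vpow (-pairC n u.1 v.1)) * X v

/-- The denominator of `ζ(x_u / x_v)`. -/
def zetaDen (u v : Vars n k) : Pk n k :=
  if aC n (u.1.1 + 1) (v.1.1 + 1) = 0 then 1 else X u - X v

lemma zetaF_mul_zetaDen {u v : Vars n k} (h : u ≠ v) :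
    zetaF u v * algebraMap (Pk n k) (Fk n k) (zetaDen u v) =
      algebraMap (Pk n k) (Fk n k) (zetaNum u v) := by
  have hne : (xvr n u - xvr n v : Fk n k) ≠ 0 := by
    rw [sub_ne_zero, xvr, xvr]
    intro e
    exact h (X_injective (IsFractionRing.injective (Pk n k) (Fk n k) e))
  unfold zetaF zetaDen zetaNum
  split_ifs with h0
  · rw [pairC, h0]
    simp only [mul_zero, neg_zero, vpow, zpow_zero, map_one, mul_one]
    rw [cf, map_one, one_mul, div_self hne]
  · rw [map_sub, map_sub, map_mul, ← cf_eq]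
    exact div_mul_cancel₀ _ hne

def numList (l : List (Vars n k)) : Pk n k := ((orderedPairs l).map fun p => zetaNum p.1 p.2).prod
def denList (l : List (Vars n k)) : Pk n k := ((orderedPairs l).map fun p => zetaDen p.1 p.2).prod

lemma ordTerm_mul_denList {es : List (Vars n k × ℤ × ℕ)} (h : (es.map Prod.fst).Nodup) :
    ordTerm es * algebraMap (Pk n k) (Fk n k) (denList (es.map Prod.fst)) =
      (es.map fun p => xvr n p.1 ^ p.2.1).prod *
        algebraMap (Pk n k) (Fk n k) (numList (es.map Prod.fst)) := by
  induction es with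
  | nil => simp [ordTerm, denList, numList, orderedPairs]
  | cons p es ih =>
    rw [List.map_cons, List.nodup_cons] at h
    have ih := ih h.2
    have key : ∀ l : List (Vars n k × ℤ × ℕ), p.1 ∉ l.map Prod.fst →
        (l.map fun q => zetaF p.1 q.1).prod *
          algebraMap (Pk n k) (Fk n k) (l.map fun q => zetaDen p.1 q.1).prod =
          algebraMap (Pk n k) (Fk n k) (l.map fun q => zetaNum p.1 q.1).prod := by
      intro l hl
      induction l with
      | nil => simp
      | cons q l ihl =>
        rw [List.map_cons, List.mem_cons, not_or] at hl
        simp only [List.map_cons, List.prod_cons, map_mul]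
        rw [← ihl hl.2, ← zetaF_mul_zetaDen hl.1]
        ring
    have key := key es h.1
    simp only [denList, numList, orderedPairs, List.map_cons, List.map_append, List.prod_append,
      List.map_map, Function.comp_def, map_mul, ordTerm, List.prod_cons] at ih ⊢
    rw [← key]
    linear_combination (xvr n p.1 ^ p.2.1 * (es.map fun q => zetaF p.1 q.1).prod *
      algebraMap (Pk n k) (Fk n k) (es.map fun q => zetaDen p.1 q.1).prod) * ih

lemma exists_monomial_clear (es : List (Vars n k × ℤ × ℕ)) :
    ∃ (M : ℕ) (p : Pk n k), (es.map fun p => xvr n p.1 ^ p.2.1).prod *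
      algebraMap (Pk n k) (Fk n k) (xProd n k ^ M) = algebraMap (Pk n k) (Fk n k) p := by
  induction es with
  | nil => exact ⟨0, 1, by simp⟩
  | cons e es ih =>
    obtain ⟨M, p, hp⟩ := ih
    obtain ⟨u, r, b⟩ := e
    obtain ⟨c, hc⟩ : (X u : Pk n k) ∣ xProd n k := Finset.dvd_prod_of_mem _ (Finset.mem_univ u)
    have hx : (xvr n u : Fk n k) ≠ 0 := by
      rw [xvr, Ne, FaithfulSMul.algebraMap_eq_zero_iff]
      exact X_ne_zero _
    refine ⟨r.natAbs + M, X u ^ (r + r.natAbs).toNat * c ^ r.natAbs * p, ?_⟩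
    have e1 : (xvr n u : Fk n k) ^ r * xvr n u ^ r.natAbs = xvr n u ^ (r + r.natAbs).toNat := by
      rw [← zpow_natCast, ← zpow_natCast, ← zpow_add₀ hx]
      congr 1
      omega
    rw [List.map_cons, List.prod_cons, pow_add, map_mul, map_mul, map_mul, ← hp, hc, mul_pow]
    simp only [map_mul, map_pow]
    rw [show algebraMap (Pk n k) (Fk n k) (X u) = xvr n u from rfl, ← e1]
    ring

/-- The product of the differences of the variables of equal colors. -/
def sameColorDiff (k : Fin n → ℕ) : Pk n k :=
  ∏ u : Vars n k, ∏ v : Vars n k, if u ≠ v ∧ u.1 = v.1 then X u - X v else 1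

lemma Dpoly_eq (k : Fin n → ℕ) : Dpoly n (aC n) k = ∏ u : Vars n k, ∏ v : Vars n k,
    if u.1 < v.1 ∧ aC n (u.1.1 + 1) (v.1.1 + 1) ≠ 0 then X u - X v else 1 := by
  rw [Fintype.prod_sigma]
  simp_rw [Fintype.prod_sigma (ι := Fin n) (α := fun i => Fin (k i))]
  unfold Dpoly
  refine Finset.prod_congr rfl fun i _ => ?_
  rw [Finset.prod_comm]
  refine Finset.prod_congr rfl fun j _ => ?_
  split_ifs with h
  · simp
  · simp

lemma denList_dvd {l : List (Vars n k)} (h : l.Nodup) (hm : ∀ u, u ∈ l) :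
    denList l ∣ Dpoly n (aC n) k * sameColorDiff k := by
  have := prod_orderedPairs_dvd (R := Pk n k) zetaDen
    (fun u v => (if u.1 < v.1 ∧ aC n (u.1.1 + 1) (v.1.1 + 1) ≠ 0 then X u - X v else 1) *
      (if u ≠ v ∧ u.1 = v.1 then X u - X v else 1)) ?_ ?_ h
  · simp only [prod_list_univ h hm, Finset.prod_mul_distrib] at this
    rwa [← Dpoly_eq] at this
  · intro u v huv
    by_cases h0 : aC n (u.1.1 + 1) (v.1.1 + 1) = 0
    · rw [zetaDen, if_pos h0]
      exact one_dvd _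
    rw [zetaDen, if_neg h0]
    rcases lt_trichotomy u.1 v.1 with hlt | heq | hgt
    · rw [if_pos (show u.1 < v.1 ∧ aC n (u.1.1 + 1) (v.1.1 + 1) ≠ 0 from ⟨hlt, h0⟩)]
      exact Dvd.dvd.mul_right (dvd_mul_right _ _) _
    · refine Dvd.dvd.mul_right (Dvd.dvd.mul_left ?_ _) _
      rw [if_pos (show u ≠ v ∧ u.1 = v.1 from ⟨huv, heq⟩)]
    · refine Dvd.dvd.mul_left (Dvd.dvd.mul_right ?_ _) _
      rw [if_pos (show v.1 < u.1 ∧ aC n (v.1.1 + 1) (u.1.1 + 1) ≠ 0 from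
        ⟨hgt, fun h => h0 (aC_eq_zero_symm h)⟩)]
      exact ⟨-1, by ring⟩
  · intro u
    simp

lemma exists_numerator {L : List (Fin n × ℤ × ℕ)} {es : List (Vars n k × ℤ × ℕ)}
    (h : IsEnum L es) : ∃ (M : ℕ) (N : Pk n k),
      ordTerm es * algebraMap (Pk n k) (Fk n k) (Dpoly n (aC n) k * sameColorDiff k * xProd n k ^ M)
        = algebraMap (Pk n k) (Fk n k) N ∧ numList (es.map Prod.fst) ∣ N := by
  obtain ⟨M, p, hp⟩ := exists_monomial_clear es
  obtain ⟨c, hc⟩ := denList_dvd h.nodup h.mem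
  refine ⟨M, numList (es.map Prod.fst) * (p * c), ?_, dvd_mul_right _ _⟩
  rw [hc]
  simp only [map_mul] at hp ⊢
  rw [← hp]
  linear_combination algebraMap (Pk n k) (Fk n k) c *
    algebraMap (Pk n k) (Fk n k) (xProd n k ^ M) * ordTerm_mul_denList h.nodup

end Numerators

section Vanishing
variable {n : ℕ} {k : Fin n → ℕ} {R : Type} [CommRing R] [Algebra KK R]

lemma exists_mul_mem_of_span (φ : Pk n k →ₐ[KK] R) (J : Ideal R) {S : Set (Fk n k)}
    (hS : ∀ F ∈ S, ∃ (M : ℕ) (N : Pk n k), F * algebraMap (Pk n k) (Fk n k)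
      (Dpoly n (aC n) k * sameColorDiff k * xProd n k ^ M) = algebraMap (Pk n k) (Fk n k) N ∧
        φ N ∈ J) {F : Fk n k} (hF : F ∈ Submodule.span KK S) {m : ℕ} {g : Pk n k}
    (hg : F * algebraMap (Pk n k) (Fk n k) (Dpoly n (aC n) k * xProd n k ^ m) =
      algebraMap (Pk n k) (Fk n k) g) :
    ∃ M : ℕ, φ g * φ (sameColorDiff k) * φ (xProd n k) ^ M ∈ J := by
  obtain ⟨M, N, hN, hJ⟩ : ∃ (M : ℕ) (N : Pk n k), F * algebraMap (Pk n k) (Fk n k)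
      (Dpoly n (aC n) k * sameColorDiff k * xProd n k ^ M) = algebraMap (Pk n k) (Fk n k) N ∧
        φ N ∈ J := by
    clear hg
    induction hF using Submodule.span_induction with
    | mem F hF => exact hS F hF
    | zero => exact ⟨0, 0, by simp, by simp⟩
    | add x y _ _ hx hy =>
      obtain ⟨M, N, h, h'⟩ := hx
      obtain ⟨M', N', g, g'⟩ := hy
      refine ⟨M + M', N * xProd n k ^ M' + N' * xProd n k ^ M, ?_, ?_⟩
      · simp only [map_mul, map_add, pow_add] at h g ⊢
        rw [← h, ← g]
        ring
      · rw [map_add, map_mul, map_mul]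
        exact J.add_mem (J.mul_mem_right _ h') (J.mul_mem_right _ g')
    | smul c x _ hx =>
      obtain ⟨M, N, h, h'⟩ := hx
      refine ⟨M, c • N, ?_, ?_⟩
      · rw [smul_mul_assoc, h, Algebra.smul_def, Algebra.smul_def, map_mul,
          ← IsScalarTower.algebraMap_apply]
      · rw [map_smul, Algebra.smul_def]
        exact J.mul_mem_left _ h'
  refine ⟨M, ?_⟩
  have e : g * sameColorDiff k * xProd n k ^ M = N * xProd n k ^ m := by
    apply IsFractionRing.injective (Pk n k) (Fk n k)
    simp only [map_mul] at hN hg ⊢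
    rw [← hN, ← hg]
    ring
  have e' := congrArg φ e
  simp only [map_mul, map_pow] at e'
  rw [e']
  exact J.mul_mem_right _ hJ

end Vanishing

section SlotLemmas
variable {n : ℕ} {d : PosRootC n → ℕ}

lemma mem_slots {c : ℕ} {p : PosRootC n × ℕ × ℕ} :
    p ∈ slots (nuC (n := n)) d c ↔ p.2.1 < d p.1 ∧ p.2.2 < nuC p.1 c := by
  obtain ⟨β, s, t⟩ := p
  simp only [slots, List.mem_flatMap, Finset.mem_sort, Finset.mem_univ, true_and, List.mem_range,
    List.mem_map, Prod.mk.injEq]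
  constructor
  · rintro ⟨β, s, hs, t, ht, rfl, rfl, rfl⟩
    exact ⟨hs, ht⟩
  · rintro ⟨hs, ht⟩
    exact ⟨β, s, hs, t, ht, rfl, rfl, rfl⟩

lemma nodup_slots (c : ℕ) : (slots (nuC (n := n)) d c).Nodup := by
  unfold slots
  rw [List.nodup_flatMap]
  refine ⟨fun β _ => ?_, ?_⟩
  · rw [List.nodup_flatMap]
    refine ⟨fun s _ => List.nodup_range.map fun a b h => by simpa using h, ?_⟩
    refine List.nodup_range.imp ?_
    intro s s' hs
    rw [Function.onFun, List.disjoint_left]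
    intro p hp hp'
    simp only [List.mem_map] at hp hp'
    obtain ⟨_, -, rfl⟩ := hp
    obtain ⟨_, -, h⟩ := hp'
    simp only [Prod.mk.injEq] at h
    exact hs h.2.1.symm
  · refine (Finset.sort_nodup _ _).imp ?_
    intro β β' hβ
    rw [Function.onFun, List.disjoint_left]
    intro p hp hp'
    simp only [List.mem_flatMap, List.mem_map] at hp hp'
    obtain ⟨_, -, _, -, rfl⟩ := hp
    obtain ⟨_, -, _, -, h⟩ := hp'
    simp only [Prod.mk.injEq] at h
    exact hβ h.1.symm

lemma length_slots (c : ℕ) :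
    (slots (nuC (n := n)) d c).length = ∑ β : PosRootC n, d β * nuC β c := by
  simp only [slots, List.length_flatMap, List.length_map, List.length_range, List.map_const',
    List.sum_replicate, smul_eq_mul]
  rw [← Finset.sum_map_toList]
  exact ((Finset.sort_perm_toList _ _).map _).sum_eq

variable {k : Fin n → ℕ}

/-- The slot of a variable in the splitting determined by a Kostant partition. -/
def slotOf (hd : KPmemC n k d) (u : Vars n k) : PosRootC n × ℕ × ℕ :=
  (slots (nuC (n := n)) d (u.1.1 + 1))[u.2.1]'(by
    rw [length_slots, hd u.1]
    exact u.2.2)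

lemma slotOf_mem (hd : KPmemC n k d) (u : Vars n k) :
    slotOf hd u ∈ slots (nuC (n := n)) d (u.1.1 + 1) := List.getElem_mem _

lemma phi1subC_eq (hd : KPmemC n k d) (u : Vars n k) : phi1subC n d u =
    specValC n (slotOf hd u).1 (slotOf hd u).2.1 (slotOf hd u).2.2 (u.1.1 + 1) := by
  have h : u.2.1 < (slots (nuC (n := n)) d (u.1.1 + 1)).length := by
    rw [length_slots, hd u.1]
    exact u.2.2
  unfold phi1subC slotOf
  rw [List.getElem?_eq_getElem h]

lemma eq_of_slotOf_eq (hd : KPmemC n k d) {u v : Vars n k} (h : u.1 = v.1)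
    (hs : slotOf hd u = slotOf hd v) : u = v := by
  obtain ⟨i, a⟩ := u
  obtain ⟨j, b⟩ := v
  obtain rfl : i = j := h
  have := (nodup_slots (d := d) (i.1 + 1)).getElem_inj_iff.1 hs
  exact congrArg _ (Fin.ext this)

lemma exists_slotOf_eq (hd : KPmemC n k d) (i : Fin n) {p : PosRootC n × ℕ × ℕ}
    (hp : p ∈ slots (nuC (n := n)) d (i.1 + 1)) : ∃ a, slotOf hd ⟨i, a⟩ = p := by
  obtain ⟨a, ha, rfl⟩ := List.getElem_of_mem hp
  refine ⟨⟨a, ?_⟩, rfl⟩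
  rwa [length_slots, hd i] at ha

end SlotLemmas

section Dominance
variable {n : ℕ}

lemma PosRootC.ext' {β β' : PosRootC n} (h : ri β = ri β') (h' : rt β = rt β') : β = β' :=
  Subtype.ext (ofLex.injective (Prod.ext (Fin.ext h) (Fin.ext h')))

lemma PosRootC.le_iff {β β' : PosRootC n} :
    β ≤ β' ↔ ri β < ri β' ∨ ri β = ri β' ∧ rt β ≤ rt β' := by
  rw [← Subtype.coe_le_coe, Prod.Lex.le_iff, Fin.lt_def, Fin.ext_iff, Fin.le_def]
  rfl

/-- The constraints on the labels `o c (β, s, t)` of the variables `x^{(β,s)}_{c,t+1}` which make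
a specialized product of `ζ`-factors nonzero. -/
structure IsZeroFree (d : PosRootC n → ℕ) (o : ℕ → PosRootC n × ℕ × ℕ → ℕ) : Prop where
  asc : ∀ β s c, ¬ isINI β → s < d β → 0 < nuC β c → 0 < nuC β (c + 1) →
    o (c + 1) (β, s, 0) ≤ o c (β, s, 0)
  desc : ∀ β s c, ¬ isINI β → s < d β → nuC β c = 2 → nuC β (c + 1) = 2 →
    o c (β, s, 1) ≤ o (c + 1) (β, s, 1)
  turn : ∀ β s c, ¬ isINI β → s < d β → c + 1 = n → nuC β c = 2 → o c (β, s, 1) ≤ o n (β, s, 0)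
  ini : ∀ β s c t, isINI β → s < d β → ri β ≤ c → c + 1 < n → t < 2 →
    o (c + 1) (β, s, t) ≤ o c (β, s, t)
  last : ∀ β s c, isINI β → s < d β → c + 1 = n → o n (β, s, 0) ≤ o c (β, s, 1)
  swap : ∀ β s, isINI β → s < d β → ∃ c, ri β ≤ c ∧ c < n ∧ o c (β, s, 1) ≤ o c (β, s, 0)

variable {d : PosRootC n → ℕ} {o : ℕ → PosRootC n × ℕ × ℕ → ℕ}

lemma nuC_first (β : PosRootC n) : 0 < nuC β (ri β) := by
  have := PosRootC.bounds β
  simp only [nuC]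
  split_ifs <;> omega

lemma nuC_le_two (β : PosRootC n) (c : ℕ) : nuC β c ≤ 2 := by
  simp only [nuC]
  split_ifs <;> omega

lemma nuC_pos {β : PosRootC n} {c : ℕ} (h : 0 < nuC β c) : ri β ≤ c ∧ c ≤ n := by
  have := PosRootC.bounds β
  simp only [nuC] at h
  split_ifs at h <;> omega

/-- In a group of a root different from `[i,n,i]`, the first variable has the largest label. -/
lemma IsZeroFree.le_first (H : IsZeroFree d o) {β : PosRootC n} {s : ℕ} (hβ : ¬ isINI β)
    (hs : s < d β) {c t : ℕ} (ht : t < nuC β c) : o c (β, s, t) ≤ o (ri β) (β, s, 0) := by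
  have hb := PosRootC.bounds β
  have first : ∀ c, 0 < nuC β c → o c (β, s, 0) ≤ o (ri β) (β, s, 0) := by
    intro c hc
    have h1 := nuC_pos hc
    obtain ⟨j, rfl⟩ := Nat.exists_eq_add_of_le h1.1
    clear h1
    induction j with
    | zero => exact le_rfl
    | succ j ih =>
      have hj : 0 < nuC β (ri β + j) := by
        unfold isINI at hβ
        simp only [nuC] at hc ⊢
        split_ifs at hc ⊢ <;> omega
      exact (H.asc β s _ hβ hs hj hc).trans (ih hj)
  have h2 := nuC_le_two β c
  rcases Nat.lt_or_ge t 1 with ht0 | ht1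
  · obtain rfl : t = 0 := by omega
    exact first c ht
  · obtain rfl : t = 1 := by omega
    have hc2 : nuC β c = 2 := by omega
    clear h2 ht ht1
    have hcn : c + 1 ≤ n := by
      simp only [nuC] at hc2
      split_ifs at hc2 <;> omega
    obtain ⟨j, hj⟩ := Nat.exists_eq_add_of_le hcn
    induction j generalizing c with
    | zero =>
      refine (H.turn β s c hβ hs (by omega) hc2).trans (first n ?_)
      unfold isINI at hβ
      simp only [nuC] at hc2 ⊢
      split_ifs at hc2 ⊢ <;> omega
    | succ j ih =>
      have hc3 : nuC β (c + 1) = 2 := by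
        unfold isINI at hβ
        simp only [nuC] at hc2 ⊢
        split_ifs at hc2 ⊢ <;> omega
      exact (H.desc β s c hβ hs hc2 hc3).trans (ih hc3 (by omega) (by omega))

lemma nuC_ini {β : PosRootC n} (hβ : isINI β) (c : ℕ) :
    nuC β c = if ri β ≤ c ∧ c < n then 2 else if c = n then 1 else 0 := by
  have hb := PosRootC.bounds β
  unfold isINI at hβ
  simp only [nuC]
  split_ifs <;> omega

lemma IsZeroFree.ini_le_first (H : IsZeroFree d o) {β : PosRootC n} {s : ℕ} (hβ : isINI β)
    (hs : s < d β) {c t : ℕ} (ht : t < 2) (hc : ri β ≤ c) (hc' : c < n) :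
    o c (β, s, t) ≤ o (ri β) (β, s, t) := by
  obtain ⟨j, rfl⟩ := Nat.exists_eq_add_of_le hc
  induction j with
  | zero => exact le_rfl
  | succ j ih =>
    exact (H.ini β s (ri β + j) t hβ hs (by omega) (by omega) ht).trans (ih (by omega) (by omega))

lemma IsZeroFree.last_le (H : IsZeroFree d o) {β : PosRootC n} {s : ℕ} (hβ : isINI β)
    (hs : s < d β) {c : ℕ} (hc : ri β ≤ c) (hc' : c < n) :
    o n (β, s, 0) ≤ o c (β, s, 1) := by
  obtain ⟨j, hj⟩ := Nat.exists_eq_add_of_le (show c + 1 ≤ n from hc')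
  induction j generalizing c with
  | zero => exact H.last β s c hβ hs (by omega)
  | succ j ih =>
    exact (ih (by omega) (by omega) (by omega)).trans
      (H.ini β s c 1 hβ hs (by omega) (by omega) (by omega))

/-- The last variable of a group has label at most that of any variable of the first color. -/
lemma IsZeroFree.last_le_first (H : IsZeroFree d o) {β : PosRootC n} {s t : ℕ}
    (hs : s < d β) (hn : 0 < nuC β n) (ht : t < nuC β (ri β)) :
    o n (β, s, 0) ≤ o (ri β) (β, s, t) := by
  by_cases hβ : isINI β
  · have h2 := nuC_le_two β (ri β)
    rcases Nat.lt_or_ge t 1 with ht0 | ht1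
    · obtain rfl : t = 0 := by omega
      obtain ⟨c, hc, hc', h⟩ := H.swap β s hβ hs
      exact (H.last_le hβ hs hc hc').trans (h.trans (H.ini_le_first hβ hs (by omega) hc hc'))
    · obtain rfl : t = 1 := by omega
      exact H.last_le hβ hs le_rfl hβ.2
  · have : t = 0 := by
      have hb := PosRootC.bounds β
      unfold isINI at hβ
      simp only [nuC] at ht
      split_ifs at ht <;> omega
    subst this
    exact H.le_first hβ hs hn

section Blocks
variable {Rs : List (PosRootC n)}

/-- All the variables of the group `(β, s)` have label `m`. -/
def IsFull (o : ℕ → PosRootC n × ℕ × ℕ → ℕ) (β : PosRootC n) (s m : ℕ) : Prop :=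
  ∀ c t, t < nuC β c → o c (β, s, t) = m

/-- The number of variables of color `c` and label `m` is the multiplicity in the root `Rs[m]`. -/
def IsBlockCount (d : PosRootC n → ℕ) (Rs : List (PosRootC n))
    (o : ℕ → PosRootC n × ℕ × ℕ → ℕ) : Prop :=
  ∀ m (hm : m < Rs.length) c, 1 ≤ c → c ≤ n →
    ((slots (nuC (n := n)) d c).filter fun p => o c p = m).length = nuC Rs[m] c

lemma card_le_of_isBlockCount (hc : IsBlockCount d Rs o) {m : ℕ} (hm : m < Rs.length) {c : ℕ}
    (hc1 : 1 ≤ c) (hcn : c ≤ n) {S : Finset (PosRootC n × ℕ × ℕ)}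
    (hS : ∀ p ∈ S, p ∈ slots (nuC (n := n)) d c ∧ o c p = m) : S.card ≤ nuC Rs[m] c := by
  rw [← hc m hm c hc1 hcn, ← List.toFinset_card_of_nodup ((nodup_slots c).filter _)]
  refine Finset.card_le_card fun p hp => ?_
  simpa using hS p hp

lemma exists_of_isBlockCount (hc : IsBlockCount d Rs o) {m : ℕ} (hm : m < Rs.length) {c : ℕ}
    (hc1 : 1 ≤ c) (hcn : c ≤ n) : ∃ S : Finset (PosRootC n × ℕ × ℕ), S.card = nuC Rs[m] c ∧
      ∀ p ∈ S, p ∈ slots (nuC (n := n)) d c ∧ o c p = m := by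
  refine ⟨((slots (nuC (n := n)) d c).filter fun p => o c p = m).toFinset, ?_, ?_⟩
  · rw [← hc m hm c hc1 hcn, ← List.toFinset_card_of_nodup ((nodup_slots c).filter _)]
  · intro p hp
    simpa using hp

lemma IsFull.eq_of_mem (hc : IsBlockCount d Rs o) {m s : ℕ} (hm : m < Rs.length)
    (hs : s < d Rs[m]) (hf : IsFull o Rs[m] s m) {c : ℕ} {p : PosRootC n × ℕ × ℕ}
    (hp : p ∈ slots (nuC (n := n)) d c) (ho : o c p = m) : (p.1, p.2.1) = (Rs[m], s) := by
  classical
  by_contra hne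
  have hpos : 0 < nuC p.1 c := (Nat.zero_le _).trans_lt (mem_slots.1 hp).2
  have h1 := nuC_pos hpos
  have h2 := PosRootC.bounds p.1
  have := card_le_of_isBlockCount hc hm (c := c) (by omega) h1.2
    (S := insert p ((Finset.range (nuC Rs[m] c)).image fun t => (Rs[m], s, t))) ?_
  · rw [Finset.card_insert_of_notMem, Finset.card_image_of_injective, Finset.card_range] at this
    · omega
    · intro a b h
      simpa using h
    · intro h
      obtain ⟨t, -, rfl⟩ := Finset.mem_image.1 h
      exact hne rfl
  · intro q hq
    rcases Finset.mem_insert.1 hq with rfl | hq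
    · exact ⟨hp, ho⟩
    · obtain ⟨t, ht, rfl⟩ := Finset.mem_image.1 hq
      exact ⟨mem_slots.2 ⟨hs, Finset.mem_range.1 ht⟩, hf c t (Finset.mem_range.1 ht)⟩

lemma eq_of_nuC_le {β ρ : PosRootC n} (hβ : ¬ isINI β) (hρ : ¬ isINI ρ) (hi : ri β = ri ρ)
    (ht : rt ρ ≤ rt β) (hν : ∀ c, 1 ≤ c → c ≤ n → nuC β c ≤ nuC ρ c) : β = ρ := by
  refine PosRootC.ext' hi ?_
  by_contra hne
  have hb := PosRootC.bounds β
  have hb' := PosRootC.bounds ρ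
  unfold isINI at hβ hρ
  obtain ⟨c, hc1, hcn, hlt⟩ : ∃ c, 1 ≤ c ∧ c ≤ n ∧ nuC ρ c < nuC β c := by
    by_cases h1 : ri β + rt β < n
    · obtain ⟨c, hc⟩ : ∃ c, c = ri β + rt β := ⟨_, rfl⟩
      have e1 : nuC β c = 1 := by
        simp only [nuC]
        split_ifs <;> omega
      have e2 : nuC ρ c = 0 := by
        simp only [nuC]
        split_ifs <;> omega
      exact ⟨c, by omega, by omega, by rw [e1, e2]; exact one_pos⟩
    by_cases h2 : ri β + rt β = n + 1
    · have e1 : nuC β n = 1 := by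
        simp only [nuC]
        split_ifs <;> omega
      have e2 : nuC ρ n = 0 := by
        simp only [nuC]
        split_ifs <;> omega
      exact ⟨_, by omega, le_rfl, by rw [e1, e2]; exact one_pos⟩
    · obtain ⟨c, hc⟩ : ∃ c, c = 2 * n + 1 - ri β - rt β := ⟨_, rfl⟩
      have e1 : nuC β c = 2 := by
        simp only [nuC]
        split_ifs <;> omega
      have e2 : nuC ρ c ≤ 1 := by
        simp only [nuC]
        split_ifs <;> omega
      exact ⟨c, by omega, by omega, by omega⟩
  exact absurd (hν c hc1 hcn) (not_le.2 hlt)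

/-- A block all of whose smaller blocks are full groups is itself a full group. -/
lemma IsZeroFree.exists_isFull (H : IsZeroFree d o) (hc : IsBlockCount d Rs o)
    {m : ℕ} (hm : m < Rs.length) (f : ℕ → ℕ)
    (hf : ∀ j (hj : j < m), f j < d (Rs[j]'(hj.trans hm)) ∧
      IsFull o (Rs[j]'(hj.trans hm)) (f j) j)
    (hlow : ∀ β s, s < d β → β < Rs[m] → ∃ j, ∃ hj : j < m, Rs[j]'(hj.trans hm) = β ∧ f j = s) :
    ∃ s < d Rs[m], IsFull o Rs[m] s m := by
  obtain ⟨ρ, hρ⟩ : ∃ ρ, ρ = Rs[m] := ⟨_, rfl⟩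
  rw [← hρ] at hlow ⊢
  have hb := PosRootC.bounds ρ
  -- the groups meeting the block in the first color
  have key : ∀ p ∈ slots (nuC (n := n)) d (ri ρ), o (ri ρ) p = m →
      ri p.1 = ri ρ ∧ rt ρ ≤ rt p.1 ∧ ∀ c t, t < nuC p.1 c → m ≤ o c (p.1, p.2.1, t) := by
    rintro ⟨β, s, t⟩ hp ho
    rw [mem_slots] at hp
    have hfree : ¬ ∃ j, ∃ hj : j < m, Rs[j]'(hj.trans hm) = β ∧ f j = s := by
      rintro ⟨j, hj, rfl, rfl⟩
      exact hj.ne (((hf j hj).2 _ _ hp.2).symm.trans ho)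
    have hle : ρ ≤ β := by
      by_contra hlt
      exact hfree (hlow β s hp.1 (not_le.1 hlt))
    have h1 := nuC_pos ((Nat.zero_le _).trans_lt hp.2)
    rw [PosRootC.le_iff] at hle
    refine ⟨by dsimp only at *; omega, by dsimp only at *; omega, fun c t' ht' => ?_⟩
    by_contra hlt
    have hj := not_le.1 hlt
    have := (hf _ hj).2.eq_of_mem hc (hj.trans hm) (hf _ hj).1
      (mem_slots.2 (show s < d β ∧ t' < nuC β c from ⟨hp.1, ht'⟩)) rfl
    simp only [Prod.mk.injEq] at this
    exact hfree ⟨_, hj, this.1.symm, this.2.symm⟩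
  have keyn : ∀ p ∈ slots (nuC (n := n)) d (ri ρ), o (ri ρ) p = m → 0 < nuC p.1 n →
      o n (p.1, p.2.1, 0) = m := by
    rintro ⟨β, s, t⟩ hp ho hn
    obtain ⟨h1, -, h3⟩ := key _ hp ho
    rw [mem_slots] at hp
    refine le_antisymm ?_ (h3 n 0 hn)
    dsimp only at *
    rw [← h1] at ho hp
    rw [← ho]
    exact H.last_le_first hp.1 hn hp.2
  obtain ⟨S, hS, hS'⟩ := exists_of_isBlockCount hc hm hb.1 hb.2.1
  rw [← hρ] at hS
  by_cases hI : isINI ρ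
  · rw [nuC_ini hI, if_pos ⟨le_rfl, hI.2⟩, Finset.card_eq_two] at hS
    obtain ⟨p, q, hpq, rfl⟩ := hS
    have hp := hS' p (by simp)
    have hq := hS' q (by simp)
    have hn1 : nuC ρ n = 1 := by rw [nuC_ini hI]; simp
    have npos : ∀ p : PosRootC n × ℕ × ℕ, ri p.1 = ri ρ → rt ρ ≤ rt p.1 → 0 < nuC p.1 n := by
      intro p h1 h2
      have := PosRootC.bounds p.1
      unfold isINI at hI
      simp only [nuC]
      split_ifs <;> omega
    have kp := key p hp.1 hp.2
    have kq := key q hq.1 hq.2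
    have np := npos p kp.1 kp.2.1
    have nq := npos q kq.1 kq.2.1
    have hgrp : p.1 = q.1 ∧ p.2.1 = q.2.1 := by
      classical
      by_contra hne
      have := card_le_of_isBlockCount hc hm (c := n) (by omega) le_rfl
        (S := {(p.1, p.2.1, 0), (q.1, q.2.1, 0)}) (by
          intro x hx
          rcases Finset.mem_insert.1 hx with rfl | hx
          · exact ⟨mem_slots.2 ⟨(mem_slots.1 hp.1).1, np⟩, keyn p hp.1 hp.2 np⟩
          · rw [Finset.mem_singleton.1 hx]
            exact ⟨mem_slots.2 ⟨(mem_slots.1 hq.1).1, nq⟩, keyn q hq.1 hq.2 nq⟩)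
      rw [Finset.card_pair (fun h => hne (by simpa using h)), ← hρ, hn1] at this
      omega
    obtain ⟨β, s, t⟩ := p
    obtain ⟨β', s', t'⟩ := q
    obtain ⟨rfl, rfl⟩ : β = β' ∧ s = s' := hgrp
    have htt : t ≠ t' := fun h => hpq (by rw [h])
    rw [mem_slots] at hp hq
    dsimp only at *
    have hINI : isINI β := by
      have h1 := hp.1.2
      have h2 := hq.1.2
      have := PosRootC.bounds β
      unfold isINI at hI ⊢
      simp only [nuC] at h1 h2
      split_ifs at h1 h2 <;> omega
    obtain rfl : β = ρ := PosRootC.ext' kp.1 (by have := hINI.1; have := hI.1; omega)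
    have ht2 := nuC_le_two β (ri β)
    have first : ∀ t, t < 2 → o (ri β) (β, s, t) = m := by
      intro a ha
      have : a = t ∨ a = t' := by omega
      rcases this with rfl | rfl
      · exact hp.2
      · exact hq.2
    refine ⟨s, hp.1.1, fun c a ha => le_antisymm ?_ (kp.2.2 c a ha)⟩
    rw [nuC_ini hINI] at ha
    split_ifs at ha with h1 h2
    · exact (H.ini_le_first hINI hp.1.1 ha h1.1 h1.2).trans (first a ha).le
    · obtain rfl : a = 0 := by omega
      rw [h2]
      exact (H.last_le hINI hp.1.1 le_rfl hINI.2).trans (first 1 (by omega)).le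
    · omega
  · obtain ⟨p, hp⟩ : S.Nonempty := by
      rw [← Finset.card_pos, hS]
      exact nuC_first ρ
    have hp := hS' p hp
    have kp := key p hp.1 hp.2
    have kn := keyn p hp.1 hp.2
    obtain ⟨β, s, t⟩ := p
    rw [mem_slots] at hp
    dsimp only at *
    by_cases hβ : isINI β
    · exfalso
      have hn1 : nuC β n = 1 := by rw [nuC_ini hβ]; simp
      have := card_le_of_isBlockCount hc hm (c := n) (by omega) le_rfl
        (S := {(β, s, 0)}) (by
          intro x hx
          rw [Finset.mem_singleton.1 hx]
          exact ⟨mem_slots.2 ⟨hp.1.1, by simp [hn1]⟩, kn (by omega)⟩)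
      rw [Finset.card_singleton, ← hρ] at this
      have hb' := PosRootC.bounds β
      unfold isINI at hI hβ
      simp only [nuC] at this
      split_ifs at this <;> omega
    · have ht0 : t = 0 := by
        have h1 := hp.1.2
        have hb' := PosRootC.bounds β
        unfold isINI at hβ
        simp only [nuC] at h1
        split_ifs at h1 <;> omega
      subst ht0
      have hfull : IsFull o β s m := fun c a ha =>
        le_antisymm ((H.le_first hβ hp.1.1 ha).trans (by rw [kp.1]; exact hp.2.le))
          (kp.2.2 c a ha)
      have : β = ρ := by
        refine eq_of_nuC_le hβ hI kp.1 kp.2.1 fun c hc1 hcn => ?_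
        classical
        have := card_le_of_isBlockCount hc hm (c := c) hc1 hcn
          (S := (Finset.range (nuC β c)).image fun t => (β, s, t)) (by
            intro x hx
            obtain ⟨a, ha, rfl⟩ := Finset.mem_image.1 hx
            exact ⟨mem_slots.2 ⟨hp.1.1, Finset.mem_range.1 ha⟩, hfull c a (Finset.mem_range.1 ha)⟩)
        rwa [Finset.card_image_of_injective _ (fun a b h => by simpa using h),
          Finset.card_range, ← hρ] at this
      subst this
      exact ⟨s, hp.1.1, hfull⟩

end Blocks
end Dominance

section Dominance
variable {n : ℕ} {d d' : PosRootC n → ℕ} {o : ℕ → PosRootC n × ℕ × ℕ → ℕ}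
  {Rs : List (PosRootC n)}

lemma List.count_eq_card_filter_getElem {α : Type} [BEq α] [LawfulBEq α] [DecidableEq α] (l : List α) (a : α) :
    l.count a = (Finset.univ.filter fun j : Fin l.length => l[j] = a).card := by
  conv_lhs => rw [← List.map_getElem_finRange l]
  rw [List.count, List.countP_map, List.countP_eq_length_filter,
    ← List.toFinset_card_of_nodup ((List.nodup_finRange _).filter _)]
  congr 1
  ext j
  simp

lemma exists_finset_of_isFull {β : PosRootC n} {f : ℕ → ℕ}
    (hf : ∀ j (hj : j < Rs.length), Rs[j] = β → f j < d' β ∧ IsFull o β (f j) j) :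
    ∃ S ⊆ Finset.range (d' β), S.card = Rs.count β ∧
      ∀ s ∈ S, ∃ j, ∃ hj : j < Rs.length, Rs[j] = β ∧ f j = s := by
  refine ⟨(Finset.univ.filter fun j : Fin Rs.length => Rs[j] = β).image fun j => f j.1, ?_, ?_, ?_⟩
  · intro s hs
    obtain ⟨j, hj, rfl⟩ := Finset.mem_image.1 hs
    exact Finset.mem_range.2 (hf j j.2 (Finset.mem_filter.1 hj).2).1
  · rw [List.count_eq_card_filter_getElem, Finset.card_image_of_injOn]
    intro i hi j hj hij
    have hi' := (hf i i.2 (Finset.mem_filter.1 hi).2).2 _ _ (nuC_first β)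
    have hj' := (hf j j.2 (Finset.mem_filter.1 hj).2).2 _ _ (nuC_first β)
    dsimp only at hij
    rw [hij, hj'] at hi'
    exact Fin.ext hi'.symm
  · intro s hs
    obtain ⟨j, hj, rfl⟩ := Finset.mem_image.1 hs
    exact ⟨j, j.2, (Finset.mem_filter.1 hj).2, rfl⟩

/-- For `d' < d` no labelling by the blocks of a word of degree `d` avoids the zeros of the
specialization `φ_{d'}`. -/
lemma not_isZeroFree (hs : Rs.Pairwise (· ≤ ·)) (hcount : ∀ β, Rs.count β = d β)
    (hlt : KPltC n d' d) (hc : IsBlockCount d' Rs o) : ¬ IsZeroFree d' o := by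
  intro H
  obtain ⟨γ, hγ, hlow⟩ := hlt
  have claim : ∀ m (hm : m < Rs.length), Rs[m] ≤ γ → ∃ s < d' Rs[m], IsFull o Rs[m] s m := by
    intro m
    induction m using Nat.strong_induction_on with
    | _ m ih =>
      intro hm hmγ
      have hle : ∀ j (hj : j < m), Rs[j] ≤ Rs[m] := fun j hj =>
        List.pairwise_iff_getElem.1 hs j m _ hm hj
      have : ∀ j, ∃ s, ∀ hj : j < m, s < d' (Rs[j]'(hj.trans hm)) ∧
          IsFull o (Rs[j]'(hj.trans hm)) s j := by
        intro j
        by_cases hj : j < m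
        · obtain ⟨s, hs⟩ := ih j hj (hj.trans hm) ((hle j hj).trans hmγ)
          exact ⟨s, fun _ => hs⟩
        · exact ⟨0, fun h => absurd h hj⟩
      choose f hf using this
      refine H.exists_isFull hc hm f hf fun β s hs' hβ => ?_
      have hjm : ∀ j (hj : j < Rs.length), Rs[j] = β → j < m := by
        rintro j hj rfl
        by_contra hmj
        rcases Nat.lt_or_eq_of_le (not_lt.1 hmj) with h | rfl
        · exact absurd (List.pairwise_iff_getElem.1 hs m j hm hj h) (not_le.2 hβ)
        · exact lt_irrefl _ hβ
      obtain ⟨S, hS, hcard, hS'⟩ := exists_finset_of_isFull (d' := d') (o := o) (β := β) (f := f)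
        (Rs := Rs) (by
          rintro j hj rfl
          exact hf j (hjm j hj rfl))
      have : S = Finset.range (d' β) := by
        refine Finset.eq_of_subset_of_card_le hS ?_
        rw [hcard, hcount, Finset.card_range, hlow β (hβ.trans_le hmγ)]
      obtain ⟨j, hj, h1, h2⟩ := hS' s (this ▸ Finset.mem_range.2 hs')
      exact ⟨j, hjm j hj h1, h1, h2⟩
  have : ∀ j, ∃ s, ∀ hj : j < Rs.length, Rs[j] = γ → s < d' γ ∧ IsFull o γ s j := by
    intro j
    by_cases hj : ∃ hj : j < Rs.length, Rs[j] = γ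
    · obtain ⟨hj, h⟩ := hj
      obtain ⟨s, hs⟩ := claim j hj h.le
      rw [h] at hs
      exact ⟨s, fun _ _ => hs⟩
    · exact ⟨0, fun h h' => absurd ⟨h, h'⟩ hj⟩
  choose f hf using this
  obtain ⟨S, hS, hcard, -⟩ := exists_finset_of_isFull hf
  have := Finset.card_le_card hS
  rw [hcard, hcount, Finset.card_range] at this
  omega

end Dominance

section Labels
variable {n : ℕ} {k : Fin n → ℕ} {d : PosRootC n → ℕ}

lemma exists_label {L : List (Fin n × ℤ × ℕ)} {es : List (Vars n k × ℤ × ℕ)} (h : IsEnum L es) :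
    ∃ lab : Vars n k → ℕ, ∀ p ∈ es, p.2.2 = lab p.1 := by
  have : ∀ u, ∃ b, ∀ p ∈ es, p.1 = u → p.2.2 = b := by
    intro u
    obtain ⟨q, hq, rfl⟩ := List.mem_map.1 (h.mem u)
    exact ⟨q.2.2, fun p hp hpq => by rw [List.inj_on_of_nodup_map h.nodup hp hq hpq]⟩
  choose lab hlab using this
  exact ⟨lab, fun p hp => hlab _ p hp rfl⟩

lemma countP_eq_card {α : Type} [Fintype α] {l : List α} (h : l.Nodup) (hm : ∀ a, a ∈ l)
    (P : α → Prop) [DecidablePred P] : l.countP (fun a => P a) = (Finset.univ.filter P).card := by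
  classical
  rw [List.countP_eq_length_filter, ← List.toFinset_card_of_nodup (h.filter _)]
  congr 1
  ext j
  simp [hm]

/-- The label of the variable of color `c` in a given slot. -/
def slotLabel (hd : KPmemC n k d) (lab : Vars n k → ℕ) (c : ℕ) (p : PosRootC n × ℕ × ℕ) : ℕ :=
  open Classical in
  if h : ∃ u : Vars n k, u.1.1 + 1 = c ∧ slotOf hd u = p then lab h.choose else 0

lemma slotLabel_slotOf (hd : KPmemC n k d) (lab : Vars n k → ℕ) (u : Vars n k) :
    slotLabel hd lab (u.1.1 + 1) (slotOf hd u) = lab u := by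
  have h : ∃ v : Vars n k, v.1.1 + 1 = u.1.1 + 1 ∧ slotOf hd v = slotOf hd u := ⟨u, rfl, rfl⟩
  rw [slotLabel, dif_pos h]
  congr 1
  have := h.choose_spec
  exact eq_of_slotOf_eq hd (Fin.ext (by omega)) this.2

lemma slots_eq_map (hd : KPmemC n k d) (i : Fin n) :
    slots (nuC (n := n)) d (i.1 + 1) =
      (List.finRange (k i)).map fun a => slotOf hd (⟨i, a⟩ : Vars n k) := by
  refine List.ext_getElem ?_ ?_
  · simp [length_slots, hd i]
  · intro a h1 h2
    simp [slotOf]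

lemma isBlockCount_slotLabel (hd : KPmemC n k d) {Rs : List (PosRootC n)}
    {L : List (Fin n × ℤ × ℕ)} (hL : IsBlockWord Rs L) {es : List (Vars n k × ℤ × ℕ)}
    (h : IsEnum L es) {lab : Vars n k → ℕ} (hlab : ∀ p ∈ es, p.2.2 = lab p.1) :
    IsBlockCount d Rs (slotLabel hd lab) := by
  intro m hm c hc1 hcn
  obtain ⟨i, rfl⟩ : ∃ i : Fin n, i.1 + 1 = c := ⟨⟨c - 1, by omega⟩, by simp; omega⟩
  have e1 : (es.map Prod.fst).countP (fun u => u.1.1 + 1 = i.1 + 1 ∧ lab u = m) =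
      nuC Rs[m] (i.1 + 1) := by
    rw [← hL.count m hm, ← h.map_eq, List.countP_map, List.countP_map]
    refine List.countP_congr fun p hp => ?_
    simp [hlab p hp]
  rw [← e1, countP_eq_card h.nodup h.mem, slots_eq_map hd, List.filter_map, List.length_map,
    ← List.countP_eq_length_filter, Finset.card_filter, Fintype.sum_sigma,
    Finset.sum_eq_single i]
  · rw [← Finset.card_filter, ← countP_eq_card (List.nodup_finRange _) (List.mem_finRange)]
    refine List.countP_congr fun a _ => ?_
    have := slotLabel_slotOf hd lab (⟨i, a⟩ : Vars n k)
    dsimp only at this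
    simp [this]
  · intro j _ hj
    refine Finset.sum_eq_zero fun a _ => if_neg ?_
    rintro ⟨h', -⟩
    exact hj (Fin.ext (by dsimp only at h'; omega))
  · simp

lemma pairwise_label {Rs : List (PosRootC n)}
    {L : List (Fin n × ℤ × ℕ)} (hL : IsBlockWord Rs L) {es : List (Vars n k × ℤ × ℕ)}
    (h : IsEnum L es) {lab : Vars n k → ℕ} (hlab : ∀ p ∈ es, p.2.2 = lab p.1) :
    (es.map Prod.fst).Pairwise fun u v => lab u ≤ lab v := by
  have := hL.sorted
  rw [← h.map_eq, List.pairwise_map] at this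
  rw [List.pairwise_map]
  refine this.imp_of_mem fun {p q} hp hq hpq => ?_
  rw [← hlab p hp, ← hlab q hq]
  exact hpq

end Labels

section Zeros
variable {n : ℕ} {k : Fin n → ℕ} {d : PosRootC n → ℕ}
open MvPolynomial

/-- The factor `w_{β,s} - v^{-2} w'_{β,s}`. -/
def piC (p : PosRootC n × ℕ) : WR2C n := X (Sum.inl p) - C (vpow (-2)) * X (Sum.inr p)

/-- The exponent of `w_{β,s} - v^{-2} w'_{β,s}` in the normalizing factor `B_β`. -/
def expC (p : PosRootC n × ℕ) : ℕ := if isINI p.1 then n - ri p.1 - 1 else 0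

/-- The ideal generated by the powers of `w_{β,s} - v^{-2} w'_{β,s}` exceeding those in `B_β`. -/
def idealC (n : ℕ) : Ideal (WR2C n) :=
  Ideal.span {q | ∃ p : PosRootC n × ℕ, isINI p.1 ∧ q = piC p ^ (expC p + 1)}

lemma vpow_add (a b : ℤ) : vpow (a + b) = vpow a * vpow b :=
  zpow_add₀ RatFunc.X_ne_zero a b

lemma aeval_zetaNum_eq_zero {u v : Vars n k}
    (h0 : aC n (u.1.1 + 1) (v.1.1 + 1) ≠ 0) {x : WR2C n} {a b : ℤ}
    (hu : phi1subC n d u = C (vpow a) * x) (hv : phi1subC n d v = C (vpow b) * x)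
    (hab : a = b - pairC n u.1 v.1) : aeval (phi1subC n d) (zetaNum u v) = 0 := by
  have e : vpow a = vpow (-pairC n u.1 v.1) * vpow b := by
    rw [← vpow_add, hab]
    congr 1
    ring
  rw [zetaNum, if_neg h0, map_sub, map_mul, aeval_X, aeval_X, aeval_C, hu, hv, e]
  simp only [algebraMap_eq, map_mul]
  ring

lemma le_of_zeta_ne_zero {es : List (Vars n k)} {lab : Vars n k → ℕ}
    (hs : es.Pairwise fun u v => lab u ≤ lab v) (hm : ∀ u, u ∈ es)
    (hne : aeval (phi1subC n d) (numList es) ≠ 0) {u v : Vars n k}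
    (h : aeval (phi1subC n d) (zetaNum u v) = 0) : lab v ≤ lab u := by
  by_contra hlt
  apply hne
  have := mem_orderedPairs_of_lt hs (hm u) (hm v) (not_le.1 hlt)
  have hdvd : zetaNum u v ∣ numList es := List.dvd_prod (List.mem_map.2 ⟨_, this, rfl⟩)
  obtain ⟨c, hc⟩ := hdvd
  rw [hc, map_mul, h, zero_mul]

lemma exists_var (hd : KPmemC n k d) (lab : Vars n k → ℕ) {β : PosRootC n} {s c t : ℕ}
    (hs : s < d β) (ht : t < nuC β c) : ∃ u : Vars n k, u.1.1 + 1 = c ∧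
      phi1subC n d u = specValC n β s t c ∧ slotLabel hd lab c (β, s, t) = lab u := by
  have h1 := nuC_pos ((Nat.zero_le _).trans_lt ht)
  have h2 := PosRootC.bounds β
  obtain ⟨i, rfl⟩ : ∃ i : Fin n, i.1 + 1 = c := ⟨⟨c - 1, by omega⟩, by simp; omega⟩
  obtain ⟨a, ha⟩ := exists_slotOf_eq hd i (mem_slots.2 (show (β, s, t).2.1 < _ ∧ _ from ⟨hs, ht⟩))
  refine ⟨⟨i, a⟩, rfl, ?_, ?_⟩
  · rw [phi1subC_eq hd, ha]
  · rw [← ha]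
    exact slotLabel_slotOf hd lab ⟨i, a⟩

lemma dC_mul_aC_succ {c : ℕ} (hc : c + 1 ≤ n) :
    (dC n c : ℤ) * aC n c (c + 1) = if c + 1 = n then -2 else -1 := by
  unfold dC aC
  split_ifs <;> omega

lemma dC_mul_aC_pred (c : ℕ) :
    (dC n (c + 1) : ℤ) * aC n (c + 1) c = if c + 1 = n then -2 else -1 := by
  unfold dC aC
  split_ifs <;> omega

lemma prod_zetaNum_dvd {l : List (Vars n k)} (hl : l.Nodup) {ι : Type} (S : Finset ι)
    (f : ι → Vars n k × Vars n k) (hf : Set.InjOn f S) (hS : ∀ i ∈ S, f i ∈ orderedPairs l) :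
    ∏ i ∈ S, zetaNum (f i).1 (f i).2 ∣ numList l := by
  classical
  rw [numList, ← List.prod_toFinset _ (nodup_orderedPairs hl),
    ← Finset.prod_image (f := fun p : Vars n k × Vars n k => zetaNum p.1 p.2) hf]
  refine Finset.prod_dvd_prod_of_subset _ _ _ fun p hp => ?_
  obtain ⟨i, hi, rfl⟩ := Finset.mem_image.1 hp
  exact List.mem_toFinset.2 (hS i hi)

lemma aeval_numList_mem (hd : KPmemC n k d) {es : List (Vars n k)} {lab : Vars n k → ℕ}
    (hnd : es.Nodup) (hs : es.Pairwise fun u v => lab u ≤ lab v) (hm : ∀ u, u ∈ es)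
    {β : PosRootC n} {s : ℕ} (hβ : isINI β) (hsd : s < d β)
    (hlt : ∀ c, ri β ≤ c → c < n → slotLabel hd lab c (β, s, 0) < slotLabel hd lab c (β, s, 1)) :
    aeval (phi1subC n d) (numList es) ∈ idealC n := by
  have : ∀ c, ∃ p : Vars n k × Vars n k, ri β ≤ c → c < n → p.1.1.1 + 1 = c ∧
      p ∈ orderedPairs es ∧
      aeval (phi1subC n d) (zetaNum p.1 p.2) = C (vpow (1 - c)) * piC (β, s) := by
    intro c
    by_cases hc : ri β ≤ c ∧ c < n
    · have hν : nuC β c = 2 := by rw [nuC_ini hβ, if_pos hc]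
      obtain ⟨u, rfl, hu1, hu2⟩ := exists_var hd lab hsd (show 0 < nuC β c by omega)
      obtain ⟨v, hv, hv1, hv2⟩ := exists_var hd lab hsd (show 1 < nuC β (u.1.1 + 1) by omega)
      have huv := hlt _ hc.1 hc.2
      rw [hu2, hv2] at huv
      refine ⟨(u, v), fun _ _ => ⟨rfl, mem_orderedPairs_of_lt hs (hm u) (hm v) huv, ?_⟩⟩
      have hv' : v.1 = u.1 := Fin.ext (by omega)
      have hp : pairC n u.1 v.1 = 2 := by
        rw [pairC, hv']
        have := hc.2.ne
        simp [dC, aC, this]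
      have ha : aC n (u.1.1 + 1) (v.1.1 + 1) ≠ 0 := by
        rw [hv']
        simp [aC]
      rw [zetaNum, if_neg ha, map_sub, map_mul, aeval_X, aeval_X, aeval_C, hu1, hv1, hp, piC,
        specValC, specValC, if_pos hβ, if_neg hc.2.ne, if_pos rfl, if_pos hβ, if_neg hc.2.ne,
        if_neg one_ne_zero, algebraMap_eq]
      ring
    · obtain ⟨u, -⟩ := exists_var hd lab hsd (nuC_first β)
      exact ⟨(u, u), fun h h' => absurd ⟨h, h'⟩ hc⟩
  choose f hf using this
  have hdvd := prod_zetaNum_dvd hnd (Finset.Ico (ri β) n) f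
    (fun a ha b hb hab => by
      rw [Finset.coe_Ico, Set.mem_Ico] at ha hb
      rw [← (hf a ha.1 ha.2).1, ← (hf b hb.1 hb.2).1, hab])
    (fun c hc => (hf c (Finset.mem_Ico.1 hc).1 (Finset.mem_Ico.1 hc).2).2.1)
  obtain ⟨c, hc⟩ := hdvd
  rw [hc, map_mul, map_prod, Finset.prod_congr rfl
    fun c hc => (hf c (Finset.mem_Ico.1 hc).1 (Finset.mem_Ico.1 hc).2).2.2,
    Finset.prod_mul_distrib, Finset.prod_const, Nat.card_Ico]
  refine Ideal.mul_mem_right _ _ (Ideal.mul_mem_left _ _ (Ideal.subset_span ⟨(β, s), hβ, ?_⟩))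
  have := hβ.2
  rw [expC, if_pos hβ]
  congr 1
  dsimp only
  omega

lemma isZeroFree_of_notMem (hd : KPmemC n k d) {es : List (Vars n k)}
    {lab : Vars n k → ℕ} (hnd : es.Nodup)
    (hs : es.Pairwise fun u v => lab u ≤ lab v) (hm : ∀ u, u ∈ es)
    (hne : aeval (phi1subC n d) (numList es) ∉ idealC n) :
    IsZeroFree d (slotLabel hd lab) := by
  have hne0 : aeval (phi1subC n d) (numList es) ≠ 0 := fun h => hne (h ▸ (idealC n).zero_mem)
  have key : ∀ {β : PosRootC n} {s c t c' t' : ℕ} {x : WR2C n} {a b e : ℤ}, s < d β →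
      t < nuC β c → t' < nuC β c' → dC n c * aC n c c' = e → e ≠ 0 →
      specValC n β s t c = C (vpow a) * x → specValC n β s t' c' = C (vpow b) * x →
      a = b - e → slotLabel hd lab c' (β, s, t') ≤ slotLabel hd lab c (β, s, t) := by
    intro β s c t c' t' x a b e hsd ht ht' he h0 hu hv hab
    subst he
    obtain ⟨u, rfl, hu1, hu2⟩ := exists_var hd lab hsd ht
    obtain ⟨v, rfl, hv1, hv2⟩ := exists_var hd lab hsd ht'
    rw [hu2, hv2]
    exact le_of_zeta_ne_zero hs hm hne0 (aeval_zetaNum_eq_zero (right_ne_zero_of_mul h0)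
      (hu1.trans hu) (hv1.trans hv) hab)
  constructor
  · intro β s c hβ hsd h1 h2
    have hc := (nuC_pos h2).2
    refine key (x := X (Sum.inl (β, s))) (a := 1 - c) (b := if c + 1 = n then -n else -c) hsd h1 h2
      (dC_mul_aC_succ hc) (by split_ifs <;> simp) ?_ ?_ ?_
    · rw [specValC, if_neg hβ, if_neg (by omega), if_pos rfl]
    · rw [specValC, if_neg hβ]
      split_ifs <;> first | omega | simp
    · split_ifs <;> omega
  · intro β s c hβ hsd h1 h2
    have hc : c + 1 < n := by
      simp only [nuC] at h2
      split_ifs at h2 <;> omega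
    refine key (x := X (Sum.inl (β, s))) (a := (c + 1 : ℕ) - 1 - 2 * n) (b := c - 1 - 2 * n) hsd
      (by omega) (by omega) (dC_mul_aC_pred c) (by split_ifs <;> simp) ?_ ?_ ?_
    · rw [specValC, if_neg hβ, if_neg (by omega), if_neg one_ne_zero]
    · rw [specValC, if_neg hβ, if_neg (by omega), if_neg one_ne_zero]
    · rw [if_neg hc.ne]
      push_cast
      ring
  · rintro β s c hβ hsd rfl h1
    have h2 : 0 < nuC β (c + 1) := by
      unfold isINI at hβ
      simp only [nuC] at h1 ⊢
      split_ifs at h1 ⊢ <;> omega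
    refine key (x := X (Sum.inl (β, s))) (a := -(c + 1 : ℕ)) (b := c - 1 - 2 * (c + 1 : ℕ)) hsd
      (by omega) (by omega) (dC_mul_aC_pred c) (by simp) ?_ ?_ ?_
    · rw [specValC, if_neg hβ, if_pos rfl]
    · rw [specValC, if_neg hβ, if_neg (by omega), if_neg one_ne_zero]
    · rw [if_pos rfl]
      push_cast
      ring
  · intro β s c t hβ hsd hc hcn ht
    refine key (x := if t = 0 then X (Sum.inl (β, s)) else X (Sum.inr (β, s))) (a := 1 - c)
      (b := 1 - (c + 1 : ℕ)) hsd (by rw [nuC_ini hβ, if_pos (by omega)]; exact ht)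
      (by rw [nuC_ini hβ, if_pos (by omega)]; exact ht) (dC_mul_aC_succ hcn.le)
      (by split_ifs <;> simp) ?_ ?_ ?_
    · rw [specValC, if_pos hβ, if_neg (by omega)]
      split_ifs <;> rfl
    · rw [specValC, if_pos hβ, if_neg (by omega)]
      split_ifs <;> rfl
    · rw [if_neg hcn.ne]
      push_cast
      ring
  · rintro β s c hβ hsd rfl
    have hb := hβ.2
    refine key (x := X (Sum.inr (β, s))) (a := 1 - c) (b := -(c + 1 : ℕ)) hsd
      (by rw [nuC_ini hβ, if_pos (by omega)]; omega)
      (by rw [nuC_ini hβ, if_neg (by omega), if_pos rfl]; omega) (dC_mul_aC_succ le_rfl)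
      (by simp) ?_ ?_ ?_
    · rw [specValC, if_pos hβ, if_neg (by omega), if_neg one_ne_zero]
    · rw [specValC, if_pos hβ, if_pos rfl]
    · rw [if_pos rfl]
      push_cast
      ring
  · intro β s hβ hsd
    by_contra! hlt
    exact hne (aeval_numList_mem hd hnd hs hm hβ hsd hlt)

end Zeros

section Normalization
variable {n : ℕ}
open MvPolynomial

lemma vpow_ne_zero (a : ℤ) : vpow a ≠ 0 := zpow_ne_zero _ RatFunc.X_ne_zero

lemma vpow_injective : Function.Injective vpow := by
  have key : ∀ m : ℕ, vpow m = 1 → m = 0 := by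
    intro m hm
    rw [vpow, vv, zpow_natCast, ← RatFunc.algebraMap_X, ← map_pow,
      ← map_one (algebraMap (Polynomial ℚ) (RatFunc ℚ))] at hm
    have := congrArg Polynomial.natDegree (RatFunc.algebraMap_injective ℚ hm)
    simpa using this
  have key' : ∀ a b : ℤ, a ≤ b → vpow a = vpow b → a = b := by
    intro a b hab h
    have e : vpow ((b - a).toNat : ℕ) = 1 := by
      rw [Int.toNat_of_nonneg (by omega)]
      refine mul_left_cancel₀ (vpow_ne_zero a) ?_
      rw [← vpow_add, mul_one, h]
      congr 1
      ring
    have := key _ e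
    omega
  intro a b h
  rcases le_total a b with hab | hab
  · exact key' a b hab h
  · exact (key' b a hab h.symm).symm

/-- The coordinate change turning `w_{β,s} - v^{-2} w'_{β,s}` into a variable. -/
def thetaC (n : ℕ) : WR2C n →ₐ[KK] WR2C n :=
  aeval fun u => match u with
    | Sum.inl p => X (Sum.inl p)
    | Sum.inr p => C (vpow 2) * (X (Sum.inl p) - X (Sum.inr p))

/-- The evaluation at zero of the second family of variables. -/
def rhoC (n : ℕ) : WR2C n →ₐ[KK] WRC n :=
  aeval fun u => match u with
    | Sum.inl p => X p
    | Sum.inr _ => 0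

lemma rhoC_thetaC (q : WR2C n) : rhoC n (thetaC n q) = psi2C n q := by
  have : (rhoC n).comp (thetaC n) = psi2C n := by
    refine MvPolynomial.algHom_ext fun u => ?_
    rcases u with p | p
    · simp [rhoC, thetaC, psi2C]
    · simp [rhoC, thetaC, psi2C, algebraMap_eq]
  exact DFunLike.congr_fun this q

lemma thetaC_piC (p : PosRootC n × ℕ) : thetaC n (piC p) = X (Sum.inr p) := by
  have : (C (vpow (-2)) * C (vpow 2) : WR2C n) = 1 := by
    rw [← C_mul, ← vpow_add]
    simp [vpow]
  simp only [piC, thetaC, map_sub, map_mul, aeval_X, aeval_C, algebraMap_eq]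
  linear_combination (X (Sum.inr p) - X (Sum.inl p)) * this

lemma rhoC_eq_zero {S : Set (PosRootC n × ℕ)} {e : PosRootC n × ℕ → ℕ}
    {m₀ : (PosRootC n × ℕ) ⊕ (PosRootC n × ℕ) →₀ ℕ} (hm₀ : ∀ p, m₀ (Sum.inr p) ≤ e p)
    {Q : WR2C n} (h : monomial m₀ 1 * Q ∈
      Ideal.span ((fun p => (X (Sum.inr p) : WR2C n) ^ (e p + 1)) '' S)) : rhoC n Q = 0 := by
  have hS : (fun p => (X (Sum.inr p) : WR2C n) ^ (e p + 1)) '' S =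
      (fun m => monomial m (1 : KK)) '' ((fun p => Finsupp.single (Sum.inr p) (e p + 1)) '' S) := by
    rw [Set.image_image]
    simp only [X_pow_eq_monomial]
  rw [hS, mem_ideal_span_monomial_image] at h
  rw [rhoC, aeval_def, eval₂_eq]
  refine Finset.sum_eq_zero fun m hm => mul_eq_zero_of_right _ ?_
  obtain ⟨_, ⟨p, -, rfl⟩, hle⟩ := h (m₀ + m) (by
    rw [mem_support_iff, coeff_monomial_mul, one_mul]
    exact mem_support_iff.1 hm)
  have hp := hle (Sum.inr p)
  have hp' := hm₀ p
  rw [Finsupp.single_eq_same, Finsupp.add_apply] at hp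
  have hpos : m (Sum.inr p) ≠ 0 := by omega
  exact Finset.prod_eq_zero (Finsupp.mem_support_iff.2 hpos) (zero_pow hpos)

lemma BprodC_eq (d : PosRootC n → ℕ) : BprodC n d =
    ∏ p ∈ Finset.univ.sigma fun β : PosRootC n => Finset.range (d β),
      (piC (p.1, p.2) ^ expC (p.1, p.2) *
        (X (Sum.inl (p.1, p.2)) - C (vpow 2) * X (Sum.inr (p.1, p.2))) ^ expC (p.1, p.2)) := by
  rw [BprodC, Finset.prod_sigma]
  refine Finset.prod_congr rfl fun β _ => Finset.prod_congr rfl fun s _ => ?_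
  unfold BoneC expC piC
  dsimp only
  split_ifs with h
  · rw [mul_pow]
  · simp

lemma psi2C_eq_zero_of_mem {d : PosRootC n → ℕ} {Q : WR2C n}
    (h : BprodC n d * Q ∈ idealC n) : psi2C n Q = 0 := by
  classical
  set I : Finset (Σ _ : PosRootC n, ℕ) :=
    Finset.univ.sigma fun β : PosRootC n => Finset.range (d β)
  set m₀ : (PosRootC n × ℕ) ⊕ (PosRootC n × ℕ) →₀ ℕ :=
    ∑ p ∈ I, Finsupp.single (Sum.inr (p.1, p.2)) (expC (p.1, p.2))
  set U : WR2C n := ∏ p ∈ I,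
    (X (Sum.inl (p.1, p.2)) - C (vpow 2) * X (Sum.inr (p.1, p.2))) ^ expC (p.1, p.2)
  have hB : thetaC n (BprodC n d) = monomial m₀ 1 * thetaC n U := by
    rw [BprodC_eq, Finset.prod_mul_distrib, map_mul, map_prod]
    congr 1
    rw [monomial_sum_one]
    refine Finset.prod_congr rfl fun p _ => ?_
    rw [map_pow, thetaC_piC, X_pow_eq_monomial]
  have hm₀ : ∀ p, m₀ (Sum.inr p) ≤ expC p := by
    rintro ⟨β, s⟩
    have e : m₀ (Sum.inr (β, s)) = ∑ p ∈ I, if p = ⟨β, s⟩ then expC (β, s) else 0 := by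
      rw [Finsupp.finsetSum_apply]
      refine Finset.sum_congr rfl fun p _ => ?_
      obtain ⟨β', s'⟩ := p
      rw [Finsupp.single_apply]
      refine ite_congr (by simp) (fun h => ?_) fun _ => rfl
      obtain ⟨rfl, rfl⟩ : β' = β ∧ s' = s := by simpa using h
      rfl
    rw [e, Finset.sum_ite_eq']
    split_ifs
    · exact le_rfl
    · exact Nat.zero_le _
  have hJ : monomial m₀ 1 * thetaC n (U * Q) ∈ Ideal.span
      ((fun p => (X (Sum.inr p) : WR2C n) ^ (expC p + 1)) '' {p | isINI p.1}) := by
    have := Ideal.mem_map_of_mem (thetaC n) h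
    rw [map_mul, hB, mul_assoc, ← map_mul, idealC, Ideal.map_span] at this
    refine Ideal.span_mono ?_ this
    rintro _ ⟨_, ⟨p, hp, rfl⟩, rfl⟩
    exact ⟨p, hp, by rw [map_pow, thetaC_piC]⟩
  have h0 := rhoC_eq_zero hm₀ hJ
  rw [rhoC_thetaC, map_mul] at h0
  refine (mul_eq_zero.1 h0).resolve_left ?_
  rw [map_prod]
  refine Finset.prod_ne_zero_iff.2 fun p _ => ?_
  rw [map_pow]
  refine pow_ne_zero _ ?_
  have e : psi2C n (X (Sum.inl (p.1, p.2)) - C (vpow 2) * X (Sum.inr (p.1, p.2))) =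
      C (vpow 0 - vpow 4) * X (p.1, p.2) := by
    rw [show (4 : ℤ) = 2 + 2 from rfl, vpow_add]
    simp [psi2C, algebraMap_eq, vpow]
    ring
  rw [e]
  refine mul_ne_zero ?_ (X_ne_zero _)
  rw [Ne, C_eq_zero, sub_eq_zero]
  exact fun h => by simpa using vpow_injective h

end Normalization

section Nonvanishing
variable {n : ℕ} {k : Fin n → ℕ} {d : PosRootC n → ℕ}
open MvPolynomial

/-- The exponent of `v` in the specialization of the variable `x^{(β,s)}_{c,t+1}`. -/
def specExp (β : PosRootC n) (t c : ℕ) : ℤ :=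
  if isINI β then (if c = n then 2 - n else if t = 0 then 1 - c else 3 - c)
  else (if c = n then -n else if t = 0 then 1 - c else c - 1 - 2 * n)

lemma psi2C_specValC (β : PosRootC n) (s t c : ℕ) :
    psi2C n (specValC n β s t c) = monomial (Finsupp.single (β, s) 1) (vpow (specExp β t c)) := by
  have e : ∀ a : ℤ, psi2C n (C (vpow a) * X (Sum.inl (β, s))) =
      monomial (Finsupp.single (β, s) 1) (vpow a) := fun a => by
    rw [← C_mul_X_eq_monomial]
    simp [psi2C, algebraMap_eq]
  have e' : ∀ a : ℤ, psi2C n (C (vpow a) * X (Sum.inr (β, s))) =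
      monomial (Finsupp.single (β, s) 1) (vpow (a + 2)) := fun a => by
    rw [← C_mul_X_eq_monomial, vpow_add, C_mul, mul_assoc]
    simp [psi2C, algebraMap_eq]
  unfold specValC specExp
  split_ifs
  · rw [e', neg_add_eq_sub]
  · rw [e]
  · rw [e', sub_add_eq_add_sub]
    rfl
  · rw [e]
  · rw [e]
  · rw [e]

lemma specExp_inj {β : PosRootC n} {c t t' : ℕ} (ht : t < nuC β c) (ht' : t' < nuC β c)
    (h : specExp β t c = specExp β t' c) : t = t' := by
  have hb := PosRootC.bounds β
  have h2 := nuC_le_two β c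
  have hc := nuC_pos ((Nat.zero_le _).trans_lt ht)
  have hn : nuC β n ≤ 1 := by
    simp only [nuC]
    split_ifs <;> omega
  rcases Nat.lt_or_eq_of_le hc.2 with h | rfl
  · unfold specExp at *
    split_ifs at * <;> omega
  · omega

lemma psi2C_phi1subC_inj (hd : KPmemC n k d) {u v : Vars n k} (h : u.1 = v.1)
    (huv : psi2C n (phi1subC n d u) = psi2C n (phi1subC n d v)) : u = v := by
  have hu := mem_slots.1 (slotOf_mem hd u)
  have hv := mem_slots.1 (slotOf_mem hd v)
  refine eq_of_slotOf_eq hd h ?_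
  rw [phi1subC_eq hd, phi1subC_eq hd, psi2C_specValC, psi2C_specValC, monomial_eq_monomial_iff]
    at huv
  rcases huv with ⟨h1, h2⟩ | ⟨h1, -⟩
  · rw [Finsupp.single_left_inj one_ne_zero, Prod.mk.injEq] at h1
    rw [← h] at h2 hv
    refine Prod.ext h1.1 (Prod.ext h1.2 ?_)
    rw [← h1.1] at h2 hv
    exact specExp_inj hu.2 hv.2 (vpow_injective h2)
  · exact absurd h1 (vpow_ne_zero _)

lemma psi2C_sameColorDiff_ne_zero (hd : KPmemC n k d) :
    psi2C n (aeval (phi1subC n d) (sameColorDiff k)) ≠ 0 := by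
  simp only [sameColorDiff, map_prod]
  refine Finset.prod_ne_zero_iff.2 fun u _ => Finset.prod_ne_zero_iff.2 fun v _ => ?_
  split_ifs with h
  · rw [map_sub, map_sub, aeval_X, aeval_X, sub_ne_zero]
    exact fun e => h.1 (psi2C_phi1subC_inj hd h.2 e)
  · simp

lemma psi2C_xProd_ne_zero (hd : KPmemC n k d) :
    psi2C n (aeval (phi1subC n d) (xProd n k)) ≠ 0 := by
  simp only [xProd, map_prod]
  refine Finset.prod_ne_zero_iff.2 fun u _ => ?_
  rw [aeval_X, phi1subC_eq hd, psi2C_specValC, Ne, monomial_eq_zero]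
  exact vpow_ne_zero _

end Nonvanishing

/-- **Dominance property of specialization maps (type `C_n`)**: for any choice of quantum root
vectors `E_{β,s}`, any `k ∈ ℕ^n`, any Kostant partitions `d, d' ∈ KP(k)` with `d' < d`, and any
`h ∈ H_{k,d}`, one has `φ_{d'}(Ψ(E_h)) = 0`.  Here `Ψ` is the homomorphism to the shuffle
algebra determined by `e_{i,r} ↦ x_{i,1}^r`, and the specialization map `φ_{d'}` is encoded by
the graph relation `PhiRelC`. -/
theorem specialization_vanishing_typeC (n : ℕ) (hn : 2 ≤ n)
    (Ψ : UA n (aC n) (dC n) →ₗ[KK] BigS n)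
    (hmul : ∀ a b, Ψ (a * b) = bstar n (aC n) (dC n) (Ψ a) (Ψ b))
    (hone : Ψ 1 = DirectSum.of (fun k => Fk n k) 0 1)
    (hgen : ∀ (i : Fin n) (r : ℤ),
      Ψ (ug n (aC n) (dC n) i r) =
        DirectSum.of (fun k => Fk n k) (unitVec i)
          (xvr n (⟨i, ⟨0, by simp [unitVec]⟩⟩ : Vars n (unitVec i)) ^ r))
    (E : PosRootC n × ℤ → UC n) (hE : ∀ p, IsRVC p.1 p.2 (E p))
    (k : Fin n → ℕ) (d d' : PosRootC n → ℕ)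
    (hd : KPmemC n k d) (hd' : KPmemC n k d')
    (h : Lex (PosRootC n × ℤ) →₀ ℕ) (hdeg : ∀ β, degH h β = d β)
    (hlt : KPltC n d' d) :
    ∀ P : FWC n, PhiRelC n d' ((Ψ (EmonC E h)) k) P → P = 0 := by
  rintro P ⟨m, g, q, hg, hq, hP⟩
  have hnum : ∀ F ∈ {F : Fk n k | ∃ L es, IsBlockWord (rootList h) L ∧ IsEnum L es ∧
      F = ordTerm es}, ∃ (M : ℕ) (N : Pk n k), F * algebraMap (Pk n k) (Fk n k)
        (Dpoly n (aC n) k * sameColorDiff k * xProd n k ^ M) = algebraMap (Pk n k) (Fk n k) N ∧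
        MvPolynomial.aeval (phi1subC n d') N ∈ idealC n := by
    rintro F ⟨L, es, hL, hes, rfl⟩
    obtain ⟨M, N, hN, hdvd⟩ := exists_numerator hes
    refine ⟨M, N, hN, ?_⟩
    obtain ⟨lab, hlab⟩ := exists_label hes
    obtain ⟨c, rfl⟩ := hdvd
    rw [map_mul]
    refine Ideal.mul_mem_right _ _ ?_
    by_contra hne
    exact not_isZeroFree (rootList_sorted h)
      (fun β => (count_rootList h β).trans (hdeg β)) hlt (isBlockCount_slotLabel hd' hL hes hlab)
      (isZeroFree_of_notMem hd' hes.nodup (pairwise_label hL hes hlab) hes.mem hne)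
  obtain ⟨M, hM⟩ := exists_mul_mem_of_span (MvPolynomial.aeval (phi1subC n d')) (idealC n) hnum
    (Psi_EmonC_mem hmul hone hgen hE h k) hg
  rw [hq, mul_assoc, mul_assoc] at hM
  have hq0 := psi2C_eq_zero_of_mem hM
  rw [map_mul, map_mul, map_pow] at hq0
  have hq1 : psi2C n q = 0 := (mul_eq_zero.1 hq0).resolve_right
    (mul_ne_zero (psi2C_sameColorDiff_ne_zero hd') (pow_ne_zero _ (psi2C_xProd_ne_zero hd')))
  rw [hq1, map_zero] at hP
  refine (mul_eq_zero.1 hP).resolve_right ?_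
  rw [FaithfulSMul.algebraMap_eq_zero_iff, map_pow, map_pow]
  exact pow_ne_zero _ (psi2C_xProd_ne_zero hd')
end
end

section
/- The trigonometric R-matrix of type D_n satisfies the Yang–Baxter equation with spectral parameters: R̄_{12}(z)·R̄_{13}(zw)·R̄_{23}(w) = R̄_{23}(w)·R̄_{13}(zw)·R̄_{12}(z), as an equality of N³×N³ matrices over the field 𝕂=ℚ(v)(z,w). -/
noncomputable section
open scoped BigOperators

/-- the field `𝕂 = ℚ(v)(z,w)`. -/
abbrev KT : Type := FractionRing (MvPolynomial (Fin 2) KK)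
/-- the inclusion `ℚ(v) → 𝕂`. -/
def cT (a : KK) : KT := algebraMap KK KT a
/-- the variable `z ∈ 𝕂`. -/
def zz : KT := algebraMap (MvPolynomial (Fin 2) KK) KT (MvPolynomial.X 0)
/-- the variable `w ∈ 𝕂`. -/
def ww : KT := algebraMap (MvPolynomial (Fin 2) KK) KT (MvPolynomial.X 1)

section Rmatrix
variable (n : ℕ)

/-- the involution `i ↦ i' = N+1-i` (0-based realization). -/
def prm (i : Fin (2 * n)) : Fin (2 * n) := ⟨2 * n - 1 - i.1, by omega⟩

/-- `ī` for `1 ≤ i ≤ N` (1-based value `i.1+1`): `(n-1,…,1,0,0,-1,…,-(n-1))`. -/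
def barD (i : Fin (2 * n)) : ℤ :=
  if (i.1 + 1 : ℕ) ≤ n then (n : ℤ) - (i.1 + 1) else (n : ℤ) + 1 - (i.1 + 1)

/-- square matrices on `𝕂^N ⊗ 𝕂^N`. -/
abbrev MT := Matrix (Fin (2 * n) × Fin (2 * n)) (Fin (2 * n) × Fin (2 * n)) KT

/-- the elementary tensor `e_{ij} ⊗ e_{kl}`. -/
def E2 (i j k l : Fin (2 * n)) : MT n :=
  fun a b => if a = (i, k) ∧ b = (j, l) then 1 else 0

/-- the permutation operator `P = Σ e_{ij} ⊗ e_{ji}`. -/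
def Pmat : MT n := ∑ i, ∑ j, E2 n i j j i

/-- the operator `Q = Σ v^{ī-j̄} e_{i'j'} ⊗ e_{ij}`. -/
def Qmat : MT n :=
  ∑ i, ∑ j, cT (vpow (barD n i - barD n j)) • E2 n (prm n i) (prm n j) i j

/-- the constant `R`-matrix of type `D_n`. -/
def Rmat : MT n :=
  cT vv • (∑ i, E2 n i i i i) +
  (∑ i, ∑ j, if i ≠ j ∧ i ≠ prm n j then E2 n i i j j else 0) +
  cT vv⁻¹ • (∑ i, E2 n i i (prm n i) (prm n i)) +
  (cT vv - cT vv⁻¹) • (∑ i, ∑ j, if i < j then E2 n i j j i else 0) -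
  (cT vv - cT vv⁻¹) •
    (∑ i, ∑ j, if j < i then cT (vpow (barD n i - barD n j)) • E2 n (prm n i) (prm n j) i j
      else 0)

/-- `ξ = v^{2-N}`. -/
def xiD : KT := cT (vpow (2 - 2 * (n : ℤ)))

/-- the trigonometric `R`-matrix `R̄(u)` of type `D_n` with spectral parameter `u`. -/
def Rbar (u : KT) : MT n :=
  ((u - 1) / (u * cT vv - cT vv⁻¹)) • Rmat n +
  ((cT vv - cT vv⁻¹) / (u * cT vv - cT vv⁻¹)) • Pmat n -
  ((cT vv - cT vv⁻¹) * (u - 1) * xiD n / ((u * cT vv - cT vv⁻¹) * (u - xiD n))) • Qmat n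

/-- square matrices on `𝕂^N ⊗ 𝕂^N ⊗ 𝕂^N`. -/
abbrev MT3 := Matrix (Fin (2 * n) × Fin (2 * n) × Fin (2 * n))
  (Fin (2 * n) × Fin (2 * n) × Fin (2 * n)) KT

/-- embedding acting on the tensor factors `1,2`. -/
def X12 (M : MT n) : MT3 n := fun a b =>
  M (a.1, a.2.1) (b.1, b.2.1) * (if a.2.2 = b.2.2 then 1 else 0)
/-- embedding acting on the tensor factors `1,3`. -/
def X13 (M : MT n) : MT3 n := fun a b =>
  M (a.1, a.2.2) (b.1, b.2.2) * (if a.2.1 = b.2.1 then 1 else 0)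
/-- embedding acting on the tensor factors `2,3`. -/
def X23 (M : MT n) : MT3 n := fun a b =>
  M (a.2.1, a.2.2) (b.2.1, b.2.2) * (if a.1 = b.1 then 1 else 0)

end Rmatrix

section Weights

variable {F : Type*} [Field F] {ι : Type*} [LinearOrder ι]

/-- The weight `1`, `σ`, `0` according to whether `a < b`, `a = b` or `a > b`. -/
def ordWeight (σ : F) (a b : ι) : F := if a < b then 1 else if a = b then σ else 0

/-- The coefficient `x + q s(a, b)` where `s` is `ordWeight σ`. -/
def turn (q σ x : F) (a b : ι) : F := x + q * ordWeight σ a b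

/-- The Kronecker delta. -/
def eqInd (F : Type*) [Field F] (a b : ι) : F := if a = b then 1 else 0

theorem ordWeight_of_lt {σ : F} {a b : ι} (h : a < b) : ordWeight σ a b = 1 := if_pos h

theorem ordWeight_of_gt {σ : F} {a b : ι} (h : b < a) : ordWeight σ a b = 0 := by
  simp [ordWeight, h.not_gt, h.ne']

@[simp] theorem ordWeight_self {σ : F} {a : ι} : ordWeight σ a a = σ := by
  simp [ordWeight]

@[simp] theorem eqInd_self {a : ι} : eqInd F a a = 1 := if_pos rfl

theorem eqInd_of_ne {a b : ι} (h : a ≠ b) : eqInd F a b = 0 := if_neg h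

theorem eqInd_comm (a b : ι) : eqInd F a b = eqInd F b a := by
  simp only [eqInd, eq_comm]

theorem eqInd_mul_congr {a b : ι} {x y : F} (h : a = b → x = y) :
    eqInd F a b * x = eqInd F a b * y := by
  by_cases hab : a = b
  · rw [h hab]
  · simp [eqInd_of_ne hab]

variable {q σ κ : F}

theorem turn_cross (h₁ : q * (2 * σ - 1) = κ) (h₂ : q ^ 2 * (σ * (1 - σ)) = κ) {x y z : F}
    (h : x * z = y * (x + z + q)) (a b c : ι) :
    turn q σ y a c * turn q σ z b a + turn q σ x a b * turn q σ y b c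
        - turn q σ x a c * turn q σ z b c =
      κ * eqInd F a b * (turn q σ y a c + eqInd F a c) := by
  rcases lt_trichotomy a b with hab | hab | hab <;>
    rcases lt_trichotomy b c with hbc | hbc | hbc <;>
    rcases lt_trichotomy a c with hac | hac | hac <;>
    first
    | exfalso; order
    | subst_vars
      simp only [turn, *, ordWeight_of_lt, ordWeight_of_gt, ordWeight_self, eqInd_self,
        eqInd_of_ne, ne_of_lt, ne_of_gt, Ne, not_false_eq_true]
      grind

theorem turn_cross' (h₁ : q * (2 * σ - 1) = κ) (h₂ : q ^ 2 * (σ * (1 - σ)) = κ) {x y z : F}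
    (h : x * z = y * (x + z + q)) (a b c : ι) :
    turn q σ y c a * turn q σ z a b + turn q σ x b a * turn q σ y c b
        - turn q σ x c a * turn q σ z c b =
      κ * eqInd F a b * (turn q σ y c a + eqInd F a c) := by
  rcases lt_trichotomy a b with hab | hab | hab <;>
    rcases lt_trichotomy b c with hbc | hbc | hbc <;>
    rcases lt_trichotomy a c with hac | hac | hac <;>
    first
    | exfalso; order
    | subst_vars
      simp only [turn, *, ordWeight_of_lt, ordWeight_of_gt, ordWeight_self, eqInd_self,
        eqInd_of_ne, ne_of_lt, ne_of_gt, Ne, not_false_eq_true]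
      grind

theorem turn_turn_turn (h₁ : q * (2 * σ - 1) = κ) (h₂ : q ^ 2 * (σ * (1 - σ)) = κ) {x y z : F}
    (h : x * z = y * (x + z + q)) (a b c : ι) :
    turn q σ x a b * turn q σ y b c * turn q σ z a b
        - turn q σ x b c * turn q σ y a b * turn q σ z b c =
      κ * eqInd F b c * turn q σ y a b - κ * eqInd F a b * turn q σ y b c := by
  rcases lt_trichotomy a b with hab | hab | hab <;>
    rcases lt_trichotomy b c with hbc | hbc | hbc <;>
    subst_vars <;>
    simp only [turn, *, ordWeight_of_lt, ordWeight_of_gt, ordWeight_self, eqInd_self,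
      eqInd_of_ne, ne_of_lt, ne_of_gt, Ne, not_false_eq_true] <;>
    grind

theorem ordWeight_mul (x a b : ι) :
    ordWeight σ x a * ordWeight σ x b =
      ordWeight σ x (min a b) + eqInd F x a * ((σ ^ 2 - σ) * eqInd F a b) := by
  rcases lt_trichotomy a b with hab | rfl | hab <;>
    [rw [min_eq_left hab.le]; rw [min_self]; rw [min_eq_right hab.le]]
  · rcases lt_trichotomy x a with hx | rfl | hx
    · simp [ordWeight_of_lt, hx, hx.trans hab, eqInd_of_ne hx.ne]
    · simp [ordWeight_of_lt, hab, eqInd_of_ne hab.ne]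
    · simp [ordWeight_of_gt, hx, eqInd_of_ne hx.ne']
  · rcases lt_trichotomy x a with hx | rfl | hx
    · simp [ordWeight_of_lt, hx, eqInd_of_ne hx.ne]
    · simp; ring
    · simp [ordWeight_of_gt, hx, eqInd_of_ne hx.ne']
  · rcases lt_trichotomy x b with hx | rfl | hx
    · simp [ordWeight_of_lt, hx, hx.trans hab, eqInd_of_ne hab.ne']
    · simp [ordWeight_of_lt, hab, eqInd_of_ne hab.ne']
    · simp [ordWeight_of_gt, hx, eqInd_of_ne hab.ne']

section Sums

variable [Fintype ι] {T V : ι → F}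

theorem sum_eqInd_mul (f : ι → F) (m : ι) : ∑ x, eqInd F x m * f x = f m := by
  simp [eqInd]

theorem sum_ordWeight_mul (h₁ : q * (2 * σ - 1) = κ) (h₂ : q ^ 2 * (σ * (1 - σ)) = κ)
    (hV : ∀ m, q * ∑ x, T x * ordWeight σ x m = V m - T m) (a b : ι) :
    q ^ 2 * ∑ x, T x * (ordWeight σ x a * ordWeight σ x b) =
      q * V (min a b) - q * T a * ordWeight σ a b - q * T b * ordWeight σ b a := by
  have e : ∑ x, T x * (ordWeight σ x a * ordWeight σ x b) =
      ∑ x, T x * ordWeight σ x (min a b) + T a * ((σ ^ 2 - σ) * eqInd F a b) := by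
    simp only [ordWeight_mul, mul_add, Finset.sum_add_distrib]
    rw [← sum_eqInd_mul (fun x => T x * ((σ ^ 2 - σ) * eqInd F a b)) a]
    simp only [mul_left_comm]
  rw [e]
  have hV' := hV (min a b)
  rcases lt_trichotomy a b with h | rfl | h
  · simp only [min_eq_left h.le, ordWeight_of_lt h, ordWeight_of_gt h, eqInd_of_ne h.ne] at hV' ⊢
    linear_combination q * hV'
  · simp only [min_self, ordWeight_self, eqInd_self] at hV' ⊢
    linear_combination q * hV' + T a * h₁ - T a * h₂
  · simp only [min_eq_right h.le, ordWeight_of_lt h, ordWeight_of_gt h, eqInd_of_ne h.ne'] at hV' ⊢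
    linear_combination q * hV'

theorem sum_ordWeight_mul_mul (h₁ : q * (2 * σ - 1) = κ) (h₂ : q ^ 2 * (σ * (1 - σ)) = κ)
    (hV : ∀ m, q * ∑ x, T x * ordWeight σ x m = V m - T m) (a b c : ι) :
    q ^ 3 * ∑ x, T x * (ordWeight σ x a * ordWeight σ x b * ordWeight σ x c) =
      q ^ 2 * V (min (min a b) c) - q ^ 2 * (T a * (ordWeight σ a b * ordWeight σ a c)
        + T b * (ordWeight σ b c * ordWeight σ b a)
        + T c * (ordWeight σ c a * ordWeight σ c b))
        - κ * T a * (eqInd F a b * eqInd F b c) := by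
  have e : ∑ x, T x * (ordWeight σ x a * ordWeight σ x b * ordWeight σ x c) =
      ∑ x, T x * (ordWeight σ x (min a b) * ordWeight σ x c)
        + T a * ((σ ^ 2 - σ) * eqInd F a b * ordWeight σ a c) := by
    simp only [ordWeight_mul _ a b, mul_add, add_mul, Finset.sum_add_distrib]
    rw [← sum_eqInd_mul (fun x => T x * ((σ ^ 2 - σ) * eqInd F a b * ordWeight σ x c)) a]
    simp only [mul_left_comm, mul_assoc]
  have h' := sum_ordWeight_mul h₁ h₂ hV (min a b) c
  rw [e]
  rcases lt_trichotomy a b with h | rfl | h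
  · simp only [min_eq_left h.le, ordWeight_of_lt h, ordWeight_of_gt h, eqInd_of_ne h.ne] at h' ⊢
    rcases lt_trichotomy a c with hc | rfl | hc
    · simp only [ordWeight_of_lt hc, ordWeight_of_gt hc] at h' ⊢
      linear_combination q * h'
    · simp only [ordWeight_of_lt h, ordWeight_of_gt h] at h' ⊢
      linear_combination q * h'
    · simp only [ordWeight_of_lt hc, ordWeight_of_gt hc, ordWeight_of_lt (hc.trans h),
        ordWeight_of_gt (hc.trans h)] at h' ⊢
      linear_combination q * h'
  · simp only [min_self, ordWeight_self, eqInd_self] at h' ⊢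
    rcases lt_trichotomy a c with hc | rfl | hc
    · simp only [ordWeight_of_lt hc, ordWeight_of_gt hc, eqInd_of_ne hc.ne] at h' ⊢
      linear_combination q * h' + q * T a * h₁ - q * T a * h₂
    · simp only [min_self, ordWeight_self, eqInd_self] at h' ⊢
      linear_combination q * h' + T a * (q * σ + 1) * (h₁ - h₂) - T a * h₁
    · simp only [ordWeight_of_lt hc, ordWeight_of_gt hc, eqInd_of_ne hc.ne'] at h' ⊢
      linear_combination q * h'
  · simp only [min_eq_right h.le, ordWeight_of_lt h, ordWeight_of_gt h, eqInd_of_ne h.ne'] at h' ⊢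
    rcases lt_trichotomy b c with hc | rfl | hc
    · simp only [ordWeight_of_lt hc, ordWeight_of_gt hc] at h' ⊢
      linear_combination q * h'
    · simp only [ordWeight_of_lt h, ordWeight_of_gt h] at h' ⊢
      linear_combination q * h'
    · simp only [ordWeight_of_lt hc, ordWeight_of_gt hc, ordWeight_of_lt (hc.trans h),
        ordWeight_of_gt (hc.trans h)] at h' ⊢
      linear_combination q * h'

end Sums

/-- The relations between the scalars `x = (ĝ₁, b₂, ĝ₃)` and `y = (b₁, ĝ₂, b₃)`. -/
structure IsSpectral (q ξ x₁ x₂ x₃ y₁ y₂ y₃ : F) : Prop where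
  cross₁ : y₂ * y₃ = x₁ * (y₂ + y₃ + q)
  cross₂ : y₁ * y₃ = x₂ * (y₁ + y₃ + q)
  cross₃ : y₁ * y₂ = x₃ * (y₁ + y₂ + q)
  prod_x : (x₁ + q) * (x₂ + q) * (x₃ + q) = ξ ^ 2 * (x₁ * x₂ * x₃)
  star (p a b u w r : F) (hp : p = 0 ∨ p = 1) (ha : a = 0 ∨ a = 1) (hb : b = 0 ∨ b = 1)
    (hu : p = a → u = p) (hw : p = b → w = p) (hr : a = b → r = a) :
    (x₁ + q * p) * (x₂ + q * a) * (x₃ + q * b) + ξ * (x₁ * x₂ * x₃)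
      + (y₁ + q * (1 - p)) * (x₂ + q * u) * (x₃ + q * w)
      + (y₂ + q * (1 - a)) * (x₁ + q * u) * (x₃ + q * r)
      + (y₃ + q * (1 - b)) * (x₁ + q * w) * (x₂ + q * r)
      = (y₁ + q * r) * (y₂ + q * w) * (y₃ + q * u)

theorem isSpectral {q ξ z w : F} (hz : z ≠ 1) (hw : w ≠ 1) (hzw : z * w ≠ 1)
    (hz' : z ≠ ξ) (hw' : w ≠ ξ) (hzw' : z * w ≠ ξ) :
    IsSpectral q ξ (-(q * z / (z - ξ))) (q / (z * w - 1)) (-(q * w / (w - ξ)))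
      (q / (z - 1)) (-(q * (z * w) / (z * w - ξ))) (q / (w - 1)) := by
  rw [← sub_ne_zero] at *
  constructor
  · field_simp; ring
  · field_simp; ring
  · field_simp; ring
  · field_simp; ring
  · intro p a b u s r hp ha hb hu hs hr
    rcases hp with rfl | rfl <;> rcases ha with rfl | rfl <;> rcases hb with rfl | rfl <;>
      simp only [forall_const, zero_ne_one, one_ne_zero, IsEmpty.forall_iff] at hu hs hr <;>
      simp only [*] <;> field_simp <;> ring

section Reverse

variable {ι : Type*} [LinearOrder ι] {r : ι → ι}

/-- An order-reversing involution without fixed points. -/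
structure IsReversal (r : ι → ι) : Prop where
  involutive : Function.Involutive r
  lt_iff (a b : ι) : r a < r b ↔ b < a
  ne_self (a : ι) : r a ≠ a

variable {F : Type*} [Field F] {q σ κ ξ c : F}

theorem IsReversal.ordWeight_apply (hr : IsReversal r) (a b : ι) :
    ordWeight σ (r a) (r b) = ordWeight σ b a := by
  rcases lt_trichotomy a b with h | rfl | h
  · rw [ordWeight_of_gt h, ordWeight_of_gt ((hr.lt_iff b a).2 h)]
  · simp
  · rw [ordWeight_of_lt h, ordWeight_of_lt ((hr.lt_iff a b).2 h)]

theorem IsReversal.turn_apply (hr : IsReversal r) (x : F) (a b : ι) :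
    turn q σ x (r a) (r b) = turn q σ x b a := by
  rw [turn, hr.ordWeight_apply, turn]

theorem IsReversal.ordWeight_left (hr : IsReversal r) (a b : ι) :
    ordWeight σ (r a) b = ordWeight σ (r b) a := by
  rw [← hr.ordWeight_apply, hr.involutive]

theorem IsReversal.lt_left (hr : IsReversal r) {a b : ι} : r a < b ↔ r b < a := by
  rw [← hr.lt_iff, hr.involutive]

theorem IsReversal.lt_right (hr : IsReversal r) {a b : ι} : a < r b ↔ b < r a := by
  rw [← hr.lt_iff, hr.involutive]

theorem IsReversal.ordWeight_self_cases (hr : IsReversal r) (a : ι) :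
    (r a < a ∧ ordWeight σ (r a) a = 1 ∧ ordWeight σ a (r a) = 0) ∨
      (a < r a ∧ ordWeight σ (r a) a = 0 ∧ ordWeight σ a (r a) = 1) := by
  rcases (hr.ne_self a).lt_or_gt with h | h
  · exact .inl ⟨h, ordWeight_of_lt h, ordWeight_of_gt h⟩
  · exact .inr ⟨h, ordWeight_of_gt h, ordWeight_of_lt h⟩

theorem IsReversal.ordWeight_swap (hr : IsReversal r) (a : ι) :
    ordWeight σ a (r a) = 1 - ordWeight σ (r a) a := by
  rcases hr.ordWeight_self_cases (σ := σ) a with h | h <;> simp [h]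

theorem IsReversal.ordWeight_self_eq (hr : IsReversal r) (a : ι) :
    ordWeight σ (r a) a = 0 ∨ ordWeight σ (r a) a = 1 := by
  rcases hr.ordWeight_self_cases (σ := σ) a with h | h <;> simp [h]

theorem IsReversal.ordWeight_eq_of_eq (hr : IsReversal r) (a b : ι)
    (h : ordWeight σ (r a) a = ordWeight σ (r b) b) :
    ordWeight σ (r a) b = ordWeight σ (r a) a := by
  rcases hr.ordWeight_self_cases (σ := σ) a with ha | ha <;>
    rcases hr.ordWeight_self_cases (σ := σ) b with hb | hb
  · rw [ha.2.1, ordWeight_of_lt]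
    by_contra! hab
    have := hr.lt_left.not.1 hab.not_gt
    order
  · simp [ha, hb] at h
  · simp [ha, hb] at h
  · rw [ha.2.1, ordWeight_of_gt]
    by_contra! hab
    have := hr.lt_right.not.1 hab.not_gt
    order

theorem IsReversal.ordWeight_min (hr : IsReversal r) (a b : ι) :
    ordWeight σ (r (min a b)) (min a b) = ordWeight σ (r a) a * ordWeight σ (r b) b := by
  wlog hab : a ≤ b
  · rw [min_comm, this hr b a (le_of_not_ge hab), mul_comm]
  rw [min_eq_left hab]
  rcases hr.ordWeight_self_cases (σ := σ) a with ha | ha <;>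
    rcases hr.ordWeight_self_cases (σ := σ) b with hb | hb <;> simp only [ha, hb, mul_one, mul_zero]
  have := hr.lt_left.1 (ha.1.trans_le hab)
  order

variable [Fintype ι] {T : ι → F} {x₁ x₂ x₃ y₁ y₂ y₃ : F}

theorem sum_turn_mul_mul (hr : IsReversal r) (hq : q ≠ 0)
    (h₁ : q * (2 * σ - 1) = κ) (h₂ : q ^ 2 * (σ * (1 - σ)) = κ)
    (hx : IsSpectral q ξ x₁ x₂ x₃ y₁ y₂ y₃)
    (hT : ∀ m, q * ∑ x, T x * ordWeight σ x m = c + q * ordWeight σ (r m) m - T m)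
    (hS : q * ∑ x, T x = q * (1 + ξ) - c * (ξ ^ 2 - 1)) (i j k : ι) :
    ∑ x, T x * (turn q σ x₁ x i * turn q σ x₂ x j * turn q σ x₃ x k)
      + T i * (turn q σ x₂ i j * turn q σ x₃ i k)
      + T j * (turn q σ x₁ j i * turn q σ x₃ j k)
      + T k * (turn q σ x₁ k i * turn q σ x₂ k j)
      + turn q σ y₁ i (r i) * turn q σ x₂ (r i) j * turn q σ x₃ (r i) k
      + turn q σ y₂ j (r j) * turn q σ x₁ (r j) i * turn q σ x₃ (r j) k
      + turn q σ y₃ k (r k) * turn q σ x₁ (r k) i * turn q σ x₂ (r k) j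
      = turn q σ y₁ (r j) k * turn q σ y₂ (r i) k * turn q σ y₃ (r i) j
        - κ * T i * (eqInd F i j * eqInd F j k) := by
  have e : ∑ x, T x * (turn q σ x₁ x i * turn q σ x₂ x j * turn q σ x₃ x k) =
      x₁ * x₂ * x₃ * ∑ x, T x
        + x₂ * x₃ * (q * ∑ x, T x * ordWeight σ x i)
        + x₁ * x₃ * (q * ∑ x, T x * ordWeight σ x j)
        + x₁ * x₂ * (q * ∑ x, T x * ordWeight σ x k)
        + x₃ * (q ^ 2 * ∑ x, T x * (ordWeight σ x i * ordWeight σ x j))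
        + x₂ * (q ^ 2 * ∑ x, T x * (ordWeight σ x i * ordWeight σ x k))
        + x₁ * (q ^ 2 * ∑ x, T x * (ordWeight σ x j * ordWeight σ x k))
        + q ^ 3 * ∑ x, T x * (ordWeight σ x i * ordWeight σ x j * ordWeight σ x k) := by
    simp only [Finset.mul_sum, ← Finset.sum_add_distrib]
    refine Finset.sum_congr rfl fun x _ => ?_
    simp only [turn]
    ring
  have hs := hx.star _ _ _ (ordWeight σ (r i) j) (ordWeight σ (r i) k) (ordWeight σ (r j) k)
    (hr.ordWeight_self_eq (σ := σ) i) (hr.ordWeight_self_eq j) (hr.ordWeight_self_eq k)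
    (hr.ordWeight_eq_of_eq i j) (hr.ordWeight_eq_of_eq i k) (hr.ordWeight_eq_of_eq j k)
  rw [e, sum_ordWeight_mul_mul h₁ h₂ hT, sum_ordWeight_mul h₁ h₂ hT, sum_ordWeight_mul h₁ h₂ hT,
    sum_ordWeight_mul h₁ h₂ hT, hT, hT, hT]
  simp only [turn, hr.ordWeight_min, hr.ordWeight_swap, hr.ordWeight_left j i,
    hr.ordWeight_left k i, hr.ordWeight_left k j]
  refine mul_left_cancel₀ hq ?_
  linear_combination x₁ * x₂ * x₃ * hS + c * hx.prod_x + q * hs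

end Reverse

section Matchings

variable {ι : Type*} [LinearOrder ι] {r : ι → ι} {F : Type*} [Field F] {q σ κ ξ c : F} {t : ι → F}

/-- The indicator that `r` matches `x` with `y`. -/
def cap (F : Type*) [Field F] (r : ι → ι) (x y : ι) : F := eqInd F x (r y)

/-- The coefficient of the contraction operators. -/
def contr (q σ : F) (r : ι → ι) (t : ι → F) (g : F) (x y : ι) : F :=
  t y * t (r x) * turn q σ g y x

theorem IsReversal.cap_comm (hr : IsReversal r) (x y : ι) : cap F r x y = cap F r y x := by
  simp only [cap, eqInd, ← hr.involutive.eq_iff (x := x), eq_comm (a := r x)]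

theorem cap_mul_congr (hr : IsReversal r) {x₁ x₂ x₃ y₁ y₂ y₃ : ι} {A B : F}
    (h : y₁ = r x₁ → y₂ = r x₂ → y₃ = r x₃ → A = B) :
    cap F r x₁ y₁ * cap F r x₂ y₂ * cap F r x₃ y₃ * A =
      cap F r x₁ y₁ * cap F r x₂ y₂ * cap F r x₃ y₃ * B := by
  simp only [mul_assoc, cap]
  refine eqInd_mul_congr fun h₁ => eqInd_mul_congr fun h₂ => eqInd_mul_congr fun h₃ => ?_
  exact h (by rw [h₁, hr.involutive]) (by rw [h₂, hr.involutive]) (by rw [h₃, hr.involutive])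

theorem IsReversal.turn_left (hr : IsReversal r) (x : F) (a b : ι) :
    turn q σ x (r a) b = turn q σ x (r b) a := by
  rw [← hr.turn_apply, hr.involutive]

theorem IsReversal.contr_apply (hr : IsReversal r) (g : F) (a b : ι) :
    contr q σ r t g (r a) (r b) = contr q σ r t g b a := by
  rw [contr, contr, hr.turn_apply, hr.involutive, mul_comm (t (r b))]

theorem IsReversal.contr_right (hr : IsReversal r) (g : F) (a b : ι) :
    contr q σ r t g a (r b) = contr q σ r t g b (r a) := by
  rw [← hr.contr_apply, hr.involutive]

variable {g₁ g₂ g₃ b₁ b₂ b₃ : F}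

theorem through_sum_eq_zero (hr : IsReversal r)
    (h₁ : q * (2 * σ - 1) = κ) (h₂ : q ^ 2 * (σ * (1 - σ)) = κ)
    (hx : IsSpectral q ξ g₁ b₂ g₃ b₁ g₂ b₃) (x₁ x₂ x₃ x₄ x₅ x₆ : ι) :
    cap F r x₁ x₅ * cap F r x₂ x₆ * cap F r x₃ x₄ *
        (turn q σ b₂ x₁ x₃ * turn q σ b₃ x₂ x₁ + turn q σ b₁ x₁ x₂ * turn q σ b₂ x₂ x₃
          - turn q σ b₁ x₄ x₅ * turn q σ b₃ x₄ x₆)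
      + cap F r x₁ x₆ * cap F r x₂ x₅ * cap F r x₃ x₄ *
        (turn q σ b₂ x₁ x₃ + turn q σ b₁ x₁ x₂ * turn q σ b₂ x₂ x₃ * turn q σ b₃ x₁ x₂
          - turn q σ b₂ x₄ x₆ - turn q σ b₁ x₄ x₅ * turn q σ b₂ x₅ x₆ * turn q σ b₃ x₄ x₅)
      - cap F r x₁ x₆ * cap F r x₂ x₄ * cap F r x₃ x₅ *
        (turn q σ b₂ x₄ x₆ * turn q σ b₃ x₅ x₄ + turn q σ b₁ x₄ x₅ * turn q σ b₂ x₅ x₆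
          - turn q σ b₁ x₁ x₂ * turn q σ b₃ x₁ x₃) = 0 := by
  have hb : b₁ * b₃ = b₂ * (b₁ + b₃ + q) := hx.cross₂
  have e₁ : cap F r x₁ x₅ * cap F r x₂ x₆ * cap F r x₃ x₄ *
        (turn q σ b₂ x₁ x₃ * turn q σ b₃ x₂ x₁ + turn q σ b₁ x₁ x₂ * turn q σ b₂ x₂ x₃
          - turn q σ b₁ x₄ x₅ * turn q σ b₃ x₄ x₆) =
      cap F r x₁ x₅ * cap F r x₂ x₆ * cap F r x₃ x₄ *
        (κ * eqInd F x₁ x₂ * (turn q σ b₂ x₁ x₃ + eqInd F x₁ x₃)) :=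
    cap_mul_congr hr <| by
      rintro rfl rfl rfl
      simp only [hr.turn_apply]
      exact turn_cross h₁ h₂ hb x₁ x₂ x₃
  have e₂ : cap F r x₁ x₆ * cap F r x₂ x₅ * cap F r x₃ x₄ *
        (turn q σ b₂ x₁ x₃ + turn q σ b₁ x₁ x₂ * turn q σ b₂ x₂ x₃ * turn q σ b₃ x₁ x₂
          - turn q σ b₂ x₄ x₆ - turn q σ b₁ x₄ x₅ * turn q σ b₂ x₅ x₆ * turn q σ b₃ x₄ x₅) =
      cap F r x₁ x₆ * cap F r x₂ x₅ * cap F r x₃ x₄ *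
        (κ * eqInd F x₂ x₃ * turn q σ b₂ x₁ x₂ - κ * eqInd F x₁ x₂ * turn q σ b₂ x₂ x₃) :=
    cap_mul_congr hr <| by
      rintro rfl rfl rfl
      simp only [hr.turn_apply]
      linear_combination turn_turn_turn h₁ h₂ hb x₁ x₂ x₃
  have e₃ : cap F r x₁ x₆ * cap F r x₂ x₄ * cap F r x₃ x₅ *
        (turn q σ b₂ x₄ x₆ * turn q σ b₃ x₅ x₄ + turn q σ b₁ x₄ x₅ * turn q σ b₂ x₅ x₆
          - turn q σ b₁ x₁ x₂ * turn q σ b₃ x₁ x₃) =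
      cap F r x₁ x₆ * cap F r x₂ x₄ * cap F r x₃ x₅ *
        (κ * eqInd F x₂ x₃ * (turn q σ b₂ x₁ x₂ + eqInd F x₁ x₂)) :=
    cap_mul_congr hr <| by
      rintro rfl rfl rfl
      simp only [hr.turn_apply]
      rw [eqInd_comm x₁ x₂]
      exact turn_cross' h₁ h₂ hb x₂ x₃ x₁
  rw [e₁, e₂, e₃]
  rcases eq_or_ne x₂ x₃ with rfl | h₂₃ <;> rcases eq_or_ne x₁ x₂ with rfl | h₁₂ <;>
    simp only [eqInd_self, eqInd_of_ne, Ne, not_false_eq_true, *] <;> ring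

theorem contr_cross (ht : ∀ x, t x * t (r x) = 1)
    (h₁ : q * (2 * σ - 1) = κ) (h₂ : q ^ 2 * (σ * (1 - σ)) = κ) {x y z : F}
    (h : x * z = y * (x + z + q)) (i j k : ι) :
    contr q σ r t x i j * contr q σ r t y j k + turn q σ z i j * contr q σ r t y i k
        - turn q σ z k j * contr q σ r t x i k =
      κ * eqInd F i j * (contr q σ r t y i k + eqInd F i k) := by
  have hik : eqInd F i k * (t k * t (r i)) = eqInd F i k * 1 :=
    eqInd_mul_congr fun h => by rw [h, ht]
  simp only [contr]
  linear_combination t k * t (r i) * turn_cross' h₁ h₂ h i j k + κ * eqInd F i j * hik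
    + t k * t (r i) * turn q σ x j i * turn q σ y k j * ht j

theorem contr_contr_turn (ht : ∀ x, t x * t (r x) = 1)
    (h₁ : q * (2 * σ - 1) = κ) (h₂ : q ^ 2 * (σ * (1 - σ)) = κ) {x y z : F}
    (h : x * z = y * (x + z + q)) (i j k : ι) :
    contr q σ r t y i j * contr q σ r t x j k * turn q σ z k j
        - contr q σ r t y j k * contr q σ r t x i j * turn q σ z j i =
      κ * eqInd F i j * contr q σ r t y j k - κ * eqInd F j k * contr q σ r t y i j := by
  have hij : eqInd F i j * (t k * t (r i)) = eqInd F i j * (t k * t (r j)) :=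
    eqInd_mul_congr fun h => by rw [h]
  have hjk : eqInd F j k * (t k * t (r i)) = eqInd F j k * (t j * t (r i)) :=
    eqInd_mul_congr fun h => by rw [h]
  have := turn_turn_turn h₁ h₂ h k j i
  rw [eqInd_comm j i, eqInd_comm k j] at this
  simp only [contr]
  linear_combination t k * t (r i) * t j * t (r j) * this
    + (κ * eqInd F i j * (t k * t (r i)) * turn q σ y k j
      - κ * eqInd F j k * (t k * t (r i)) * turn q σ y j i) * ht j
    + κ * turn q σ y k j * hij - κ * turn q σ y j i * hjk

theorem mixed_sum_eq_zero (hr : IsReversal r) (ht : ∀ x, t x * t (r x) = 1)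
    (h₁ : q * (2 * σ - 1) = κ) (h₂ : q ^ 2 * (σ * (1 - σ)) = κ)
    (hx : IsSpectral q ξ g₁ b₂ g₃ b₁ g₂ b₃) (x₁ x₂ x₃ x₄ x₅ x₆ : ι) :
    cap F r x₁ x₃ * cap F r x₂ x₆ * cap F r x₄ x₅ *
        (contr q σ r t g₂ x₁ (r x₄) * turn q σ b₃ x₂ x₄
          - contr q σ r t g₁ x₄ (r x₁) * turn q σ b₃ x₁ x₆
          - contr q σ r t g₁ x₄ (r x₆) * contr q σ r t g₂ (r x₆) (r x₁))
      + cap F r x₁ x₂ * cap F r x₃ x₆ * cap F r x₄ x₅ *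
        (contr q σ r t g₁ x₁ (r x₄)
          + contr q σ r t g₁ x₁ (r x₃) * contr q σ r t g₂ (r x₃) (r x₄) * turn q σ b₃ x₃ x₄
          - contr q σ r t g₁ x₄ (r x₁)
          - contr q σ r t g₁ x₄ (r x₆) * contr q σ r t g₂ (r x₆) (r x₁) * turn q σ b₃ x₆ x₁)
      - cap F r x₁ x₂ * cap F r x₃ x₅ * cap F r x₄ x₆ *
        (contr q σ r t g₂ x₄ (r x₁) * turn q σ b₃ x₅ x₁
          - contr q σ r t g₁ x₁ (r x₄) * turn q σ b₃ x₄ x₃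
          - contr q σ r t g₁ x₁ (r x₃) * contr q σ r t g₂ (r x₃) (r x₄)) = 0 := by
  have hb : g₂ * b₃ = g₁ * (g₂ + b₃ + q) := hx.cross₁
  have e₁ : cap F r x₁ x₃ * cap F r x₂ x₆ * cap F r x₄ x₅ *
        (contr q σ r t g₂ x₁ (r x₄) * turn q σ b₃ x₂ x₄
          - contr q σ r t g₁ x₄ (r x₁) * turn q σ b₃ x₁ x₆
          - contr q σ r t g₁ x₄ (r x₆) * contr q σ r t g₂ (r x₆) (r x₁)) =
      cap F r x₁ x₃ * cap F r x₂ x₆ * cap F r x₄ x₅ *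
        -(κ * cap F r x₁ x₂ * (contr q σ r t g₁ x₁ (r x₄) + cap F r x₁ x₄)) :=
    cap_mul_congr hr <| by
      rintro rfl rfl rfl
      have h := contr_cross ht h₁ h₂ hb x₁ (r x₂) (r x₄)
      simp only [hr.turn_apply, hr.contr_apply, hr.involutive _, cap] at h ⊢
      rw [hr.contr_right _ x₄ x₁, hr.contr_right _ x₂ x₁]
      linear_combination -h
  have e₂ : cap F r x₁ x₂ * cap F r x₃ x₆ * cap F r x₄ x₅ *
        (contr q σ r t g₁ x₁ (r x₄)
          + contr q σ r t g₁ x₁ (r x₃) * contr q σ r t g₂ (r x₃) (r x₄) * turn q σ b₃ x₃ x₄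
          - contr q σ r t g₁ x₄ (r x₁)
          - contr q σ r t g₁ x₄ (r x₆) * contr q σ r t g₂ (r x₆) (r x₁) * turn q σ b₃ x₆ x₁) =
      cap F r x₁ x₂ * cap F r x₃ x₆ * cap F r x₄ x₅ *
        (κ * cap F r x₁ x₃ * contr q σ r t g₁ x₄ x₃
          - κ * eqInd F x₃ x₄ * contr q σ r t g₁ x₁ (r x₃)) :=
    cap_mul_congr hr <| by
      rintro rfl rfl rfl
      have h := contr_contr_turn ht h₁ h₂ hb x₁ (r x₃) (r x₄)
      have h' : eqInd F (r x₃) (r x₄) = eqInd F x₃ x₄ := by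
        simp only [eqInd, hr.involutive.injective.eq_iff]
      simp only [hr.turn_apply, hr.contr_apply, hr.involutive _, cap, h'] at h ⊢
      rw [hr.contr_right _ x₄ x₁, hr.contr_right _ x₃ x₁]
      linear_combination h
  have e₃ : cap F r x₁ x₂ * cap F r x₃ x₅ * cap F r x₄ x₆ *
        (contr q σ r t g₂ x₄ (r x₁) * turn q σ b₃ x₅ x₁
          - contr q σ r t g₁ x₁ (r x₄) * turn q σ b₃ x₄ x₃
          - contr q σ r t g₁ x₁ (r x₃) * contr q σ r t g₂ (r x₃) (r x₄)) =
      cap F r x₁ x₂ * cap F r x₃ x₅ * cap F r x₄ x₆ *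
        -(κ * eqInd F x₃ x₄ * (contr q σ r t g₁ x₁ (r x₄) + cap F r x₁ x₄)) :=
    cap_mul_congr hr <| by
      rintro rfl rfl rfl
      have h := contr_cross ht h₁ h₂ hb x₄ x₃ (r x₁)
      rw [hr.contr_right g₁ x₄ x₁, hr.contr_right g₂ x₄ x₁, hr.contr_right _ x₃ x₁, eqInd_comm x₄ x₃,
        ← cap, hr.cap_comm x₄ x₁] at h
      rw [hr.contr_right g₂ x₄ x₁, hr.turn_left _ x₃ x₁, hr.contr_apply]
      linear_combination -h
  rw [e₁, e₂, e₃]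
  have k₁ : cap F r x₁ x₂ * cap F r x₁ x₃ * cap F r x₄ x₅ *
        (cap F r x₂ x₆ * contr q σ r t g₁ x₁ (r x₄)) =
      cap F r x₁ x₂ * cap F r x₁ x₃ * cap F r x₄ x₅ * (cap F r x₃ x₆ * contr q σ r t g₁ x₄ x₃) :=
    cap_mul_congr hr <| by
      rintro rfl rfl rfl
      rw [hr.contr_right]
  have k₂ : cap F r x₁ x₂ * cap F r x₁ x₃ * cap F r x₄ x₅ * (cap F r x₂ x₆ * cap F r x₁ x₄) =
      cap F r x₁ x₂ * cap F r x₁ x₃ * cap F r x₄ x₅ * (cap F r x₃ x₆ * eqInd F x₃ x₄) :=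
    cap_mul_congr hr <| by
      rintro rfl rfl rfl
      rw [hr.cap_comm x₁ x₄, eqInd_comm (r x₁) x₄]
      rfl
  rcases eq_or_ne x₃ x₄ with rfl | h
  · linear_combination -κ * k₁ - κ * k₂
  · rw [eqInd_of_ne h] at *
    linear_combination -κ * k₁ - κ * k₂

theorem mixed_sum_eq_zero' (hr : IsReversal r) (ht : ∀ x, t x * t (r x) = 1)
    (h₁ : q * (2 * σ - 1) = κ) (h₂ : q ^ 2 * (σ * (1 - σ)) = κ)
    (hx : IsSpectral q ξ g₁ b₂ g₃ b₁ g₂ b₃) (x₁ x₂ x₃ x₄ x₅ x₆ : ι) :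
    cap F r x₁ x₃ * cap F r x₂ x₄ * cap F r x₅ x₆ *
        (contr q σ r t g₂ x₁ (r x₄) * contr q σ r t g₃ x₂ (r x₅)
          + turn q σ b₁ x₁ x₂ * contr q σ r t g₃ x₁ (r x₅)
          - turn q σ b₁ x₄ x₅ * contr q σ r t g₂ x₅ (r x₁))
      + cap F r x₁ x₄ * cap F r x₂ x₃ * cap F r x₅ x₆ *
        (contr q σ r t g₃ x₂ (r x₅)
          + turn q σ b₁ x₁ x₂ * contr q σ r t g₂ x₂ (r x₄) * contr q σ r t g₃ x₁ (r x₅)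
          - contr q σ r t g₃ x₅ (r x₂)
          - turn q σ b₁ x₄ x₅ * contr q σ r t g₂ x₅ (r x₁) * contr q σ r t g₃ x₄ (r x₂))
      - cap F r x₁ x₅ * cap F r x₂ x₃ * cap F r x₄ x₆ *
        (contr q σ r t g₂ x₄ (r x₁) * contr q σ r t g₃ x₅ (r x₂)
          + turn q σ b₁ x₄ x₅ * contr q σ r t g₃ x₄ (r x₂)
          - turn q σ b₁ x₁ x₂ * contr q σ r t g₂ x₂ (r x₄)) = 0 := by
  have hb : g₂ * b₁ = g₃ * (g₂ + b₁ + q) := by linear_combination hx.cross₃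
  have e₁ : cap F r x₁ x₃ * cap F r x₂ x₄ * cap F r x₅ x₆ *
        (contr q σ r t g₂ x₁ (r x₄) * contr q σ r t g₃ x₂ (r x₅)
          + turn q σ b₁ x₁ x₂ * contr q σ r t g₃ x₁ (r x₅)
          - turn q σ b₁ x₄ x₅ * contr q σ r t g₂ x₅ (r x₁)) =
      cap F r x₁ x₃ * cap F r x₂ x₄ * cap F r x₅ x₆ *
        (κ * eqInd F x₁ x₂ * (contr q σ r t g₃ x₁ (r x₅) + cap F r x₁ x₅)) :=
    cap_mul_congr hr <| by
      rintro rfl rfl rfl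
      have h := contr_cross ht h₁ h₂ hb x₁ x₂ (r x₅)
      simp only [hr.involutive _, cap] at h ⊢
      rw [hr.contr_right _ x₅ x₁, hr.turn_left _ x₂ x₅]
      linear_combination h
  have e₂ : cap F r x₁ x₄ * cap F r x₂ x₃ * cap F r x₅ x₆ *
        (contr q σ r t g₃ x₂ (r x₅)
          + turn q σ b₁ x₁ x₂ * contr q σ r t g₂ x₂ (r x₄) * contr q σ r t g₃ x₁ (r x₅)
          - contr q σ r t g₃ x₅ (r x₂)
          - turn q σ b₁ x₄ x₅ * contr q σ r t g₂ x₅ (r x₁) * contr q σ r t g₃ x₄ (r x₂)) =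
      cap F r x₁ x₄ * cap F r x₂ x₃ * cap F r x₅ x₆ *
        (κ * cap F r x₁ x₅ * contr q σ r t g₃ x₂ x₁
          - κ * eqInd F x₁ x₂ * contr q σ r t g₃ x₁ (r x₅)) :=
    cap_mul_congr hr <| by
      rintro rfl rfl rfl
      have h := contr_contr_turn ht h₁ h₂ hb x₂ x₁ (r x₅)
      simp only [hr.involutive _, hr.contr_apply, cap] at h ⊢
      rw [hr.contr_right g₃ x₅ x₂, hr.contr_right g₂ x₅ x₁, hr.turn_left _ x₁ x₅, eqInd_comm x₁ x₂]
      linear_combination -h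
  have e₃ : cap F r x₁ x₅ * cap F r x₂ x₃ * cap F r x₄ x₆ *
        (contr q σ r t g₂ x₄ (r x₁) * contr q σ r t g₃ x₅ (r x₂)
          + turn q σ b₁ x₄ x₅ * contr q σ r t g₃ x₄ (r x₂)
          - turn q σ b₁ x₁ x₂ * contr q σ r t g₂ x₂ (r x₄)) =
      cap F r x₁ x₅ * cap F r x₂ x₃ * cap F r x₄ x₆ *
        (κ * eqInd F x₄ x₅ * (contr q σ r t g₃ x₄ (r x₂) + cap F r x₂ x₄)) :=
    cap_mul_congr hr <| by
      rintro rfl rfl rfl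
      have h := contr_cross ht h₁ h₂ hb x₄ (r x₁) (r x₂)
      rw [hr.cap_comm x₂ x₄]
      simp only [hr.turn_apply, cap] at h ⊢
      rw [hr.contr_right _ x₂ x₄]
      linear_combination h
  rw [e₁, e₂, e₃]
  have k₁ : cap F r x₁ x₄ * cap F r x₂ x₃ * cap F r x₁ x₅ *
        (cap F r x₅ x₆ * contr q σ r t g₃ x₂ x₁) =
      cap F r x₁ x₄ * cap F r x₂ x₃ * cap F r x₁ x₅ *
        (cap F r x₄ x₆ * eqInd F x₄ x₅ * contr q σ r t g₃ x₄ (r x₂)) :=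
    cap_mul_congr hr <| by
      rintro rfl rfl rfl
      rw [hr.contr_apply, eqInd_self, mul_one]
  have k₂ : cap F r x₁ x₄ * cap F r x₁ x₅ * cap F r x₅ x₆ * 1 =
      cap F r x₁ x₄ * cap F r x₁ x₅ * cap F r x₅ x₆ * eqInd F x₄ x₅ :=
    cap_mul_congr hr <| by
      rintro rfl rfl rfl
      rw [eqInd_self]
  have k₃ : cap F r x₁ x₄ * cap F r x₂ x₄ * cap F r x₄ x₆ * 1 =
      cap F r x₁ x₄ * cap F r x₂ x₄ * cap F r x₄ x₆ * eqInd F x₁ x₂ :=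
    cap_mul_congr hr fun h h' _ => by
      rw [hr.involutive.injective (h.symm.trans h'), eqInd_self]
  have k₄ : cap F r x₁ x₄ * cap F r x₁ x₄ = cap F r x₁ x₄ := by simp [cap, eqInd]
  rcases eq_or_ne x₁ x₂ with rfl | h₁₂ <;> rcases eq_or_ne x₄ x₅ with rfl | h₄₅ <;>
    simp only [eqInd_self, eqInd_of_ne, Ne, not_false_eq_true, *] at k₁ k₂ k₃ ⊢
  · linear_combination
      κ * k₁ + κ * cap F r x₁ x₃ * cap F r x₄ x₆ * contr q σ r t g₃ x₄ (r x₁) * k₄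
  · linear_combination κ * k₁ + κ * cap F r x₁ x₃ * k₂
  · linear_combination κ * k₁ - κ * cap F r x₂ x₃ * k₃
      + κ * cap F r x₂ x₃ * cap F r x₄ x₆ * contr q σ r t g₃ x₄ (r x₂) * k₄
  · linear_combination κ * k₁

theorem cup_cap_sum [Fintype ι] (hr : IsReversal r) (ht : ∀ x, t x * t (r x) = 1) (hq : q ≠ 0)
    (h₁ : q * (2 * σ - 1) = κ) (h₂ : q ^ 2 * (σ * (1 - σ)) = κ)
    (hx : IsSpectral q ξ g₁ b₂ g₃ b₁ g₂ b₃)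
    (hT : ∀ m, q * ∑ x, t x ^ 2 * ordWeight σ x m = c + q * ordWeight σ (r m) m - t m ^ 2)
    (hS : q * ∑ x, t x ^ 2 = q * (1 + ξ) - c * (ξ ^ 2 - 1)) (x₁ x₂ x₃ x₄ x₅ x₆ : ι) :
    cap F r x₁ x₂ * cap F r x₃ x₄ * cap F r x₅ x₆ *
        (turn q σ b₂ x₁ x₃ * contr q σ r t g₃ x₂ (r x₅)
          + turn q σ b₁ x₁ x₂ * turn q σ b₂ x₂ x₃ * contr q σ r t g₃ x₁ (r x₅)
          + contr q σ r t g₁ x₁ (r x₄) * contr q σ r t g₃ x₄ (r x₅)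
          + contr q σ r t g₁ x₁ (r x₆) * turn q σ b₂ (r x₆) x₃
          + contr q σ r t g₁ x₁ (r x₅) * turn q σ b₂ (r x₅) x₃ * turn q σ b₃ x₅ (r x₅)
          + ∑ x, contr q σ r t g₁ x₁ x * turn q σ b₂ x x₃ * contr q σ r t g₃ (r x) (r x₅)
          + contr q σ r t g₁ x₁ (r x₃) * contr q σ r t g₂ (r x₃) (r x₄)
            * contr q σ r t g₃ x₃ (r x₅)
          - turn q σ b₁ x₄ x₅ * contr q σ r t g₂ x₅ (r x₁) * turn q σ b₃ x₄ x₁) =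
      cap F r x₁ x₂ * cap F r x₃ x₄ * cap F r x₅ x₆ *
        -(κ * (eqInd F x₁ x₃ * eqInd F x₃ x₅)) :=
  cap_mul_congr hr <| by
    rintro rfl rfl rfl
    have e : ∑ x, contr q σ r t g₁ x₁ x * turn q σ b₂ x x₃ * contr q σ r t g₃ (r x) (r x₅) =
        t (r x₁) * t (r x₅) *
          ∑ x, t x ^ 2 * (turn q σ g₁ x x₁ * turn q σ b₂ x x₃ * turn q σ g₃ x x₅) := by
      rw [Finset.mul_sum]
      refine Finset.sum_congr rfl fun x _ => ?_
      rw [hr.contr_apply, contr, contr]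
      ring
    have h := sum_turn_mul_mul hr hq h₁ h₂ hx hT hS x₁ x₃ x₅
    have hδ : eqInd F x₁ x₃ * eqInd F x₃ x₅ * (t (r x₁) * t (r x₅) * t x₁ ^ 2) =
        eqInd F x₁ x₃ * eqInd F x₃ x₅ * 1 := by
      simp only [mul_assoc]
      refine eqInd_mul_congr fun h => eqInd_mul_congr fun h' => ?_
      rw [← h', ← h]
      linear_combination (1 + t x₁ * t (r x₁)) * ht x₁
    rw [e]
    simp only [hr.involutive _, contr, hr.turn_apply]
    rw [hr.turn_left g₃ x₅ x₁, hr.turn_left g₁ x₅ x₁, hr.turn_left g₃ x₅ x₃,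
      hr.turn_left b₃ x₃ x₁]
    rw [hr.turn_left g₁ x₅ x₁] at h
    linear_combination t (r x₁) * t (r x₅) * h - κ * hδ
      + t (r x₁) * t (r x₅) *
        turn q σ g₁ (r x₃) x₁ * turn q σ g₂ x₃ (r x₃) * turn q σ g₃ (r x₃) x₅
        * (t x₃ * t (r x₃) + 1) * ht x₃
      - turn q σ b₂ x₁ x₃ * t (r x₅) * t x₁ * turn q σ g₃ x₁ x₅ * ht x₁
      - t (r x₁) * t x₅ * turn q σ g₁ x₅ x₁ * turn q σ b₂ x₅ x₃ * ht x₅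

/-- The sum over all ways to resolve three crossings of three strands with end points `x₁`, …, `x₆`
(in cyclic order). -/
def braidSum [Fintype ι] (q σ : F) (r : ι → ι) (t : ι → F) (g₁ g₂ g₃ b₁ b₂ b₃ : F)
    (x₁ x₂ x₃ x₄ x₅ x₆ : ι) : F :=
  cap F r x₁ x₄ * cap F r x₂ x₅ * cap F r x₃ x₆
    + cap F r x₁ x₄ * cap F r x₃ x₅ * cap F r x₂ x₆ * turn q σ b₃ x₂ x₃
    + cap F r x₁ x₄ * cap F r x₂ x₃ * cap F r x₅ x₆ * contr q σ r t g₃ x₂ (r x₅)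
    + cap F r x₃ x₄ * cap F r x₂ x₅ * cap F r x₁ x₆ * turn q σ b₂ x₁ x₃
    + cap F r x₃ x₄ * cap F r x₁ x₅ * cap F r x₂ x₆ * turn q σ b₂ x₁ x₃ * turn q σ b₃ x₂ x₁
    + cap F r x₃ x₄ * cap F r x₁ x₂ * cap F r x₅ x₆ * turn q σ b₂ x₁ x₃
      * contr q σ r t g₃ x₂ (r x₅)
    + cap F r x₁ x₃ * cap F r x₂ x₅ * cap F r x₄ x₆ * contr q σ r t g₂ x₁ (r x₄)
    + cap F r x₁ x₃ * cap F r x₄ x₅ * cap F r x₂ x₆ * contr q σ r t g₂ x₁ (r x₄)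
      * turn q σ b₃ x₂ x₄
    + cap F r x₁ x₃ * cap F r x₂ x₄ * cap F r x₅ x₆ * contr q σ r t g₂ x₁ (r x₄)
      * contr q σ r t g₃ x₂ (r x₅)
    + cap F r x₂ x₄ * cap F r x₁ x₅ * cap F r x₃ x₆ * turn q σ b₁ x₁ x₂
    + cap F r x₂ x₄ * cap F r x₃ x₅ * cap F r x₁ x₆ * turn q σ b₁ x₁ x₂ * turn q σ b₃ x₁ x₃
    + cap F r x₂ x₄ * cap F r x₁ x₃ * cap F r x₅ x₆ * turn q σ b₁ x₁ x₂
      * contr q σ r t g₃ x₁ (r x₅)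
    + cap F r x₃ x₄ * cap F r x₁ x₅ * cap F r x₂ x₆ * turn q σ b₁ x₁ x₂ * turn q σ b₂ x₂ x₃
    + cap F r x₃ x₄ * cap F r x₂ x₅ * cap F r x₁ x₆ * turn q σ b₁ x₁ x₂ * turn q σ b₂ x₂ x₃
      * turn q σ b₃ x₁ x₂
    + cap F r x₃ x₄ * cap F r x₁ x₂ * cap F r x₅ x₆ * turn q σ b₁ x₁ x₂ * turn q σ b₂ x₂ x₃
      * contr q σ r t g₃ x₁ (r x₅)
    + cap F r x₂ x₃ * cap F r x₁ x₅ * cap F r x₄ x₆ * turn q σ b₁ x₁ x₂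
      * contr q σ r t g₂ x₂ (r x₄)
    + cap F r x₂ x₃ * cap F r x₄ x₅ * cap F r x₁ x₆ * turn q σ b₁ x₁ x₂
      * contr q σ r t g₂ x₂ (r x₄) * turn q σ b₃ x₁ x₄
    + cap F r x₂ x₃ * cap F r x₁ x₄ * cap F r x₅ x₆ * turn q σ b₁ x₁ x₂
      * contr q σ r t g₂ x₂ (r x₄) * contr q σ r t g₃ x₁ (r x₅)
    + cap F r x₁ x₂ * cap F r x₄ x₅ * cap F r x₃ x₆ * contr q σ r t g₁ x₁ (r x₄)
    + cap F r x₁ x₂ * cap F r x₃ x₅ * cap F r x₄ x₆ * contr q σ r t g₁ x₁ (r x₄)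
      * turn q σ b₃ x₄ x₃
    + cap F r x₁ x₂ * cap F r x₃ x₄ * cap F r x₅ x₆ * contr q σ r t g₁ x₁ (r x₄)
      * contr q σ r t g₃ x₄ (r x₅)
    + cap F r x₁ x₂ * cap F r x₃ x₄ * cap F r x₅ x₆ * contr q σ r t g₁ x₁ (r x₆)
      * turn q σ b₂ (r x₆) x₃
    + cap F r x₁ x₂ * cap F r x₃ x₄ * cap F r x₅ x₆ * contr q σ r t g₁ x₁ (r x₅)
      * turn q σ b₂ (r x₅) x₃ * turn q σ b₃ x₅ (r x₅)
    + cap F r x₁ x₂ * cap F r x₃ x₄ * cap F r x₅ x₆ * (∑ x, contr q σ r t g₁ x₁ x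
      * turn q σ b₂ x x₃ * contr q σ r t g₃ (r x) (r x₅))
    + cap F r x₁ x₂ * cap F r x₃ x₅ * cap F r x₄ x₆ * contr q σ r t g₁ x₁ (r x₃)
      * contr q σ r t g₂ (r x₃) (r x₄)
    + cap F r x₁ x₂ * cap F r x₄ x₅ * cap F r x₃ x₆ * contr q σ r t g₁ x₁ (r x₃)
      * contr q σ r t g₂ (r x₃) (r x₄) * turn q σ b₃ x₃ x₄
    + cap F r x₁ x₂ * cap F r x₃ x₄ * cap F r x₅ x₆ * contr q σ r t g₁ x₁ (r x₃)
      * contr q σ r t g₂ (r x₃) (r x₄) * contr q σ r t g₃ x₃ (r x₅)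

theorem braidSum_rotate [Fintype ι] (hr : IsReversal r) (ht : ∀ x, t x * t (r x) = 1) (hq : q ≠ 0)
    (h₁ : q * (2 * σ - 1) = κ) (h₂ : q ^ 2 * (σ * (1 - σ)) = κ)
    (hx : IsSpectral q ξ g₁ b₂ g₃ b₁ g₂ b₃)
    (hT : ∀ m, q * ∑ x, t x ^ 2 * ordWeight σ x m = c + q * ordWeight σ (r m) m - t m ^ 2)
    (hS : q * ∑ x, t x ^ 2 = q * (1 + ξ) - c * (ξ ^ 2 - 1)) (x₁ x₂ x₃ x₄ x₅ x₆ : ι) :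
    braidSum q σ r t g₁ g₂ g₃ b₁ b₂ b₃ x₁ x₂ x₃ x₄ x₅ x₆ =
      braidSum q σ r t g₁ g₂ g₃ b₁ b₂ b₃ x₄ x₅ x₆ x₁ x₂ x₃ := by
  have a := through_sum_eq_zero hr h₁ h₂ hx x₁ x₂ x₃ x₄ x₅ x₆
  have b := mixed_sum_eq_zero hr ht h₁ h₂ hx x₁ x₂ x₃ x₄ x₅ x₆
  have d := mixed_sum_eq_zero' hr ht h₁ h₂ hx x₁ x₂ x₃ x₄ x₅ x₆
  have e := cup_cap_sum hr ht hq h₁ h₂ hx hT hS x₁ x₂ x₃ x₄ x₅ x₆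
  have e' := cup_cap_sum hr ht hq h₁ h₂ hx hT hS x₄ x₅ x₆ x₁ x₂ x₃
  have f : cap F r x₁ x₂ * cap F r x₃ x₄ * cap F r x₅ x₆ * (eqInd F x₁ x₃ * eqInd F x₃ x₅) =
      cap F r x₄ x₅ * cap F r x₆ x₁ * cap F r x₂ x₃ * (eqInd F x₄ x₆ * eqInd F x₆ x₂) := by
    simp only [cap, eqInd, mul_ite, mul_one, mul_zero, ← ite_and]
    refine if_congr ?_ rfl rfl
    have := hr.involutive
    grind [Function.Involutive]
  have f₂ : cap F r x₁ x₄ * cap F r x₃ x₅ * cap F r x₂ x₆ * turn q σ b₃ x₂ x₃ =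
      cap F r x₁ x₄ * cap F r x₃ x₅ * cap F r x₂ x₆ * turn q σ b₃ x₅ x₆ :=
    cap_mul_congr hr <| by rintro rfl rfl rfl; rw [hr.turn_apply]
  have f₁₀ : cap F r x₂ x₄ * cap F r x₁ x₅ * cap F r x₃ x₆ * turn q σ b₁ x₁ x₂ =
      cap F r x₂ x₄ * cap F r x₁ x₅ * cap F r x₃ x₆ * turn q σ b₁ x₄ x₅ :=
    cap_mul_congr hr <| by rintro rfl rfl rfl; rw [hr.turn_apply]
  have f₇ := hr.contr_right (q := q) (σ := σ) (t := t) g₂ x₁ x₄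
  simp only [braidSum, hr.cap_comm x₄ x₁, hr.cap_comm x₄ x₂, hr.cap_comm x₄ x₃, hr.cap_comm x₅ x₁,
    hr.cap_comm x₅ x₂, hr.cap_comm x₅ x₃, hr.cap_comm x₆ x₁, hr.cap_comm x₆ x₂,
    hr.cap_comm x₆ x₃] at e' f ⊢
  linear_combination a + b + d + e - e' - κ * f + f₂ + f₁₀
    + cap F r x₁ x₃ * cap F r x₂ x₅ * cap F r x₄ x₆ * f₇

/-- The matrix entry, in row `(a, b)` and column `(c, d)`, of the `R`-matrix up to normalization. -/
def crossing (q σ : F) (r : ι → ι) (t : ι → F) (g β : F) (a b c d : ι) : F :=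
  eqInd F a c * eqInd F b d + eqInd F a d * eqInd F b c * turn q σ β a b
    + cap F r a b * cap F r c d * contr q σ r t g a c

theorem sum_crossing_mul [Fintype ι] (hr : IsReversal r) (g β : F) (a b : ι) (f : ι → ι → F) :
    ∑ x, ∑ y, crossing q σ r t g β a b x y * f x y =
      f a b + turn q σ β a b * f b a + cap F r a b * ∑ x, contr q σ r t g a x * f x (r x) := by
  have h (x y : ι) : crossing q σ r t g β a b x y * f x y =
      (if a = x then if b = y then f x y else 0 else 0)
        + (if a = y then if b = x then turn q σ β a b * f x y else 0 else 0)
        + if y = r x then cap F r a b * (contr q σ r t g a x * f x y) else 0 := by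
    rw [crossing, hr.cap_comm x y, show cap F r y x = if y = r x then 1 else 0 from rfl]
    simp only [eqInd]
    split_ifs <;> ring
  simp [h, Finset.sum_add_distrib, Finset.mul_sum]

theorem sum_crossing_mul_right [Fintype ι] (hr : IsReversal r) (g β : F) (a b c : ι) (f : ι → F) :
    ∑ y, crossing q σ r t g β a b c y * f y =
      eqInd F a c * f b + eqInd F b c * turn q σ β a b * f a
        + cap F r a b * contr q σ r t g a c * f (r c) := by
  have h (y : ι) : crossing q σ r t g β a b c y * f y =
      (if b = y then eqInd F a c * f y else 0)
        + (if a = y then eqInd F b c * turn q σ β a b * f y else 0)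
        + if y = r c then cap F r a b * contr q σ r t g a c * f y else 0 := by
    rw [crossing, hr.cap_comm c y, show cap F r y c = if y = r c then 1 else 0 from rfl]
    simp only [eqInd]
    split_ifs <;> ring
  simp [h, Finset.sum_add_distrib]

theorem crossing_reverse (hr : IsReversal r) (g β : F) (a b c d : ι) :
    crossing q σ r t g β (r c) (r d) (r a) (r b) = crossing q σ r t g β a b c d := by
  have h : eqInd F a d * eqInd F b c * turn q σ β d c =
      eqInd F a d * eqInd F b c * turn q σ β a b := by
    simp only [mul_assoc]
    refine eqInd_mul_congr fun h => eqInd_mul_congr fun h' => ?_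
    rw [h, h']
  simp only [crossing, cap, eqInd, hr.involutive.injective.eq_iff, hr.turn_apply, hr.contr_apply]
    at h ⊢
  simp only [eq_comm (a := c) (b := a), eq_comm (a := d) (b := b), eq_comm (a := d) (b := a),
    eq_comm (a := c) (b := b)]
  linear_combination h

theorem sum_crossing_eq_braidSum [Fintype ι] (hr : IsReversal r) (a b c d e f : ι) :
    ∑ x, ∑ y, crossing q σ r t g₁ b₁ a b x y *
        ∑ z, crossing q σ r t g₂ b₂ x c d z * crossing q σ r t g₃ b₃ y z e f =
      braidSum q σ r t g₁ g₂ g₃ b₁ b₂ b₃ a b c (r d) (r e) (r f) := by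
  have hs : ∑ x, contr q σ r t g₁ a x *
        (eqInd F x d * crossing q σ r t g₃ b₃ (r x) c e f
          + eqInd F c d * turn q σ b₂ x c * crossing q σ r t g₃ b₃ (r x) x e f
          + cap F r x c * contr q σ r t g₂ x d * crossing q σ r t g₃ b₃ (r x) (r d) e f) =
      contr q σ r t g₁ a d * crossing q σ r t g₃ b₃ (r d) c e f
        + eqInd F c d * cap F r e f * (contr q σ r t g₁ a f * turn q σ b₂ f c
          + contr q σ r t g₁ a e * turn q σ b₂ e c * turn q σ b₃ (r e) e
          + ∑ x, contr q σ r t g₁ a x * turn q σ b₂ x c * contr q σ r t g₃ (r x) e)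
        + contr q σ r t g₁ a (r c) * contr q σ r t g₂ (r c) d
          * crossing q σ r t g₃ b₃ c (r d) e f := by
    have h (x : ι) : contr q σ r t g₁ a x *
        (eqInd F x d * crossing q σ r t g₃ b₃ (r x) c e f
          + eqInd F c d * turn q σ b₂ x c * crossing q σ r t g₃ b₃ (r x) x e f
          + cap F r x c * contr q σ r t g₂ x d * crossing q σ r t g₃ b₃ (r x) (r d) e f) =
        (if x = d then contr q σ r t g₁ a x * crossing q σ r t g₃ b₃ (r x) c e f else 0)
        + (if x = f then eqInd F c d * cap F r e f * (contr q σ r t g₁ a x * turn q σ b₂ x c)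
            else 0)
        + (if x = e then eqInd F c d * cap F r e f *
            (contr q σ r t g₁ a x * turn q σ b₂ x c * turn q σ b₃ (r x) x) else 0)
        + eqInd F c d * cap F r e f *
          (contr q σ r t g₁ a x * turn q σ b₂ x c * contr q σ r t g₃ (r x) e)
        + (if x = r c then contr q σ r t g₁ a x * contr q σ r t g₂ x d
          * crossing q σ r t g₃ b₃ (r x) (r d) e f else 0) := by
      have h' : crossing q σ r t g₃ b₃ (r x) x e f =
          (if x = f then cap F r e f else 0) + (if x = e then cap F r e f * turn q σ b₃ (r x) x else 0)
            + cap F r e f * contr q σ r t g₃ (r x) e := by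
        have h₁ : eqInd F (r x) e * eqInd F x f = if x = f then cap F r e f else 0 := by
          rcases eq_or_ne x f with rfl | h
          · rw [if_pos rfl, eqInd_self, mul_one, cap, eqInd_comm]
          · rw [if_neg h, eqInd_of_ne h, mul_zero]
        have h₂ : eqInd F (r x) f * eqInd F x e = if x = e then cap F r e f else 0 := by
          rcases eq_or_ne x e with rfl | h
          · rw [if_pos rfl, eqInd_self, mul_one, hr.cap_comm, cap, eqInd_comm]
          · rw [if_neg h, eqInd_of_ne h, mul_zero]
        rw [crossing, h₁, h₂, show cap F r (r x) x = 1 from eqInd_self]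
        split_ifs <;> ring
      rw [h', show cap F r x c = if x = r c then 1 else 0 from rfl,
        show eqInd F x d = if x = d then 1 else 0 from rfl]
      split_ifs <;> ring
    simp only [h, Finset.sum_add_distrib, ← Finset.mul_sum, Finset.sum_ite_eq', Finset.mem_univ,
      if_true, hr.involutive _]
    ring
  have hc (x y : ι) : eqInd F x y = cap F r x (r y) := by rw [cap, hr.involutive]
  simp only [sum_crossing_mul_right hr g₂]
  refine (sum_crossing_mul hr _ _ _ _ _).trans ?_
  rw [hs]
  have hc' : cap F r e f = cap F r (r e) (r f) := by
    simp only [cap, eqInd, hr.involutive _, ← hr.involutive.eq_iff]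
  simp only [crossing, braidSum, hc, hc', hr.involutive _, hr.cap_comm (r d) c,
    hr.cap_comm b a]
  ring

theorem sum_crossing_eq [Fintype ι] (hr : IsReversal r) (ht : ∀ x, t x * t (r x) = 1) (hq : q ≠ 0)
    (h₁ : q * (2 * σ - 1) = κ) (h₂ : q ^ 2 * (σ * (1 - σ)) = κ)
    (hx : IsSpectral q ξ g₁ b₂ g₃ b₁ g₂ b₃)
    (hT : ∀ m, q * ∑ x, t x ^ 2 * ordWeight σ x m = c + q * ordWeight σ (r m) m - t m ^ 2)
    (hS : q * ∑ x, t x ^ 2 = q * (1 + ξ) - c * (ξ ^ 2 - 1)) (i j k i' j' k' : ι) :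
    ∑ x, ∑ y, crossing q σ r t g₁ b₁ i j x y *
        ∑ z, crossing q σ r t g₂ b₂ x k i' z * crossing q σ r t g₃ b₃ y z j' k' =
      ∑ x, ∑ y, crossing q σ r t g₁ b₁ x y i' j' *
        ∑ z, crossing q σ r t g₂ b₂ i z x k' * crossing q σ r t g₃ b₃ j k y z := by
  have e : ∑ x, ∑ y, crossing q σ r t g₁ b₁ x y i' j' *
        ∑ z, crossing q σ r t g₂ b₂ i z x k' * crossing q σ r t g₃ b₃ j k y z =
      ∑ x, ∑ y, crossing q σ r t g₁ b₁ (r i') (r j') x y *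
        ∑ z, crossing q σ r t g₂ b₂ x (r k') (r i) z *
          crossing q σ r t g₃ b₃ y z (r j) (r k) := by
    refine Fintype.sum_equiv hr.involutive.toPerm _ _ fun x =>
      Fintype.sum_equiv hr.involutive.toPerm _ _ fun y => ?_
    congr 1
    · exact (crossing_reverse hr ..).symm
    · refine Fintype.sum_equiv hr.involutive.toPerm _ _ fun z => ?_
      congr 1 <;> exact (crossing_reverse hr ..).symm
  rw [e, sum_crossing_eq_braidSum hr, sum_crossing_eq_braidSum hr,
    braidSum_rotate hr ht hq h₁ h₂ hx hT hS]
  simp only [hr.involutive _]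

theorem crossing_neg_zero (hr : IsReversal r) (ht : ∀ x, t x * t (r x) = 1) {V : F}
    (hq : V - V⁻¹ = q) (hσ : q * σ = V - 1) (a a' b b' : ι) :
    crossing q σ r t (-q) 0 a a' b b' =
      V * (eqInd F a b * eqInd F a' b' * eqInd F a' a)
        + (if a ≠ a' ∧ a ≠ r a' then eqInd F a b * eqInd F a' b' else 0)
        + V⁻¹ * (eqInd F a b * eqInd F a' b' * eqInd F a' (r a))
        + q * (if a < a' then eqInd F a b' * eqInd F a' b else 0)
        - q * (if b' < a' then cap F r a a' * cap F r b b' * (t a' * t (r b')) else 0) := by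
  have e₁ : eqInd F a b' * eqInd F a' b * turn q σ 0 a a' =
      (if a < a' then eqInd F a b' * eqInd F a' b else 0) * q
        + eqInd F a b * eqInd F a' b' * eqInd F a a' * (V - 1) := by
    rcases lt_trichotomy a a' with h | rfl | h
    · rw [turn, if_pos h, ordWeight_of_lt h, eqInd_of_ne h.ne]
      ring
    · rw [turn, if_neg (lt_irrefl a), ordWeight_self, eqInd_self, hσ]
      ring
    · rw [turn, if_neg h.not_gt, ordWeight_of_gt h, eqInd_of_ne h.ne']
      ring
  have e₂ : cap F r a a' * cap F r b b' * contr q σ r t (-q) a b =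
      eqInd F a b * eqInd F a' b' * cap F r a a' * (V⁻¹ - 1)
        - q * (if b' < a' then cap F r a a' * cap F r b b' * (t a' * t (r b')) else 0) := by
    by_cases h : a = r a'
    swap
    · simp [cap, eqInd_of_ne h]
    by_cases h' : b = r b'
    swap
    · have : eqInd F a b * eqInd F a' b' = 0 := by
        simp only [eqInd]
        grind
      simp [this, cap, eqInd_of_ne h']
    have hc : eqInd F a' b' = eqInd F a b := by
      simp only [eqInd, h, h', hr.involutive.injective.eq_iff]
    have h₁ : cap F r a a' = 1 := by rw [cap, h, eqInd_self]
    have h₂ : cap F r b b' = 1 := by rw [cap, h', eqInd_self]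
    have h₃ : b' < a' ↔ a < b := by rw [h, h', hr.lt_iff]
    rw [hc, h₁, h₂, contr, ← h', show r a = a' by rw [h, hr.involutive]]
    simp only [turn, h₃]
    rcases lt_trichotomy a b with hab | rfl | hab
    · rw [if_pos hab, ordWeight_of_gt hab, eqInd_of_ne hab.ne]
      ring
    · have := ht a'
      rw [← h] at this
      rw [if_neg (lt_irrefl a), ordWeight_self, eqInd_self]
      linear_combination (V⁻¹ - 1) * this + t a * t a' * (hσ + hq)
    · rw [if_neg hab.not_gt, ordWeight_of_lt hab, eqInd_of_ne hab.ne']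
      ring
  have e₃ : (if a ≠ a' ∧ a ≠ r a' then eqInd F a b * eqInd F a' b' else 0) =
      eqInd F a b * eqInd F a' b' * (1 - eqInd F a a' - cap F r a a') := by
    rcases eq_or_ne a a' with rfl | h
    · simp [cap, eqInd_of_ne (hr.ne_self a).symm]
    · by_cases h' : a = r a' <;> simp [cap, h, h', eqInd_of_ne, hr.ne_self a']
  have e₄ : eqInd F a' (r a) = cap F r a a' := hr.cap_comm a' a
  rw [e₄, e₃, eqInd_comm a' a, crossing, e₁, e₂]
  ring

end Matchings

end Weights

theorem cT_inv (x : KK) : cT x⁻¹ = (cT x)⁻¹ := by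
  exact map_inv₀ (algebraMap KK KT) x

theorem cT_zpow (x : KK) (m : ℤ) : cT (x ^ m) = cT x ^ m :=
  map_zpow₀ (algebraMap KK KT) x m

theorem vv_add_C_ne_zero (a : ℚ) : vv + RatFunc.C a ≠ 0 := by
  intro h
  refine Polynomial.X_add_C_ne_zero a (RatFunc.algebraMap_injective ℚ ?_)
  simpa [vv] using h

theorem cT_ne_zero {x : KK} (hx : x ≠ 0) : cT x ≠ 0 := by
  simpa [cT] using hx

theorem cT_vv_ne_zero : cT vv ≠ 0 := cT_ne_zero RatFunc.X_ne_zero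

theorem cT_vv_add_one_ne_zero : cT vv + 1 ≠ 0 := by
  have := cT_ne_zero (vv_add_C_ne_zero 1)
  simpa [cT] using this

theorem cT_vv_sub_inv_ne_zero : cT vv - (cT vv)⁻¹ ≠ 0 := by
  have h := cT_ne_zero (vv_add_C_ne_zero (-1))
  have h' : cT vv - 1 ≠ 0 := by simpa [cT, ← sub_eq_add_neg] using h
  have h₀ := cT_vv_ne_zero
  have h₁ := mul_ne_zero h' cT_vv_add_one_ne_zero
  contrapose! h₁
  field_simp at h₁
  linear_combination h₁

theorem algebraMap_ne_cT {p : MvPolynomial (Fin 2) KK} (hp : p.totalDegree ≠ 0) (x : KK) :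
    algebraMap (MvPolynomial (Fin 2) KK) KT p ≠ cT x := by
  rw [cT, IsScalarTower.algebraMap_apply KK (MvPolynomial (Fin 2) KK) KT]
  intro h
  rw [IsFractionRing.injective (MvPolynomial (Fin 2) KK) KT h] at hp
  exact hp (MvPolynomial.totalDegree_C x)

theorem zz_ne_cT (x : KK) : zz ≠ cT x :=
  algebraMap_ne_cT (by simp) x

theorem ww_ne_cT (x : KK) : ww ≠ cT x :=
  algebraMap_ne_cT (by simp) x

theorem zz_mul_ww_ne_cT (x : KK) : zz * ww ≠ cT x := by
  rw [zz, ww, ← map_mul]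
  refine algebraMap_ne_cT ?_ x
  rw [MvPolynomial.totalDegree_mul_of_isDomain (MvPolynomial.X_ne_zero 0) (MvPolynomial.X_ne_zero 1)]
  simp

theorem sub_inv_mul_div_add_one :
    (cT vv - (cT vv)⁻¹) * (cT vv / (cT vv + 1)) = cT vv - 1 := by
  have hv := cT_vv_ne_zero
  have hv' := cT_vv_add_one_ne_zero
  field_simp
  ring

section Entries

variable (n : ℕ)

theorem isReversal_prm : IsReversal (prm n) where
  involutive a := Fin.ext (by simp only [prm]; omega)
  lt_iff a b := by simp only [prm, Fin.lt_def]; omega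
  ne_self a h := by
    have := congrArg Fin.val h
    simp only [prm] at this
    omega

theorem barD_prm (a : Fin (2 * n)) : barD n (prm n a) = -barD n a := by
  simp only [barD, prm]
  split_ifs <;> omega

variable {n}

theorem sum_E2_diag_apply (f : Fin (2 * n) → Fin (2 * n)) (a a' b b' : Fin (2 * n)) :
    (∑ i, E2 n i i (f i) (f i)) (a, a') (b, b') =
      eqInd KT a b * eqInd KT a' b' * eqInd KT a' (f a) := by
  have h (i : Fin (2 * n)) : E2 n i i (f i) (f i) (a, a') (b, b') =
      if a = i then eqInd KT a b * eqInd KT a' b' * eqInd KT a' (f a) else 0 := by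
    simp only [E2, eqInd]
    grind
  simp [Matrix.sum_apply, h]

theorem sum_sum_E2_diag_apply (p : Fin (2 * n) → Fin (2 * n) → Prop)
    [∀ i j, Decidable (p i j)] (a a' b b' : Fin (2 * n)) :
    (∑ i, ∑ j, if p i j then E2 n i i j j else 0) (a, a') (b, b') =
      if p a a' then eqInd KT a b * eqInd KT a' b' else 0 := by
  have h (i j : Fin (2 * n)) : (if p i j then E2 n i i j j else 0) (a, a') (b, b') =
      if a = i then if a' = j then if p i j then eqInd KT a b * eqInd KT a' b' else 0 else 0
        else 0 := by
    by_cases h : p i j <;> simp [h, E2, eqInd]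
    grind
  simp [Matrix.sum_apply, h]

theorem sum_sum_E2_swap_apply (p : Fin (2 * n) → Fin (2 * n) → Prop)
    [∀ i j, Decidable (p i j)] (a a' b b' : Fin (2 * n)) :
    (∑ i, ∑ j, if p i j then E2 n i j j i else 0) (a, a') (b, b') =
      if p a a' then eqInd KT a b' * eqInd KT a' b else 0 := by
  have h (i j : Fin (2 * n)) : (if p i j then E2 n i j j i else 0) (a, a') (b, b') =
      if a = i then if a' = j then if p i j then eqInd KT a b' * eqInd KT a' b else 0 else 0
        else 0 := by
    by_cases h : p i j <;> simp [h, E2, eqInd]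
    grind
  simp [Matrix.sum_apply, h]

theorem sum_sum_smul_E2_prm_apply (p : Fin (2 * n) → Fin (2 * n) → Prop)
    [∀ i j, Decidable (p i j)] (f : Fin (2 * n) → Fin (2 * n) → KT) (a a' b b' : Fin (2 * n)) :
    (∑ i, ∑ j, if p i j then f i j • E2 n (prm n i) (prm n j) i j else 0) (a, a') (b, b') =
      if p a' b' then cap KT (prm n) a a' * cap KT (prm n) b b' * f a' b' else 0 := by
  have h (i j : Fin (2 * n)) :
      (if p i j then f i j • E2 n (prm n i) (prm n j) i j else 0) (a, a') (b, b') =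
        if a' = i then if b' = j then if p i j then
          cap KT (prm n) a a' * cap KT (prm n) b b' * f a' b' else 0 else 0 else 0 := by
    by_cases h : p i j <;> simp [h, E2, cap, eqInd]
    grind
  simp [Matrix.sum_apply, h]

end Entries

section Coefficients

variable (n : ℕ)

/-- The weight `v ^ ī`. -/
def barWeight (a : Fin (2 * n)) : KT := cT (vpow (barD n a))

theorem barWeight_mul_prm (a : Fin (2 * n)) : barWeight n a * barWeight n (prm n a) = 1 := by
  have : vv ≠ 0 := RatFunc.X_ne_zero
  rw [barWeight, barWeight, barD_prm, cT, cT, ← map_mul, vpow, vpow, ← zpow_add₀ this]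
  simp

theorem cT_vpow_sub (a b : Fin (2 * n)) :
    cT (vpow (barD n a - barD n b)) = barWeight n a * barWeight n (prm n b) := by
  have : vv ≠ 0 := RatFunc.X_ne_zero
  rw [barWeight, barWeight, barD_prm, cT, cT, cT, ← map_mul, vpow, vpow, vpow, ← zpow_add₀ this,
    sub_eq_add_neg]

variable {n}

theorem Pmat_apply (a a' b b' : Fin (2 * n)) :
    Pmat n (a, a') (b, b') = eqInd KT a b' * eqInd KT a' b := by
  simpa [Pmat] using sum_sum_E2_swap_apply (fun _ _ => True) a a' b b'

theorem Qmat_apply (a a' b b' : Fin (2 * n)) :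
    Qmat n (a, a') (b, b') = cap KT (prm n) a a' * cap KT (prm n) b b' *
      (barWeight n b * barWeight n (prm n a)) := by
  have h := sum_sum_smul_E2_prm_apply (fun _ _ => True)
    (fun i j => cT (vpow (barD n i - barD n j))) a a' b b'
  simp only [if_true] at h
  rw [Qmat, h, cT_vpow_sub]
  simp only [mul_assoc, cap]
  refine eqInd_mul_congr fun h₁ => eqInd_mul_congr fun h₂ => ?_
  rw [h₁, h₂, (isReversal_prm n).involutive, mul_comm]

theorem Rmat_apply (a a' b b' : Fin (2 * n)) :
    Rmat n (a, a') (b, b') = crossing (cT vv - cT vv⁻¹) (cT vv / (cT vv + 1)) (prm n)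
      (barWeight n) (-(cT vv - cT vv⁻¹)) 0 a a' b b' := by
  have h₁ := sum_E2_diag_apply (fun i => i) a a' b b'
  have h₂ := sum_sum_E2_diag_apply (fun i j => i ≠ j ∧ i ≠ prm n j) a a' b b'
  have h₃ := sum_E2_diag_apply (prm n) a a' b b'
  have h₄ := sum_sum_E2_swap_apply (fun i j => i < j) a a' b b'
  have h₅ := sum_sum_smul_E2_prm_apply (fun i j => j < i)
    (fun i j => cT (vpow (barD n i - barD n j))) a a' b b'
  simp only [Rmat, Matrix.add_apply, Matrix.sub_apply, Matrix.smul_apply, h₁, h₂, h₃, h₄, h₅,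
    smul_eq_mul, cT_inv]
  rw [crossing_neg_zero (isReversal_prm n) (barWeight_mul_prm n) rfl sub_inv_mul_div_add_one]
  simp only [cT_vpow_sub]

theorem Rbar_apply {u : KT} (hu : u ≠ 1) (hu' : u ≠ xiD n) (a a' b b' : Fin (2 * n)) :
    Rbar n u (a, a') (b, b') = (u - 1) / (u * cT vv - cT vv⁻¹) *
      crossing (cT vv - cT vv⁻¹) (cT vv / (cT vv + 1)) (prm n) (barWeight n)
        (-((cT vv - cT vv⁻¹) * u / (u - xiD n))) ((cT vv - cT vv⁻¹) / (u - 1)) a a' b b' := by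
  rw [← sub_ne_zero] at hu hu'
  simp only [Rbar, Matrix.add_apply, Matrix.sub_apply, Matrix.smul_apply, Rmat_apply, Pmat_apply,
    Qmat_apply, smul_eq_mul, crossing, contr, turn]
  rcases eq_or_ne (u * cT vv - cT vv⁻¹) 0 with h | h
  · simp [h]
  · generalize cT vv - cT vv⁻¹ = q
    field_simp
    ring

end Coefficients

section Sums

/-- The exponents `ī`, extended to all natural numbers. -/
def barNat (n i : ℕ) : ℤ := if i + 1 ≤ n then (n : ℤ) - (i + 1) else (n : ℤ) + 1 - (i + 1)

variable {F : Type*} [Field F] {V : F} (n : ℕ)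

theorem sum_range_zpow_barNat (hV : V ≠ 0) (hn : n ≠ 0) (m : ℕ) :
    (V - V⁻¹) * ∑ x ∈ Finset.range m, (V ^ barNat n x) ^ 2 =
      V ^ (2 * (n : ℤ) - 1) - V * (V ^ barNat n m) ^ 2 + if n ≤ m then V - V⁻¹ else 0 := by
  have h₂ (k : ℤ) : V * (V ^ k) ^ 2 = V ^ (2 * k + 1) := by
    rw [zpow_add₀ hV, zpow_one, two_mul, zpow_add₀ hV, pow_two, mul_comm]
  have hq (k : ℤ) : (V - V⁻¹) * (V ^ k) ^ 2 = V ^ (2 * k + 1) - V ^ (2 * k - 1) := by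
    rw [zpow_sub₀ hV, zpow_add₀ hV, zpow_one, two_mul, zpow_add₀ hV]
    field_simp
  induction m with
  | zero =>
    rw [Finset.sum_range_zero, h₂, if_neg (by omega),
      show 2 * barNat n 0 + 1 = 2 * (n : ℤ) - 1 by rw [barNat, if_pos (by omega)]; push_cast; ring]
    ring
  | succ m ih =>
    rw [Finset.sum_range_succ, mul_add, ih, hq, h₂, h₂]
    rcases lt_trichotomy (m + 1) n with h | h | h
    · rw [if_neg (by omega), if_neg (by omega),
        show 2 * barNat n (m + 1) + 1 = 2 * barNat n m - 1 by
          rw [barNat, barNat, if_pos (by omega), if_pos (by omega)]; push_cast; ring]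
      ring
    · rw [if_neg (by omega), if_pos (by omega),
        show barNat n (m + 1) = 0 by rw [barNat, if_neg (by omega), ← h]; push_cast; ring,
        show barNat n m = 0 by rw [barNat, if_pos (by omega), ← h]; push_cast; ring]
      simp
    · rw [if_pos (by omega), if_pos (by omega),
        show 2 * barNat n (m + 1) + 1 = 2 * barNat n m - 1 by
          rw [barNat, barNat, if_neg (by omega), if_neg (by omega)]; push_cast; ring]
      ring

theorem barD_eq (a : Fin (2 * n)) : barD n a = barNat n a := rfl

theorem sum_zpow_barD_mul_ordWeight (hV : V ≠ 0) (hn : n ≠ 0) {σ : F}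
    (hσ : (V - V⁻¹) * σ = V - 1) (m : Fin (2 * n)) :
    (V - V⁻¹) * ∑ x, (V ^ barD n x) ^ 2 * ordWeight σ x m =
      V ^ (2 * (n : ℤ) - 1) + (V - V⁻¹) * ordWeight σ (prm n m) m - (V ^ barD n m) ^ 2 := by
  have h (x : Fin (2 * n)) : (V ^ barD n x) ^ 2 * ordWeight σ x m =
      (if (x : ℕ) < m then (V ^ barNat n x) ^ 2 else 0)
        + if x = m then (V ^ barD n x) ^ 2 * σ else 0 := by
    rcases lt_trichotomy x m with h | rfl | h
    · simp [ordWeight_of_lt h, Fin.lt_def.1 h, h.ne, barD_eq]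
    · simp
    · simp [ordWeight_of_gt h, (Fin.lt_def.1 h).not_gt, h.ne']
  have h' : ∑ x : Fin (2 * n), (if (x : ℕ) < m then (V ^ barNat n x) ^ 2 else 0) =
      ∑ x ∈ Finset.range m, (V ^ barNat n x) ^ 2 := by
    rw [Fin.sum_univ_eq_sum_range (fun x => if x < m then (V ^ barNat n x) ^ 2 else 0),
      ← Finset.sum_filter]
    congr 1
    ext x
    simp only [Finset.mem_filter, Finset.mem_range]
    omega
  have h'' : ordWeight σ (prm n m) m = if n ≤ (m : ℕ) then 1 else 0 := by
    have hm := m.isLt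
    split_ifs with hnm
    · exact ordWeight_of_lt (by simp only [prm, Fin.lt_def]; omega)
    · exact ordWeight_of_gt (by simp only [prm, Fin.lt_def]; omega)
  simp only [h, Finset.sum_add_distrib, h', Finset.sum_ite_eq', Finset.mem_univ, if_true, mul_add,
    sum_range_zpow_barNat n hV hn, h'', mul_ite, mul_one, mul_zero]
  rw [barD_eq]
  linear_combination (V ^ barNat n m) ^ 2 * hσ

theorem sum_zpow_barD (hV : V ≠ 0) (hn : n ≠ 0) {ξ : F} (hξ : ξ = V ^ (2 - 2 * (n : ℤ))) :
    (V - V⁻¹) * ∑ x, (V ^ barD n x) ^ 2 =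
      (V - V⁻¹) * (1 + ξ) - V ^ (2 * (n : ℤ) - 1) * (ξ ^ 2 - 1) := by
  simp only [barD_eq]
  rw [Fin.sum_univ_eq_sum_range (fun x => (V ^ barNat n x) ^ 2), sum_range_zpow_barNat n hV hn,
    if_pos (by omega), show barNat n (2 * n) = -n by
      rw [barNat, if_neg (by omega)]; push_cast; ring, hξ, zpow_sub₀ hV, zpow_sub₀ hV, zpow_neg,
    two_mul (n : ℤ), zpow_add₀ hV, zpow_one, zpow_two]
  have := zpow_ne_zero n hV
  field_simp
  ring

end Sums

section Products

variable {n : ℕ} (A B C : MT n) (i j k i' j' k' : Fin (2 * n))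

theorem X12_mul_X13_mul_X23_apply :
    (X12 n A * X13 n B * X23 n C) (i, j, k) (i', j', k') =
      ∑ x, ∑ y, A (i, j) (x, y) * ∑ z, B (x, k) (i', z) * C (y, z) (j', k') := by
  rw [Matrix.mul_assoc]
  simp [Matrix.mul_apply, Fintype.sum_prod_type, X12, X13, X23]

theorem X23_mul_X13_mul_X12_apply :
    (X23 n C * X13 n B * X12 n A) (i, j, k) (i', j', k') =
      ∑ x, ∑ y, A (x, y) (i', j') * ∑ z, B (i, z) (x, k') * C (j, k) (y, z) := by
  simp [Matrix.mul_apply, Fintype.sum_prod_type, X12, X13, X23]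
  simp only [mul_comm (A _ _), mul_comm (B _ _)]

end Products

section Assembly

variable {n : ℕ}

theorem barWeight_eq (a : Fin (2 * n)) : barWeight n a = cT vv ^ barD n a := cT_zpow ..

theorem sum_barWeight_mul_ordWeight (hn : n ≠ 0) (m : Fin (2 * n)) :
    (cT vv - cT vv⁻¹) * ∑ x, barWeight n x ^ 2 * ordWeight (cT vv / (cT vv + 1)) x m =
      cT vv ^ (2 * (n : ℤ) - 1)
        + (cT vv - cT vv⁻¹) * ordWeight (cT vv / (cT vv + 1)) (prm n m) m
        - barWeight n m ^ 2 := by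
  simp only [barWeight_eq, cT_inv]
  exact sum_zpow_barD_mul_ordWeight n cT_vv_ne_zero hn sub_inv_mul_div_add_one m

theorem sum_barWeight (hn : n ≠ 0) :
    (cT vv - cT vv⁻¹) * ∑ x, barWeight n x ^ 2 =
      (cT vv - cT vv⁻¹) * (1 + xiD n) - cT vv ^ (2 * (n : ℤ) - 1) * (xiD n ^ 2 - 1) := by
  simp only [barWeight_eq, cT_inv]
  exact sum_zpow_barD n cT_vv_ne_zero hn (cT_zpow ..)

theorem sum_mul_sum_smul {ι F : Type*} [Fintype ι] [Field F] (s₁ s₂ s₃ : F) (A : ι → ι → F)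
    (B C : ι → ι → ι → F) :
    ∑ x, ∑ y, s₁ * A x y * ∑ z, s₂ * B x y z * (s₃ * C x y z) =
      s₁ * s₂ * s₃ * ∑ x, ∑ y, A x y * ∑ z, B x y z * C x y z := by
  simp only [Finset.mul_sum]
  refine Finset.sum_congr rfl fun x _ => Finset.sum_congr rfl fun y _ =>
    Finset.sum_congr rfl fun z _ => ?_
  ring

end Assembly

/-- **Yang–Baxter equation for the trigonometric `R`-matrix of type `D_n`**:
`R̄₁₂(z) R̄₁₃(zw) R̄₂₃(w) = R̄₂₃(w) R̄₁₃(zw) R̄₁₂(z)` over `𝕂 = ℚ(v)(z,w)`. -/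
theorem yang_baxter_typeD (n : ℕ) (hn : 2 ≤ n) :
    X12 n (Rbar n zz) * X13 n (Rbar n (zz * ww)) * X23 n (Rbar n ww) =
      X23 n (Rbar n ww) * X13 n (Rbar n (zz * ww)) * X12 n (Rbar n zz) := by
  have hv := cT_vv_ne_zero
  have hσ := sub_inv_mul_div_add_one
  have h₁ : (cT vv - cT vv⁻¹) * (2 * (cT vv / (cT vv + 1)) - 1) = cT vv + (cT vv)⁻¹ - 2 := by
    rw [cT_inv]
    linear_combination 2 * hσ
  have h₂ : (cT vv - cT vv⁻¹) ^ 2 * (cT vv / (cT vv + 1) * (1 - cT vv / (cT vv + 1))) =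
      cT vv + (cT vv)⁻¹ - 2 := by
    rw [cT_inv]
    have h₀ : cT vv * (cT vv)⁻¹ = 1 := mul_inv_cancel₀ hv
    have e : (cT vv - (cT vv)⁻¹) * (1 - cT vv / (cT vv + 1)) = 1 - (cT vv)⁻¹ := by
      linear_combination -hσ
    linear_combination (cT vv - (cT vv)⁻¹) * (1 - cT vv / (cT vv + 1)) * hσ + (cT vv - 1) * e - h₀
  have hn' : n ≠ 0 := by omega
  have hone : (1 : KT) = cT 1 := (map_one (algebraMap KK KT)).symm
  have z₁ : zz ≠ 1 := hone ▸ zz_ne_cT 1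
  have w₁ : ww ≠ 1 := hone ▸ ww_ne_cT 1
  have zw₁ : zz * ww ≠ 1 := hone ▸ zz_mul_ww_ne_cT 1
  have zξ : zz ≠ xiD n := zz_ne_cT _
  have wξ : ww ≠ xiD n := ww_ne_cT _
  have zwξ : zz * ww ≠ xiD n := zz_mul_ww_ne_cT _
  ext ⟨i, j, k⟩ ⟨i', j', k'⟩
  have main := sum_crossing_eq (isReversal_prm n) (barWeight_mul_prm n)
    (by rw [cT_inv]; exact cT_vv_sub_inv_ne_zero) h₁ h₂ (isSpectral z₁ w₁ zw₁ zξ wξ zwξ)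
    (sum_barWeight_mul_ordWeight hn') (sum_barWeight hn') i j k i' j' k'
  rw [X12_mul_X13_mul_X23_apply, X23_mul_X13_mul_X12_apply]
  simp only [Rbar_apply z₁ zξ, Rbar_apply w₁ wξ, Rbar_apply zw₁ zwξ]
  rw [sum_mul_sum_smul _ _ _ (fun x y => crossing _ _ _ _ _ _ i j x y),
    sum_mul_sum_smul _ _ _ (fun x y => crossing _ _ _ _ _ _ x y i' j'), main]
end
end
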